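/- arXiv:1911.10507 — 3 statements merged into one kernel-verified Lean document; each statement's English description precedes it below -/
import Mathlib

section
/- Let n ≥ 2 and let f : S^n → (0,∞) be a positive Lipschitz function, extended to ℝ^{n+1}\{0} as a function homogeneous of degree −1. Let u : ℝ^{n+1} → ℝ be continuous, homogeneous of degree 1, of class C² on ℝ^{n+1}\{0}, and satisfy Δu = f on ℝ^{n+1}\{0}. Then u is convex on ℝ^{n+1} if and only if for all x, ξ ∈ S^n with ⟨ξ, x⟩ = 0, ∫_{S^n} ω(x,z) ⟨ξ, z⟩ ⟨∇f(z), ξ⟩ dσ(z) ≥ 0, where ω(x,z) = −∫_0^∞ r^{n−1} / |x − r z|^{n+1} dr, ∇f is the (almost everywhere defined) gradient of the degree −1 homogeneous extension of f, and the integral over S^n is absolutely convergent. -/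
open MeasureTheory Metric Set
open scoped RealInnerProductSpace

/-- The Euclidean Laplacian of `u : ℝ^m → ℝ`, as the sum of second partial
derivatives along the standard coordinate directions. -/
noncomputable def laplacian {m : ℕ} (u : EuclideanSpace ℝ (Fin m) → ℝ)
    (x : EuclideanSpace ℝ (Fin m)) : ℝ :=
  ∑ i, fderiv ℝ (fun y => fderiv ℝ u y (EuclideanSpace.single i 1)) x (EuclideanSpace.single i 1)

/-- The surface measure on the unit sphere `Sⁿ ⊂ ℝ^{n+1}`. -/
noncomputable def sphereMeasure (n : ℕ) :
    Measure (sphere (0 : EuclideanSpace ℝ (Fin (n + 1))) 1) :=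
  (volume : Measure (EuclideanSpace ℝ (Fin (n + 1)))).toSphere

/-- The kernel `ω(x,z) = -∫₀^∞ r^{n-1}/|x - rz|^{n+1} dr`. -/
noncomputable def omegaKer (n : ℕ) (x z : EuclideanSpace ℝ (Fin (n + 1))) : ℝ :=
  -∫ r in Set.Ioi (0 : ℝ), r ^ (n - 1) / ‖x - r • z‖ ^ (n + 1)

open Filter Topology

section Radial
variable {E : Type*} [NormedAddCommGroup E] [InnerProductSpace ℝ E] [FiniteDimensional ℝ E]
  [MeasurableSpace E] [BorelSpace E]

theorem integrable_radial_of_le {n : ℕ} (hE : Module.finrank ℝ E = n + 1) {ρ : ℝ → ℝ}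
    (hρ : Measurable ρ) (h : ∀ r, 0 < r → r ^ n * |ρ r| ≤ ((1 + r) ^ 2)⁻¹) :
    Integrable (fun y : E => ρ ‖y‖) := by
  have : Nontrivial E := Module.nontrivial_of_finrank_pos (R := ℝ) (by omega)
  rw [integrable_fun_norm_addHaar (μ := (volume : Measure E)) (f := ρ), hE]
  have hJ : Integrable (fun r : ℝ => (1 + ‖r‖) ^ (-(2 : ℝ))) :=
    integrable_one_add_norm (by simp)
  refine Integrable.mono' (hJ.integrableOn (s := Ioi 0)) (by fun_prop) ?_
  filter_upwards [ae_restrict_mem measurableSet_Ioi] with r hr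
  have hr : 0 < r := hr
  rw [smul_eq_mul, norm_mul, Real.norm_of_nonneg (by positivity), Real.norm_eq_abs,
    Real.norm_of_nonneg hr.le, Real.rpow_neg (by positivity)]
  exact_mod_cast h r hr

/-- The function `|y|⁻² (1 + |y|)⁻ⁿ` dominates the integrands in the integrations by parts. -/
theorem integrable_inv_sq_mul_inv_one_add_pow {n : ℕ} (hn : 2 ≤ n)
    (hE : Module.finrank ℝ E = n + 1) :
    Integrable (fun y : E => (‖y‖ ^ 2)⁻¹ * ((1 + ‖y‖) ^ n)⁻¹) := by
  refine integrable_radial_of_le hE (ρ := fun r => (r ^ 2)⁻¹ * ((1 + r) ^ n)⁻¹)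
    (by fun_prop) fun r hr => ?_
  obtain ⟨m, rfl⟩ := Nat.exists_eq_add_of_le hn
  rw [abs_of_nonneg (by positivity)]
  have h1 : r ^ m ≤ (1 + r) ^ m := pow_le_pow_left₀ hr.le (by linarith) _
  have h2 : r ^ (2 + m) * ((r ^ 2)⁻¹ * ((1 + r) ^ (2 + m))⁻¹) =
      r ^ m / (1 + r) ^ m * ((1 + r) ^ 2)⁻¹ := by
    rw [pow_add, pow_add]; field_simp
  rw [h2]
  exact mul_le_of_le_one_left (by positivity) (div_le_one_of_le₀ h1 (by positivity))

theorem integrable_inv_pow_mul_inv_one_add_sq {n : ℕ}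
    (hE : Module.finrank ℝ E = n + 1) :
    Integrable (fun y : E => (‖y‖ ^ n)⁻¹ * ((1 + ‖y‖) ^ 2)⁻¹) := by
  refine integrable_radial_of_le hE (ρ := fun r => (r ^ n)⁻¹ * ((1 + r) ^ 2)⁻¹)
    (by fun_prop) fun r hr => ?_
  rw [abs_of_nonneg (by positivity), mul_inv_cancel_left₀ (by positivity)]

theorem integrable_inv_sq_mul_inv_norm_sub_pow {n : ℕ} (hn : 2 ≤ n)
    (hE : Module.finrank ℝ E = n + 1) {x : E} (hx : ‖x‖ = 1) :
    Integrable (fun y : E => (‖y‖ ^ 2)⁻¹ * (‖y - x‖ ^ n)⁻¹) := by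
  have hA := (integrable_inv_sq_mul_inv_one_add_pow hn hE).const_mul (3 ^ n)
  have hB := ((integrable_inv_pow_mul_inv_one_add_sq hE).comp_sub_right x).const_mul 25
  refine (hA.add hB).mono' (by fun_prop) (Eventually.of_forall fun y => ?_)
  rw [Real.norm_of_nonneg (by positivity)]
  simp only [Pi.add_apply]
  have hxy : ‖x‖ ≤ ‖y‖ + ‖y - x‖ := by
    have := norm_sub_le y (y - x); simpa using this
  have hyx : ‖y - x‖ ≤ ‖y‖ + ‖x‖ := norm_sub_le y x
  rcases le_total ‖y‖ (1 / 2) with h | h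
  · refine le_add_of_le_of_nonneg ?_ (by positivity)
    have h1 : 1 + ‖y‖ ≤ 3 * ‖y - x‖ := by linarith
    have h2 : (‖y - x‖ ^ n)⁻¹ ≤ 3 ^ n * ((1 + ‖y‖) ^ n)⁻¹ := by
      have h3 := pow_le_pow_left₀ (by positivity) h1 n
      rw [mul_pow] at h3
      have : 0 < ‖y - x‖ := by linarith
      rw [← div_eq_mul_inv, le_div_iff₀ (by positivity), inv_mul_le_iff₀ (by positivity)]
      linarith
    calc _ ≤ (‖y‖ ^ 2)⁻¹ * (3 ^ n * ((1 + ‖y‖) ^ n)⁻¹) := by gcongr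
      _ = _ := by ring
  · refine le_add_of_nonneg_of_le (by positivity) ?_
    have h1 : 1 + ‖y - x‖ ≤ 5 * ‖y‖ := by linarith
    have h2 : (‖y‖ ^ 2)⁻¹ ≤ 25 * ((1 + ‖y - x‖) ^ 2)⁻¹ := by
      have h3 := pow_le_pow_left₀ (by positivity) h1 2
      have : 0 < ‖y‖ := by linarith
      rw [← div_eq_mul_inv, le_div_iff₀ (by positivity), inv_mul_le_iff₀ (by positivity)]
      linarith
    calc _ ≤ 25 * ((1 + ‖y - x‖) ^ 2)⁻¹ * (‖y - x‖ ^ n)⁻¹ := by gcongr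
      _ = _ := by ring

end Radial

section Cutoff
variable {E : Type*} [NormedAddCommGroup E] [InnerProductSpace ℝ E] [FiniteDimensional ℝ E]

theorem exists_cutoff_sequence : ∃ (M : ℝ) (χ : ℕ → E → ℝ), (∀ k, ContDiff ℝ 2 (χ k)) ∧
    (∀ k, HasCompactSupport (χ k)) ∧ (∀ k, χ k =ᶠ[𝓝 0] 0) ∧ (∀ k y, |χ k y| ≤ 1) ∧
    (∀ k y, ‖fderiv ℝ (χ k) y‖ * ‖y‖ ≤ M) ∧ ∀ y, y ≠ 0 → ∀ᶠ k in atTop, χ k =ᶠ[𝓝 y] 1 := by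
  let η : ContDiffBump (0 : E) := ⟨1, 2, one_pos, one_lt_two⟩
  have hη : ContDiff ℝ 2 η := η.contDiff
  have hdη : Differentiable ℝ η := hη.differentiable (by norm_num)
  obtain ⟨M, hM⟩ : ∃ M, ∀ z, ‖‖z‖ • fderiv ℝ η z‖ ≤ M := by
    have h1 : Continuous fun z => ‖z‖ • fderiv ℝ η z :=
      continuous_norm.smul (hη.continuous_fderiv (by norm_num))
    have h2 : HasCompactSupport fun z => ‖z‖ • fderiv ℝ η z :=
      HasCompactSupport.smul_left (f := fun z : E => ‖z‖) (η.hasCompactSupport.fderiv ℝ)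
    exact h1.bounded_above_of_compact_support h2
  have hscale : ∀ (c : ℝ) (y : E), ‖fderiv ℝ (fun y => η (c • y)) y‖ * ‖y‖ ≤ M := fun c y => by
    have h := hM (c • y)
    have : fderiv ℝ (fun y => η (c • y)) y = c • fderiv ℝ η (c • y) := fderiv_comp_smul ..
    rw [this]
    rw [norm_smul, norm_norm, norm_smul] at *
    linarith
  have hcd : ∀ c : ℝ, ContDiff ℝ 2 fun y => η (c • y) := fun c => hη.comp (contDiff_const_smul c)
  have hone : ∀ (c : ℝ) (y : E), ‖c • y‖ < 1 → ∀ᶠ w in 𝓝 y, η (c • w) = 1 := fun c y h => by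
    have : Tendsto (fun w : E => ‖c • w‖) (𝓝 y) (𝓝 ‖c • y‖) :=
      (by fun_prop : Continuous fun w : E => ‖c • w‖).tendsto y
    filter_upwards [this.eventually (gt_mem_nhds h)] with w hw
    exact η.one_of_mem_closedBall (by simpa [η] using hw.le)
  have hzero : ∀ (c : ℝ) (y : E), 2 < ‖c • y‖ → ∀ᶠ w in 𝓝 y, η (c • w) = 0 := fun c y h => by
    have : Tendsto (fun w : E => ‖c • w‖) (𝓝 y) (𝓝 ‖c • y‖) :=
      (by fun_prop : Continuous fun w : E => ‖c • w‖).tendsto y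
    filter_upwards [this.eventually (lt_mem_nhds h)] with w hw
    exact η.zero_of_le_dist (by simpa [η] using hw.le)
  have habs : ∀ z, |η z| ≤ 1 := fun z => by rw [abs_of_nonneg η.nonneg]; exact η.le_one
  have habs' : ∀ z, |1 - η z| ≤ 1 := fun z => by
    rw [abs_of_nonneg (by linarith [η.le_one (x := z)])]; linarith [η.nonneg (x := z)]
  refine ⟨M + M, fun k y => η (((k : ℝ) + 1)⁻¹ • y) * (1 - η (((k : ℝ) + 1) • y)),
    fun k => (hcd _).mul (contDiff_const.sub (hcd _)), fun k => ?_, fun k => ?_, fun k y => ?_,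
    fun k y => ?_, fun y hy => ?_⟩
  · refine HasCompactSupport.mul_right ?_
    have hk : ((k : ℝ) + 1)⁻¹ ≠ 0 := by positivity
    exact η.hasCompactSupport.comp_homeomorph (Homeomorph.smulOfNeZero _ hk)
  · filter_upwards [hone ((k : ℝ) + 1) 0 (by simp)] with w hw
    simp [hw]
  · rw [abs_mul]
    exact mul_le_one₀ (habs _) (abs_nonneg _) (habs' _)
  · have h1 := ((hcd ((k : ℝ) + 1)⁻¹).differentiable (by norm_num)) y
    have h2 := ((hcd ((k : ℝ) + 1)).differentiable (by norm_num)) y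
    rw [fderiv_fun_mul h1 (h2.const_sub 1), fderiv_const_sub]
    have e1 := hscale ((k : ℝ) + 1)⁻¹ y
    have e2 := hscale ((k : ℝ) + 1) y
    set A := fderiv ℝ (fun y => η (((k : ℝ) + 1)⁻¹ • y)) y
    set B := fderiv ℝ (fun y => η (((k : ℝ) + 1) • y)) y
    have e3 : ‖η (((k : ℝ) + 1)⁻¹ • y) • -B‖ ≤ ‖B‖ := by
      rw [norm_smul, norm_neg]; exact mul_le_of_le_one_left (norm_nonneg _) (habs _)
    have e4 : ‖(1 - η (((k : ℝ) + 1) • y)) • A‖ ≤ ‖A‖ := by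
      rw [norm_smul]; exact mul_le_of_le_one_left (norm_nonneg _) (habs' _)
    calc _ ≤ (‖B‖ + ‖A‖) * ‖y‖ := by
            gcongr; exact (norm_add_le _ _).trans (add_le_add e3 e4)
      _ ≤ _ := by linarith
  · have hy' : 0 < ‖y‖ := norm_pos_iff.2 hy
    filter_upwards [eventually_gt_atTop ⌈‖y‖⌉₊, eventually_gt_atTop ⌈2 * ‖y‖⁻¹⌉₊] with k hk hk'
    have a1 : ‖y‖ < k := Nat.lt_of_ceil_lt hk
    have a2 : 2 * ‖y‖⁻¹ < k := Nat.lt_of_ceil_lt hk'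
    have hk0 : (0 : ℝ) < k + 1 := by positivity
    filter_upwards [hone ((k : ℝ) + 1)⁻¹ y (by
      rw [norm_smul, norm_inv, Real.norm_of_nonneg hk0.le, inv_mul_lt_iff₀ hk0]; linarith),
      hzero ((k : ℝ) + 1) y (by
        rw [norm_smul, Real.norm_of_nonneg hk0.le]
        rw [← div_eq_mul_inv, div_lt_iff₀ hy'] at a2
        nlinarith)] with w hw hw'
    simp [hw, hw']

variable [MeasurableSpace E] [BorelSpace E]

/-- A first-order integral identity valid for test functions supported away from the origin
extends to functions with suitable decay at infinity. -/
theorem integral_eq_zero_of_forall_hasCompactSupport {n : ℕ} (hn : 2 ≤ n)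
    (hE : Module.finrank ℝ E = n + 1) {α : E → E} {β : E → ℝ}
    (hα : AEStronglyMeasurable α) (hβ : AEStronglyMeasurable β) {C : ℝ}
    (hαC : ∀ y, y ≠ 0 → ‖α y‖ ≤ C * ‖y‖⁻¹) (hβC : ∀ y, y ≠ 0 → |β y| ≤ C * (‖y‖ ^ 2)⁻¹)
    (h : ∀ φ : E → ℝ, ContDiff ℝ 2 φ → HasCompactSupport φ → φ =ᶠ[𝓝 0] 0 →
      ∫ y, (fderiv ℝ φ y (α y) + β y * φ y) = 0)
    {ψ : E → ℝ} (hψ : ContDiff ℝ 2 ψ) {C' : ℝ}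
    (hψ0 : ∀ y, |ψ y| ≤ C' * ((1 + ‖y‖) ^ n)⁻¹)
    (hψ1 : ∀ y, ‖fderiv ℝ ψ y‖ ≤ C' * ((1 + ‖y‖) ^ (n + 1))⁻¹) :
    ∫ y, (fderiv ℝ ψ y (α y) + β y * ψ y) = 0 := by
  have : Nontrivial E := Module.nontrivial_of_finrank_pos (R := ℝ) (by omega)
  obtain ⟨M, χ, hχ, hχc, hχ0, hχ1, hχM, hχlim⟩ := exists_cutoff_sequence (E := E)
  have hae : ∀ᵐ y : E, y ≠ 0 := by simp [ae_iff]
  have hC : 0 ≤ C := by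
    obtain ⟨y, hy⟩ := exists_ne (0 : E)
    exact nonneg_of_mul_nonneg_left ((norm_nonneg _).trans (hαC y hy))
      (inv_pos.2 (norm_pos_iff.2 hy))
  have hC' : 0 ≤ C' := nonneg_of_mul_nonneg_left ((abs_nonneg _).trans (hψ0 0)) (by simp)
  have hlim : Tendsto (fun k => ∫ y, (fderiv ℝ (fun y => χ k y * ψ y) y (α y)
      + β y * (χ k y * ψ y))) atTop (𝓝 (∫ y, (fderiv ℝ ψ y (α y) + β y * ψ y))) := by
    refine tendsto_integral_of_dominated_convergence
      (fun y => (C * C' * (2 + M)) * ((‖y‖ ^ 2)⁻¹ * ((1 + ‖y‖) ^ n)⁻¹)) (fun k => ?_)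
      ((integrable_inv_sq_mul_inv_one_add_pow hn hE).const_mul _) (fun k => ?_) ?_
    · have hc : ContDiff ℝ 2 (fun y => χ k y * ψ y) := (hχ k).mul hψ
      have hc' := (hc.continuous_fderiv (by norm_num)).aestronglyMeasurable (μ := volume)
      refine AEStronglyMeasurable.add ?_ (hβ.mul hc.continuous.aestronglyMeasurable)
      exact isBoundedBilinearMap_apply.continuous.comp_aestronglyMeasurable (hc'.prodMk hα)
    · filter_upwards [hae] with y hy
      have hy' : 0 < ‖y‖ := norm_pos_iff.2 hy
      have d1 := ((hχ k).differentiable (by norm_num)) y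
      have d2 := (hψ.differentiable (by norm_num)) y
      rw [fderiv_fun_mul d1 d2]
      have b1 : ‖fderiv ℝ (χ k) y‖ ≤ M * ‖y‖⁻¹ := by
        rw [← div_eq_mul_inv, le_div_iff₀ hy']; exact hχM k y
      have hM : 0 ≤ M := (mul_nonneg (norm_nonneg _) (norm_nonneg _)).trans (hχM k y)
      have b2 : ‖fderiv ℝ ψ y‖ ≤ C' * (((1 + ‖y‖) ^ n)⁻¹ * ‖y‖⁻¹) := by
        refine (hψ1 y).trans ?_
        rw [pow_succ, mul_inv]
        gcongr
        linarith
      have b3 := hψ0 y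
      have b4 : ‖χ k y • fderiv ℝ ψ y + ψ y • fderiv ℝ (χ k) y‖ ≤
          1 * (C' * (((1 + ‖y‖) ^ n)⁻¹ * ‖y‖⁻¹)) + C' * ((1 + ‖y‖) ^ n)⁻¹ * (M * ‖y‖⁻¹) := by
        refine (norm_add_le _ _).trans ?_
        rw [norm_smul, norm_smul, Real.norm_eq_abs, Real.norm_eq_abs]
        gcongr
        exact hχ1 k y
      have b5 : |χ k y * ψ y| ≤ 1 * (C' * ((1 + ‖y‖) ^ n)⁻¹) := by
        rw [abs_mul]
        gcongr
        exact hχ1 k y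
      calc _ ≤ ‖χ k y • fderiv ℝ ψ y + ψ y • fderiv ℝ (χ k) y‖ * ‖α y‖
            + |β y| * |χ k y * ψ y| := by
            refine (norm_add_le _ _).trans ?_
            rw [norm_mul, Real.norm_eq_abs, Real.norm_eq_abs]
            gcongr
            · exact (χ k y • fderiv ℝ ψ y + ψ y • fderiv ℝ (χ k) y).le_opNorm (α y)
            · exact le_rfl
        _ ≤ (1 * (C' * (((1 + ‖y‖) ^ n)⁻¹ * ‖y‖⁻¹)) + C' * ((1 + ‖y‖) ^ n)⁻¹ * (M * ‖y‖⁻¹))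
            * (C * ‖y‖⁻¹) + (C * (‖y‖ ^ 2)⁻¹) * (1 * (C' * ((1 + ‖y‖) ^ n)⁻¹)) := by
            gcongr
            · exact hαC y hy
            · exact hβC y hy
        _ = _ := by field_simp; ring
    · filter_upwards [hae] with y hy
      refine tendsto_const_nhds.congr' ?_
      filter_upwards [hχlim y hy] with k hk
      have e : (fun y => χ k y * ψ y) =ᶠ[𝓝 y] ψ := by
        filter_upwards [hk] with w hw
        simp [hw]
      rw [e.fderiv_eq, hk.self_of_nhds]
      simp
  refine tendsto_nhds_unique hlim ?_
  refine tendsto_const_nhds.congr fun k => (h _ ((hχ k).mul hψ) (hχc k).mul_right ?_).symm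
  filter_upwards [hχ0 k] with w hw
  simp [hw]

end Cutoff

section TestFunctions
variable {E : Type*} [NormedAddCommGroup E] [InnerProductSpace ℝ E] [FiniteDimensional ℝ E]
  [MeasurableSpace E] [BorelSpace E]

theorem integral_fderiv_eq_zero_of_hasCompactSupport {G : E → ℝ} (hG : ContDiff ℝ 1 G)
    (hc : HasCompactSupport G) (a : E) :
    Integrable (fun y => fderiv ℝ G y a) ∧ ∫ y, fderiv ℝ G y a = 0 := by
  have hi : Integrable (fun y => fderiv ℝ G y a) :=
    ((hG.continuous_fderiv (by norm_num)).clm_apply continuous_const).integrable_of_hasCompactSupport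
      (hc.fderiv_apply ℝ a)
  refine ⟨hi, ?_⟩
  have h := integral_mul_fderiv_eq_neg_fderiv_mul_of_integrable (μ := (volume : Measure E))
    (f := fun _ : E => (1 : ℝ)) (g := G) (v := a) (by simp) (by simpa using hi)
    (by simpa using hG.continuous.integrable_of_hasCompactSupport hc) (by simp)
    (fun x _ => hG.differentiable (by norm_num) x)
  simpa using h

theorem integral_fderiv_apply_swap {w φ : E → ℝ} (hw : ContDiffOn ℝ 1 w {0}ᶜ)
    (hφ : ContDiff ℝ 2 φ) (hc : HasCompactSupport φ) (h0 : φ =ᶠ[𝓝 0] 0) (a b : E) :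
    ∫ y, fderiv ℝ φ y (fderiv ℝ w y a • b - fderiv ℝ w y b • a) = 0 := by
  have hφ' : ContDiff ℝ 1 (fderiv ℝ φ) := hφ.fderiv_right (by norm_num)
  have hwat : ∀ y, y ≠ 0 → ContDiffAt ℝ 1 w y := fun y hy =>
    (hw y hy).contDiffAt (isOpen_compl_singleton.mem_nhds hy)
  have h0' : fderiv ℝ φ =ᶠ[𝓝 0] 0 := by
    have h := h0.fderiv (𝕜 := ℝ)
    refine h.trans (Eventually.of_forall fun y => ?_)
    simp [show (0 : E → ℝ) = fun _ => 0 from rfl]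
  have hφat : ∀ b y, DifferentiableAt ℝ (fun y => fderiv ℝ φ y b) y := fun b y =>
    ((hφ'.clm_apply contDiff_const).differentiable (by norm_num)) y
  have hG : ∀ b, ContDiff ℝ 1 (fun y => w y * fderiv ℝ φ y b) := fun b => by
    rw [contDiff_iff_contDiffAt]
    intro y
    rcases eq_or_ne y 0 with rfl | hy
    · refine (contDiffAt_const (c := (0 : ℝ))).congr_of_eventuallyEq ?_
      filter_upwards [h0'] with z hz
      simp [hz]
    · exact (hwat y hy).mul (hφ'.contDiffAt.clm_apply contDiffAt_const)
  have hGc : ∀ b, HasCompactSupport (fun y => w y * fderiv ℝ φ y b) := fun b =>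
    (hc.fderiv_apply ℝ b).mul_left
  have hderiv : ∀ a b y, y ≠ 0 → fderiv ℝ (fun y => w y * fderiv ℝ φ y b) y a =
      w y * fderiv ℝ (fderiv ℝ φ) y a b + fderiv ℝ φ y b * fderiv ℝ w y a := fun a b y hy => by
    rw [fderiv_fun_mul ((hwat y hy).differentiableAt (by norm_num)) (hφat b y)]
    have : fderiv ℝ (fun y => fderiv ℝ φ y b) y a = fderiv ℝ (fderiv ℝ φ) y a b := by
      rw [fderiv_clm_apply (hφ'.differentiable (by norm_num) y) (by fun_prop)]
      simp
    simp [this]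
  obtain ⟨i1, e1⟩ := integral_fderiv_eq_zero_of_hasCompactSupport (hG b) (hGc b) a
  obtain ⟨i2, e2⟩ := integral_fderiv_eq_zero_of_hasCompactSupport (hG a) (hGc a) b
  have h3 := integral_sub i1 i2
  rw [e1, e2, sub_zero] at h3
  rw [← h3]
  refine integral_congr_ae (Eventually.of_forall fun y => ?_)
  beta_reduce
  rcases eq_or_ne y 0 with rfl | hy
  · have hz : ∀ b, fderiv ℝ (fun y => w y * fderiv ℝ φ y b) 0 = 0 := fun b => by
      have : (fun y => w y * fderiv ℝ φ y b) =ᶠ[𝓝 0] fun _ => 0 := by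
        filter_upwards [h0'] with z hz
        simp [hz]
      rw [this.fderiv_eq]; simp
    rw [hz, hz, h0'.self_of_nhds]
    simp
  · have hsymm : fderiv ℝ (fderiv ℝ φ) y a b = fderiv ℝ (fderiv ℝ φ) y b a :=
      (hφ.contDiffAt.isSymmSndFDerivAt (by simp)).eq a b
    rw [hderiv a b y hy, hderiv b a y hy, hsymm, map_sub, map_smul, map_smul]
    simp only [smul_eq_mul]
    ring

theorem integral_fderiv_mul_add_of_lipschitzOnWith {f φ : E → ℝ}
    (hf : ∀ δ > 0, ∃ L, LipschitzOnWith L f {y | δ ≤ ‖y‖})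
    (hφ : ContDiff ℝ 2 φ) (hc : HasCompactSupport φ) (h0 : φ =ᶠ[𝓝 0] 0) (ξ : E) :
    ∫ y, (fderiv ℝ φ y (f y • ξ) + fderiv ℝ f y ξ * φ y) = 0 := by
  obtain ⟨δ, hδ, hball⟩ := Metric.eventually_nhds_iff_ball.1 h0
  obtain ⟨L, hL⟩ := hf (δ / 2) (by positivity)
  obtain ⟨g, hg, hgf⟩ := hL.extend_real
  obtain ⟨D, hD⟩ := ContDiff.lipschitzWith_of_hasCompactSupport hc hφ (by norm_num)
  have key := LipschitzWith.integral_lineDeriv_mul_eq (μ := (volume : Measure E)) hg hD hc ξ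
  have i1 : Integrable (fun y => lineDeriv ℝ g y ξ * φ y) := by
    refine (hφ.continuous.integrable_of_hasCompactSupport hc).bdd_mul (c := L * ‖ξ‖)
      (measurable_lineDeriv hg.continuous).aestronglyMeasurable ?_
    exact Eventually.of_forall fun y => norm_lineDeriv_le_of_lipschitz ℝ hg
  have i2 : Integrable (fun y => fderiv ℝ φ y ξ * g y) :=
    ((((hφ.continuous_fderiv (by norm_num)).clm_apply continuous_const).mul
      hg.continuous)).integrable_of_hasCompactSupport (hc.fderiv_apply ℝ ξ).mul_right
  have e2 : ∫ y, lineDeriv ℝ φ y (-ξ) * g y = - ∫ y, fderiv ℝ φ y ξ * g y := by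
    rw [← integral_neg]
    refine integral_congr_ae (Eventually.of_forall fun y => ?_)
    simp [(hφ.differentiable (by norm_num) y).lineDeriv_eq_fderiv]
  rw [e2] at key
  have h3 := integral_add i2 i1
  rw [key, add_neg_cancel] at h3
  rw [← h3]
  refine integral_congr_ae ?_
  filter_upwards [hg.ae_differentiableAt (μ := (volume : Measure E))] with y hy
  rcases lt_or_ge ‖y‖ δ with hlt | hge
  · have e : φ =ᶠ[𝓝 y] fun _ => 0 := by
      filter_upwards [isOpen_ball.mem_nhds (mem_ball_zero_iff.2 hlt)] with z hz
      exact hball z hz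
    simp [e.fderiv_eq, e.self_of_nhds]
  · have e : f =ᶠ[𝓝 y] g := by
      have : ∀ᶠ z in 𝓝 y, δ / 2 < ‖z‖ :=
        continuous_norm.continuousAt.eventually (lt_mem_nhds (by linarith))
      filter_upwards [this] with z hz
      exact hgf hz.le
    rw [e.fderiv_eq, e.self_of_nhds, hy.lineDeriv_eq_fderiv]
    simp [mul_comm]

end TestFunctions

section Kernel
variable {E : Type*} [NormedAddCommGroup E]

/-- The regularised distance `√(|y - x|² + ε²)`. -/
noncomputable def regDist (ε : ℝ) (x y : E) : ℝ := √(‖y - x‖ ^ 2 + ε ^ 2)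

theorem regDist_sq (ε : ℝ) (x y : E) : regDist ε x y ^ 2 = ‖y - x‖ ^ 2 + ε ^ 2 :=
  Real.sq_sqrt (by positivity)

theorem regDist_pos {ε : ℝ} (hε : 0 < ε) (x y : E) : 0 < regDist ε x y :=
  Real.sqrt_pos.2 (by positivity)

theorem norm_sub_le_regDist (ε : ℝ) (x y : E) : ‖y - x‖ ≤ regDist ε x y :=
  Real.le_sqrt_of_sq_le (by nlinarith [sq_nonneg ε])

theorem le_regDist (ε : ℝ) (x y : E) : ε ≤ regDist ε x y :=
  Real.le_sqrt_of_sq_le (by nlinarith [sq_nonneg ‖y - x‖])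

theorem one_add_norm_le_mul_regDist {ε : ℝ} (hε : 0 < ε) (x y : E) :
    1 + ‖y‖ ≤ ((1 + ‖x‖) / ε + 1) * regDist ε x y := by
  have h1 : (1 + ‖x‖) ≤ (1 + ‖x‖) / ε * regDist ε x y := by
    rw [div_mul_eq_mul_div, le_div_iff₀ hε]
    gcongr
    exact le_regDist ε x y
  have h2 := norm_sub_le_regDist ε x y
  have h3 : ‖y‖ ≤ ‖y - x‖ + ‖x‖ := by simpa using norm_add_le (y - x) x
  linarith

variable [InnerProductSpace ℝ E]

/-- The `a`-derivative of a regularised fundamental solution of the Laplacian with pole `x` in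
dimension `n + 1`, up to a constant factor. -/
noncomputable def regKernel (n : ℕ) (ε : ℝ) (x a y : E) : ℝ :=
  ⟪y - x, a⟫ * (regDist ε x y ^ (n + 1))⁻¹

theorem contDiff_regDist {ε : ℝ} (hε : 0 < ε) (x : E) : ContDiff ℝ 2 (regDist ε x) := by
  refine ContDiff.sqrt ?_ fun y => by positivity
  exact ((contDiff_id.sub contDiff_const).norm_sq ℝ).add contDiff_const

theorem contDiff_regKernel (n : ℕ) {ε : ℝ} (hε : 0 < ε) (x a : E) :
    ContDiff ℝ 2 (regKernel n ε x a) := by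
  refine ContDiff.mul ?_ ?_
  · exact (contDiff_id.sub contDiff_const).inner ℝ contDiff_const
  · exact ((contDiff_regDist hε x).pow _).inv fun y => (pow_pos (regDist_pos hε x y) _).ne'

theorem fderiv_regKernel_apply (n : ℕ) {ε : ℝ} (hε : 0 < ε) (x a y b : E) :
    fderiv ℝ (regKernel n ε x a) y b = ⟪a, b⟫ * (regDist ε x y ^ (n + 1))⁻¹ -
      (n + 1) * (⟪y - x, a⟫ * ⟪y - x, b⟫) * (regDist ε x y ^ (n + 3))⁻¹ := by
  have hρ := regDist_pos hε x y
  have hsub : HasDerivAt (fun t : ℝ => y + t • b - x) b 0 := by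
    simpa using ((hasDerivAt_id (0 : ℝ)).smul_const b).const_add y |>.sub_const x
  have h1 : HasDerivAt (fun t : ℝ => ‖y + t • b - x‖ ^ 2) (2 * ⟪y - x, b⟫) 0 := by
    simpa using hsub.norm_sq
  have h2 : HasDerivAt (fun t : ℝ => regDist ε x (y + t • b)) (⟪y - x, b⟫ / regDist ε x y) 0 := by
    have := (h1.add_const (ε ^ 2)).sqrt (by simp; positivity)
    rw [zero_smul, add_zero, mul_div_mul_left _ _ two_ne_zero] at this
    exact this
  have h3 := (h2.fun_pow (n + 1)).fun_inv (by simpa using hρ.ne')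
  have h4 : HasDerivAt (fun t : ℝ => ⟪y + t • b - x, a⟫) ⟪b, a⟫ 0 := by
    simpa using hsub.inner ℝ (hasDerivAt_const (0 : ℝ) a)
  have h5 := h4.fun_mul h3
  have h6 : HasLineDerivAt ℝ (regKernel n ε x a) (fderiv ℝ (regKernel n ε x a) y b) y b :=
    (((contDiff_regKernel n hε x a).differentiable (by norm_num)) y).hasFDerivAt.hasLineDerivAt b
  rw [HasDerivAt.unique h6 h5, real_inner_comm b a]
  simp only [zero_smul, add_zero, Nat.cast_add, Nat.cast_one, Nat.add_sub_cancel]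
  field_simp
  ring

theorem abs_regKernel_le (n : ℕ) {ε : ℝ} (hε : 0 < ε) (x a y : E) :
    |regKernel n ε x a y| ≤ ‖a‖ * (regDist ε x y ^ n)⁻¹ := by
  have hρ := regDist_pos hε x y
  rw [regKernel, abs_mul, abs_of_pos (inv_pos.2 (pow_pos hρ _))]
  calc _ ≤ (regDist ε x y * ‖a‖) * (regDist ε x y ^ (n + 1))⁻¹ := by
        gcongr
        exact (abs_real_inner_le_norm _ _).trans (by gcongr; exact norm_sub_le_regDist ε x y)
    _ = _ := by field_simp; ring

theorem norm_fderiv_regKernel_le (n : ℕ) {ε : ℝ} (hε : 0 < ε) (x a y : E) :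
    ‖fderiv ℝ (regKernel n ε x a) y‖ ≤ (n + 2) * ‖a‖ * (regDist ε x y ^ (n + 1))⁻¹ := by
  have hρ := regDist_pos hε x y
  refine ContinuousLinearMap.opNorm_le_bound _ (by positivity) fun b => ?_
  rw [fderiv_regKernel_apply n hε, Real.norm_eq_abs]
  have h1 := abs_real_inner_le_norm (y - x) a
  have h2 := abs_real_inner_le_norm (y - x) b
  have h3 := norm_sub_le_regDist ε x y
  calc _ ≤ |⟪a, b⟫ * (regDist ε x y ^ (n + 1))⁻¹| +
          |(n + 1) * (⟪y - x, a⟫ * ⟪y - x, b⟫) * (regDist ε x y ^ (n + 3))⁻¹| := abs_sub _ _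
    _ ≤ ‖a‖ * ‖b‖ * (regDist ε x y ^ (n + 1))⁻¹ +
          (n + 1) * ((regDist ε x y * ‖a‖) * (regDist ε x y * ‖b‖)) *
            (regDist ε x y ^ (n + 3))⁻¹ := by
        rw [abs_mul, abs_mul, abs_mul, abs_mul, abs_of_pos (inv_pos.2 (pow_pos hρ (n + 1))),
          abs_of_pos (inv_pos.2 (pow_pos hρ (n + 3))), abs_of_pos (by positivity : (0 : ℝ) < n + 1)]
        gcongr
        · exact abs_real_inner_le_norm a b
        · exact h1.trans (by gcongr)
        · exact h2.trans (by gcongr)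
    _ = _ := by field_simp; ring

theorem exists_regKernel_decay (n : ℕ) {ε : ℝ} (hε : 0 < ε) (x a : E) :
    ∃ C, (∀ y, |regKernel n ε x a y| ≤ C * ((1 + ‖y‖) ^ n)⁻¹) ∧
      ∀ y, ‖fderiv ℝ (regKernel n ε x a) y‖ ≤ C * ((1 + ‖y‖) ^ (n + 1))⁻¹ := by
  set c := (1 + ‖x‖) / ε + 1
  have hc1 : 1 ≤ c := by simp only [c, le_add_iff_nonneg_left]; positivity
  have hinv : ∀ (y : E) (k : ℕ), (regDist ε x y ^ k)⁻¹ ≤ c ^ k * ((1 + ‖y‖) ^ k)⁻¹ := fun y k => by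
    have hρ := regDist_pos hε x y
    have h := pow_le_pow_left₀ (by positivity) (one_add_norm_le_mul_regDist hε x y) k
    rw [mul_pow] at h
    rw [← div_eq_mul_inv, le_div_iff₀ (by positivity), inv_mul_le_iff₀ (by positivity)]
    linarith
  refine ⟨(n + 2) * ‖a‖ * c ^ (n + 1), fun y => ?_, fun y => ?_⟩
  · calc _ ≤ ‖a‖ * (regDist ε x y ^ n)⁻¹ := abs_regKernel_le n hε x a y
      _ ≤ 1 * ‖a‖ * (c ^ n * ((1 + ‖y‖) ^ n)⁻¹) := by rw [one_mul]; gcongr; exact hinv y n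
      _ ≤ (n + 2) * ‖a‖ * (c ^ (n + 1) * ((1 + ‖y‖) ^ n)⁻¹) := by
        gcongr
        · linarith [(Nat.cast_nonneg n : (0 : ℝ) ≤ n)]
        · omega
      _ = _ := by ring
  · calc _ ≤ (n + 2) * ‖a‖ * (regDist ε x y ^ (n + 1))⁻¹ := norm_fderiv_regKernel_le n hε x a y
      _ ≤ (n + 2) * ‖a‖ * (c ^ (n + 1) * ((1 + ‖y‖) ^ (n + 1))⁻¹) := by
        gcongr; exact hinv y (n + 1)
      _ = _ := by ring

end Kernel

section Homogeneous
variable {E : Type*} [NormedAddCommGroup E] [NormedSpace ℝ E]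

theorem fderiv_smul_of_homogeneous {G : E → ℝ} {t c : ℝ} (ht : 0 < t)
    (hG : ∀ z, z ≠ 0 → G (t • z) = c * G z) {y : E} (hy : y ≠ 0) :
    fderiv ℝ G (t • y) = (t⁻¹ * c) • fderiv ℝ G y := by
  have h1 : fderiv ℝ (fun z => G (t • z)) y = t • fderiv ℝ G (t • y) := fderiv_comp_smul ..
  have h2 : (fun z => G (t • z)) =ᶠ[𝓝 y] c • G := by
    filter_upwards [isOpen_compl_singleton.mem_nhds hy] with z hz
    exact hG z hz
  rw [h2.fderiv_eq, fderiv_const_smul_field, Pi.smul_apply] at h1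
  rw [mul_smul, h1, smul_smul, inv_mul_cancel₀ ht.ne', one_smul]

theorem exists_norm_fderiv_le_of_homogeneous [FiniteDimensional ℝ E] {G : E → ℝ}
    (hG : ContDiffOn ℝ 1 G {0}ᶜ) (hhom : ∀ t : ℝ, 0 < t → ∀ y, y ≠ 0 → G (t • y) = G y) :
    ∃ C, ∀ y, y ≠ 0 → ‖fderiv ℝ G y‖ ≤ C * ‖y‖⁻¹ := by
  have hcont : ContinuousOn (fderiv ℝ G) (sphere 0 1) :=
    (hG.continuousOn_fderiv_of_isOpen isOpen_compl_singleton le_rfl).mono fun y hy => by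
      rintro rfl; simp at hy
  obtain ⟨C, hC⟩ := (isCompact_sphere (0 : E) 1).exists_bound_of_continuousOn hcont
  refine ⟨C, fun y hy => ?_⟩
  have hy' : 0 < ‖y‖ := norm_pos_iff.2 hy
  have hz : ‖y‖⁻¹ • y ≠ 0 := smul_ne_zero (inv_ne_zero hy'.ne') hy
  have h := fderiv_smul_of_homogeneous (G := G) (c := 1) hy' (fun z hz => by simp [hhom _ hy' z hz]) hz
  rw [smul_smul, mul_inv_cancel₀ hy'.ne', one_smul] at h
  rw [h, norm_smul, mul_one, norm_inv, norm_norm, mul_comm]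
  gcongr
  exact hC _ (by simp [norm_smul, hy'.ne'])

end Homogeneous

section LipschitzHomogeneous
variable {E : Type*} [NormedAddCommGroup E] [NormedSpace ℝ E] {f : E → ℝ} {K : NNReal}

theorem exists_abs_le_of_lipschitzOnWith_sphere [FiniteDimensional ℝ E]
    (hf : LipschitzOnWith K f (sphere 0 1))
    (hhom : ∀ t : ℝ, 0 < t → ∀ y, y ≠ 0 → f (t • y) = t⁻¹ * f y) :
    ∃ C, 0 ≤ C ∧ ∀ y, y ≠ 0 → |f y| ≤ C * ‖y‖⁻¹ := by
  obtain ⟨C, hC⟩ := (isCompact_sphere (0 : E) 1).exists_bound_of_continuousOn hf.continuousOn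
  refine ⟨max C 0, le_max_right _ _, fun y hy => ?_⟩
  have hy' : 0 < ‖y‖ := norm_pos_iff.2 hy
  have hz : ‖y‖⁻¹ • y ≠ 0 := smul_ne_zero (inv_ne_zero hy'.ne') hy
  have h := hhom _ hy' _ hz
  rw [smul_smul, mul_inv_cancel₀ hy'.ne', one_smul] at h
  rw [h, abs_mul, abs_of_pos (inv_pos.2 hy'), mul_comm]
  gcongr
  exact (hC _ (by simp [norm_smul, hy'.ne'])).trans (le_max_left _ _)

theorem exists_lipschitzOnWith_of_homogeneous [FiniteDimensional ℝ E]
    (hf : LipschitzOnWith K f (sphere 0 1))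
    (hhom : ∀ t : ℝ, 0 < t → ∀ y, y ≠ 0 → f (t • y) = t⁻¹ * f y) :
    ∀ δ > 0, ∃ L, LipschitzOnWith L f {y | δ ≤ ‖y‖} := by
  intro δ hδ
  obtain ⟨C, hC0, hC⟩ := exists_abs_le_of_lipschitzOnWith_sphere hf hhom
  have hunit : ∀ y : E, δ ≤ ‖y‖ → f y = ‖y‖⁻¹ * f (‖y‖⁻¹ • y) := fun y hy => by
    have hy' : 0 < ‖y‖ := hδ.trans_le hy
    rw [← hhom _ hy' _ (smul_ne_zero (inv_ne_zero hy'.ne') (norm_pos_iff.1 hy')), smul_smul,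
      mul_inv_cancel₀ hy'.ne', one_smul]
  refine ⟨_, LipschitzOnWith.of_dist_le' (K := (C + 2 * K) / δ ^ 2) fun y hy z hz => ?_⟩
  have hy : δ ≤ ‖y‖ := hy
  have hz : δ ≤ ‖z‖ := hz
  have hy' : 0 < ‖y‖ := hδ.trans_le hy
  have hz' : 0 < ‖z‖ := hδ.trans_le hz
  have hnn : |‖z‖ - ‖y‖| ≤ ‖y - z‖ := by rw [norm_sub_rev]; exact abs_norm_sub_norm_le z y
  set p := ‖y‖⁻¹ • y
  set q := ‖z‖⁻¹ • z
  have hp : ‖p‖ = 1 := by simp [p, norm_smul, hy'.ne']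
  have hq : ‖q‖ = 1 := by simp [q, norm_smul, hz'.ne']
  have hzq : z = ‖z‖ • q := by simp [q, smul_smul, hz'.ne']
  have hinv : |‖y‖⁻¹ - ‖z‖⁻¹| ≤ ‖y - z‖ / (‖y‖ * ‖z‖) := by
    rw [inv_sub_inv hy'.ne' hz'.ne', abs_div, abs_of_pos (mul_pos hy' hz')]
    gcongr
  have hpq : ‖p - q‖ ≤ 2 * ‖y - z‖ / ‖y‖ := by
    have e : p - q = ‖y‖⁻¹ • ((y - z) + (‖z‖ - ‖y‖) • q) := by
      have : (‖z‖ - ‖y‖) • q = z - ‖y‖ • q := by rw [sub_smul, ← hzq]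
      rw [this, sub_add_sub_cancel, smul_sub, smul_smul, inv_mul_cancel₀ hy'.ne', one_smul]
    rw [e, norm_smul, norm_inv, norm_norm, inv_mul_eq_div]
    gcongr
    refine (norm_add_le _ _).trans ?_
    rw [norm_smul, hq, Real.norm_eq_abs]
    linarith
  have hfp : |f p| ≤ C := by
    have := hC p (norm_pos_iff.1 (by rw [hp]; norm_num))
    simpa [hp] using this
  have hfpq : |f p - f q| ≤ K * ‖p - q‖ := by
    have := hf.dist_le_mul p (by simp [hp]) q (by simp [hq])
    rwa [Real.dist_eq, dist_eq_norm] at this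
  rw [Real.dist_eq, dist_eq_norm, hunit y hy, hunit z hz]
  have e : ‖y‖⁻¹ * f p - ‖z‖⁻¹ * f q = (‖y‖⁻¹ - ‖z‖⁻¹) * f p + ‖z‖⁻¹ * (f p - f q) := by ring
  rw [e]
  calc _ ≤ |‖y‖⁻¹ - ‖z‖⁻¹| * |f p| + ‖z‖⁻¹ * |f p - f q| := by
        refine (abs_add_le _ _).trans ?_
        rw [abs_mul, abs_mul, abs_of_pos (inv_pos.2 hz')]
    _ ≤ ‖y - z‖ / (‖y‖ * ‖z‖) * C + ‖z‖⁻¹ * (K * (2 * ‖y - z‖ / ‖y‖)) := by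
        gcongr
        exact hfpq.trans (by gcongr)
    _ = (C + 2 * K) * ‖y - z‖ / (‖y‖ * ‖z‖) := by field_simp
    _ ≤ (C + 2 * K) * ‖y - z‖ / (δ * δ) := by gcongr
    _ = _ := by ring

theorem exists_norm_fderiv_le_of_lipschitzOnWith_sphere [FiniteDimensional ℝ E]
    (hf : LipschitzOnWith K f (sphere 0 1))
    (hhom : ∀ t : ℝ, 0 < t → ∀ y, y ≠ 0 → f (t • y) = t⁻¹ * f y) :
    ∃ C, ∀ y, y ≠ 0 → ‖fderiv ℝ f y‖ ≤ C * (‖y‖ ^ 2)⁻¹ := by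
  obtain ⟨L, hL⟩ := exists_lipschitzOnWith_of_homogeneous hf hhom (1 / 2) (by norm_num)
  refine ⟨L, fun y hy => ?_⟩
  have hy' : 0 < ‖y‖ := norm_pos_iff.2 hy
  have hz : ‖y‖⁻¹ • y ≠ 0 := smul_ne_zero (inv_ne_zero hy'.ne') hy
  have h := fderiv_smul_of_homogeneous hy' (hhom _ hy') hz
  rw [smul_smul, mul_inv_cancel₀ hy'.ne', one_smul] at h
  have hmem : {y : E | 1 / 2 ≤ ‖y‖} ∈ 𝓝 (‖y‖⁻¹ • y) := by
    have : ∀ᶠ z in 𝓝 (‖y‖⁻¹ • y), 1 / 2 < ‖z‖ :=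
      continuous_norm.continuousAt.eventually (lt_mem_nhds (by
        beta_reduce
        rw [norm_smul, norm_inv, norm_norm, inv_mul_cancel₀ hy'.ne']; norm_num))
    filter_upwards [this] with z hz using hz.le
  rw [h, norm_smul, norm_mul, norm_inv, norm_norm, mul_comm, ← mul_inv, ← sq]
  gcongr
  exact norm_fderiv_le_of_lipschitzOn ℝ hmem hL

end LipschitzHomogeneous

section Hessian
variable {E : Type*} [NormedAddCommGroup E] [NormedSpace ℝ E]

/-- The second derivative of `u` at `y`, first in direction `b` and then in direction `a`. -/
noncomputable def hess (u : E → ℝ) (y a b : E) : ℝ :=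
  fderiv ℝ (fun z => fderiv ℝ u z b) y a

variable {u : E → ℝ}

theorem contDiffOn_fderiv_apply (hu : ContDiffOn ℝ 2 u {0}ᶜ) (b : E) :
    ContDiffOn ℝ 1 (fun z => fderiv ℝ u z b) {0}ᶜ :=
  (hu.fderiv_of_isOpen isOpen_compl_singleton (by norm_num)).clm_apply contDiffOn_const

theorem contDiffAt_of_contDiffOn_compl {F : Type*} [NormedAddCommGroup F] [NormedSpace ℝ F]
    {w : E → F} {m : ℕ} (hw : ContDiffOn ℝ m w {0}ᶜ) {y : E} (hy : y ≠ 0) : ContDiffAt ℝ m w y :=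
  hw.contDiffAt (isOpen_compl_singleton.mem_nhds hy)

theorem hess_eq_fderiv_fderiv (hu : ContDiffOn ℝ 2 u {0}ᶜ) {y : E} (hy : y ≠ 0) (a b : E) :
    hess u y a b = fderiv ℝ (fderiv ℝ u) y a b := by
  have h : DifferentiableAt ℝ (fderiv ℝ u) y :=
    ((contDiffAt_of_contDiffOn_compl hu hy).fderiv_right (m := 1) (by norm_num)).differentiableAt
      (by norm_num)
  rw [hess, fderiv_clm_apply h (by fun_prop)]
  simp

theorem hess_symm (hu : ContDiffOn ℝ 2 u {0}ᶜ) {y : E} (hy : y ≠ 0) (a b : E) :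
    hess u y a b = hess u y b a := by
  rw [hess_eq_fderiv_fderiv hu hy, hess_eq_fderiv_fderiv hu hy]
  exact ((contDiffAt_of_contDiffOn_compl hu hy).isSymmSndFDerivAt (by simp)).eq a b

theorem continuousAt_hess (hu : ContDiffOn ℝ 2 u {0}ᶜ) {y : E} (hy : y ≠ 0) (a b : E) :
    ContinuousAt (fun y => hess u y a b) y :=
  ((((contDiffAt_of_contDiffOn_compl (m := 1) (contDiffOn_fderiv_apply hu b) hy).fderiv_right
    (m := 0) (by norm_num)).clm_apply contDiffAt_const).continuousAt :)

theorem exists_hess_bound [FiniteDimensional ℝ E] (hu : ContDiffOn ℝ 2 u {0}ᶜ)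
    (hhom : ∀ t : ℝ, 0 < t → ∀ y, y ≠ 0 → u (t • y) = t * u y) (b : E) :
    ∃ C, ∀ y, y ≠ 0 → ‖fderiv ℝ (fun z => fderiv ℝ u z b) y‖ ≤ C * ‖y‖⁻¹ := by
  refine exists_norm_fderiv_le_of_homogeneous (contDiffOn_fderiv_apply hu b) fun t ht y hy => ?_
  rw [fderiv_smul_of_homogeneous ht (hhom t ht) hy, inv_mul_cancel₀ ht.ne', one_smul]

end Hessian

section Identity
variable {E : Type*} [NormedAddCommGroup E] [InnerProductSpace ℝ E] [FiniteDimensional ℝ E]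
  [MeasurableSpace E] [BorelSpace E] {n : ℕ}

theorem integrable_mul_of_decay (hn : 2 ≤ n) (hE : Module.finrank ℝ E = n + 1) {g k : E → ℝ}
    (hg : AEStronglyMeasurable g) (hk : AEStronglyMeasurable k) {C C' : ℝ}
    (hgC : ∀ y, y ≠ 0 → |g y| ≤ C * ‖y‖⁻¹) (hkC : ∀ y, |k y| ≤ C' * ((1 + ‖y‖) ^ (n + 1))⁻¹) :
    Integrable (fun y => g y * k y) := by
  have : Nontrivial E := Module.nontrivial_of_finrank_pos (R := ℝ) (by omega)
  have hae : ∀ᵐ y : E, y ≠ 0 := by simp [ae_iff]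
  refine ((integrable_inv_sq_mul_inv_one_add_pow hn hE).const_mul (C * C')).mono' (hg.mul hk) ?_
  filter_upwards [hae] with y hy
  have hy' : 0 < ‖y‖ := norm_pos_iff.2 hy
  have h1 := hgC y hy
  have h2 := hkC y
  have hC' : 0 ≤ C' :=
    nonneg_of_mul_nonneg_left ((abs_nonneg _).trans h2) (by positivity)
  have hC : 0 ≤ C := nonneg_of_mul_nonneg_left ((abs_nonneg _).trans h1) (by positivity)
  rw [norm_mul, Real.norm_eq_abs, Real.norm_eq_abs]
  calc _ ≤ (C * ‖y‖⁻¹) * (C' * ((1 + ‖y‖) ^ (n + 1))⁻¹) := by gcongr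
    _ = C * C' * (‖y‖⁻¹ * (((1 + ‖y‖) ^ n)⁻¹ * (1 + ‖y‖)⁻¹)) := by
      rw [pow_succ, mul_inv]; ring
    _ ≤ C * C' * (‖y‖⁻¹ * (((1 + ‖y‖) ^ n)⁻¹ * ‖y‖⁻¹)) := by
      gcongr
      linarith
    _ = _ := by rw [sq, mul_inv]; ring

theorem integrable_mul_of_decay_sq (hn : 2 ≤ n) (hE : Module.finrank ℝ E = n + 1) {g k : E → ℝ}
    (hg : AEStronglyMeasurable g) (hk : AEStronglyMeasurable k) {C C' : ℝ}
    (hgC : ∀ y, y ≠ 0 → |g y| ≤ C * (‖y‖ ^ 2)⁻¹) (hkC : ∀ y, |k y| ≤ C' * ((1 + ‖y‖) ^ n)⁻¹) :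
    Integrable (fun y => g y * k y) := by
  have : Nontrivial E := Module.nontrivial_of_finrank_pos (R := ℝ) (by omega)
  have hae : ∀ᵐ y : E, y ≠ 0 := by simp [ae_iff]
  refine ((integrable_inv_sq_mul_inv_one_add_pow hn hE).const_mul (C * C')).mono' (hg.mul hk) ?_
  filter_upwards [hae] with y hy
  have h1 := hgC y hy
  have h2 := hkC y
  rw [norm_mul, Real.norm_eq_abs, Real.norm_eq_abs]
  calc _ ≤ (C * (‖y‖ ^ 2)⁻¹) * (C' * ((1 + ‖y‖) ^ n)⁻¹) := by
        gcongr
        exact (abs_nonneg _).trans h1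
    _ = _ := by ring

theorem integrable_hess_mul (hn : 2 ≤ n) (hE : Module.finrank ℝ E = n + 1) {u : E → ℝ}
    (hu : ContDiffOn ℝ 2 u {0}ᶜ) (hhom : ∀ t : ℝ, 0 < t → ∀ y, y ≠ 0 → u (t • y) = t * u y)
    {ε : ℝ} (hε : 0 < ε) (x a b c d : E) :
    Integrable fun y => hess u y a b * fderiv ℝ (regKernel n ε x d) y c := by
  obtain ⟨C, hC⟩ := exists_hess_bound hu hhom b
  obtain ⟨C', -, hC'⟩ := exists_regKernel_decay n hε x d
  refine integrable_mul_of_decay hn hE (C := C * ‖a‖) (C' := C' * ‖c‖)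
    (measurable_fderiv_apply_const ℝ _ _).aestronglyMeasurable
    (measurable_fderiv_apply_const ℝ _ _).aestronglyMeasurable (fun y hy => ?_) fun y => ?_
  · calc _ ≤ ‖fderiv ℝ (fun z => fderiv ℝ u z b) y‖ * ‖a‖ :=
          (fderiv ℝ (fun z => fderiv ℝ u z b) y).le_opNorm a
      _ ≤ C * ‖y‖⁻¹ * ‖a‖ := by gcongr; exact hC y hy
      _ = _ := by ring
  · calc _ ≤ ‖fderiv ℝ (regKernel n ε x d) y‖ * ‖c‖ :=
          (fderiv ℝ (regKernel n ε x d) y).le_opNorm c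
      _ ≤ C' * ((1 + ‖y‖) ^ (n + 1))⁻¹ * ‖c‖ := by gcongr; exact hC' y
      _ = _ := by ring

theorem integral_hess_mul_swap (hn : 2 ≤ n) (hE : Module.finrank ℝ E = n + 1) {u : E → ℝ}
    (hu : ContDiffOn ℝ 2 u {0}ᶜ) (hhom : ∀ t : ℝ, 0 < t → ∀ y, y ≠ 0 → u (t • y) = t * u y)
    {ε : ℝ} (hε : 0 < ε) (x a b c d : E) :
    ∫ y, hess u y a c * fderiv ℝ (regKernel n ε x d) y b =
      ∫ y, hess u y b c * fderiv ℝ (regKernel n ε x d) y a := by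
  obtain ⟨C, hC⟩ := exists_hess_bound hu hhom c
  obtain ⟨C', hC0, hC1⟩ := exists_regKernel_decay n hε x d
  have hm : ∀ e : E, Measurable fun y => hess u y e c := fun e =>
    measurable_fderiv_apply_const ℝ _ _
  have hle : ∀ (e : E) (y : E), y ≠ 0 → |hess u y e c| ≤ C * ‖y‖⁻¹ * ‖e‖ := fun e y hy =>
    ((fderiv ℝ (fun z => fderiv ℝ u z c) y).le_opNorm e).trans (by gcongr; exact hC y hy)
  have key := integral_eq_zero_of_forall_hasCompactSupport hn hE
    (α := fun y => hess u y a c • b - hess u y b c • a) (β := fun _ => 0)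
    (C := max (C * ‖a‖ * ‖b‖ + C * ‖b‖ * ‖a‖) 0)
    (((hm a).smul_const b).sub ((hm b).smul_const a)).aestronglyMeasurable
    aestronglyMeasurable_const (fun y hy => ?_) (fun y _ => by simp; positivity)
    (fun φ hφ hc h0 => ?_) (contDiff_regKernel n hε x d) hC0 hC1
  · simp only [map_sub, map_smul, smul_eq_mul, zero_mul, add_zero] at key
    rw [integral_sub (integrable_hess_mul hn hE hu hhom hε x a c b d)
      (integrable_hess_mul hn hE hu hhom hε x b c a d), sub_eq_zero] at key
    exact key
  · calc _ ≤ |hess u y a c| * ‖b‖ + |hess u y b c| * ‖a‖ :=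
          (norm_sub_le _ _).trans_eq (by simp [norm_smul])
      _ ≤ C * ‖y‖⁻¹ * ‖a‖ * ‖b‖ + C * ‖y‖⁻¹ * ‖b‖ * ‖a‖ := by
        gcongr <;> exact hle _ y hy
      _ = (C * ‖a‖ * ‖b‖ + C * ‖b‖ * ‖a‖) * ‖y‖⁻¹ := by ring
      _ ≤ _ := by gcongr; exact le_max_left _ _
  · simp only [zero_mul, add_zero]
    exact integral_fderiv_apply_swap (contDiffOn_fderiv_apply hu c) hφ hc h0 a b

end Identity

section Regularised
variable {E : Type*} [NormedAddCommGroup E] [InnerProductSpace ℝ E]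

theorem fderiv_regKernel_symm (n : ℕ) {ε : ℝ} (hε : 0 < ε) (x a y b : E) :
    fderiv ℝ (regKernel n ε x a) y b = fderiv ℝ (regKernel n ε x b) y a := by
  rw [fderiv_regKernel_apply n hε, fderiv_regKernel_apply n hε, real_inner_comm,
    mul_comm ⟪y - x, a⟫]

theorem sum_fderiv_regKernel {ι : Type*} [Fintype ι] (v : OrthonormalBasis ι ℝ E) {n : ℕ}
    (hι : Fintype.card ι = n + 1) {ε : ℝ} (hε : 0 < ε) (x y : E) :
    ∑ i, fderiv ℝ (regKernel n ε x (v i)) y (v i) =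
      (n + 1) * ε ^ 2 * (regDist ε x y ^ (n + 3))⁻¹ := by
  have hρ := regDist_pos hε x y
  have h1 : ∑ i, ⟪y - x, v i⟫ * ⟪y - x, v i⟫ = ‖y - x‖ ^ 2 := by
    rw [← v.sum_sq_norm_inner_left (y - x)]
    exact Finset.sum_congr rfl fun i _ => by rw [Real.norm_eq_abs, sq_abs, sq]
  have h2 : ‖y - x‖ ^ 2 = regDist ε x y ^ 2 - ε ^ 2 := by rw [regDist_sq]; ring
  simp_rw [fderiv_regKernel_apply n hε]
  rw [Finset.sum_sub_distrib, ← Finset.sum_mul, ← Finset.sum_mul, ← Finset.mul_sum, h1, h2]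
  simp only [inner_self_eq_norm_sq_to_K, v.norm_eq_one]
  simp [hι]
  field_simp
  ring

variable [FiniteDimensional ℝ E] [MeasurableSpace E] [BorelSpace E] {n : ℕ}

theorem integral_mul_fderiv_regKernel (hn : 2 ≤ n) (hE : Module.finrank ℝ E = n + 1) {f : E → ℝ}
    {K : NNReal} (hf : LipschitzOnWith K f (sphere 0 1))
    (hhom : ∀ t : ℝ, 0 < t → ∀ y, y ≠ 0 → f (t • y) = t⁻¹ * f y)
    {ε : ℝ} (hε : 0 < ε) (x ξ : E) :
    ∫ y, f y * fderiv ℝ (regKernel n ε x ξ) y ξ =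
      -∫ y, regKernel n ε x ξ y * fderiv ℝ f y ξ := by
  obtain ⟨C, hC0, hC⟩ := exists_abs_le_of_lipschitzOnWith_sphere hf hhom
  obtain ⟨D, hD⟩ := exists_norm_fderiv_le_of_lipschitzOnWith_sphere hf hhom
  obtain ⟨C', hC'0, hC'1⟩ := exists_regKernel_decay n hε x ξ
  have hlip := exists_lipschitzOnWith_of_homogeneous hf hhom
  have : Nontrivial E := Module.nontrivial_of_finrank_pos (R := ℝ) (by omega)
  have hfm : AEStronglyMeasurable f := by
    have hc : ContinuousOn f {0}ᶜ := fun y hy => by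
      obtain ⟨L, hL⟩ := hlip (‖y‖ / 2) (by have := norm_pos_iff.2 hy; positivity)
      refine (hL.continuousOn.continuousAt ?_).continuousWithinAt
      filter_upwards [continuous_norm.continuousAt.eventually_const_le
        (half_lt_self (norm_pos_iff.2 hy))] with z hz using hz
    have := hc.aestronglyMeasurable (μ := volume) (measurableSet_singleton (0 : E)).compl
    rwa [Measure.restrict_eq_self_of_ae_mem (by simp [ae_iff])] at this
  have hdm : AEStronglyMeasurable fun y => fderiv ℝ f y ξ :=
    (measurable_fderiv_apply_const ℝ _ _).aestronglyMeasurable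
  have hDξ : ∀ y, y ≠ 0 → |fderiv ℝ f y ξ| ≤ D * ‖ξ‖ * (‖y‖ ^ 2)⁻¹ := fun y hy =>
    ((fderiv ℝ f y).le_opNorm ξ).trans
      ((mul_le_mul_of_nonneg_right (hD y hy) (norm_nonneg _)).trans_eq (by ring))
  have hk : Continuous (regKernel n ε x ξ) := (contDiff_regKernel n hε x ξ).continuous
  have key := integral_eq_zero_of_forall_hasCompactSupport hn hE
    (α := fun y => f y • ξ) (β := fun y => fderiv ℝ f y ξ) (C := max (C * ‖ξ‖) (D * ‖ξ‖))
    (hfm.smul_const ξ) hdm (fun y hy => ?_) (fun y hy => ?_)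
    (fun φ hφ hc h0 => integral_fderiv_mul_add_of_lipschitzOnWith hlip hφ hc h0 ξ)
    (contDiff_regKernel n hε x ξ) hC'0 hC'1
  · simp only [map_smul, smul_eq_mul] at key
    rw [integral_add, add_eq_zero_iff_eq_neg] at key
    · simpa only [mul_comm (fderiv ℝ f _ ξ)] using key
    · refine integrable_mul_of_decay hn hE (C := C) (C' := C' * ‖ξ‖) hfm
        (measurable_fderiv_apply_const ℝ _ _).aestronglyMeasurable hC fun y => ?_
      exact ((fderiv ℝ (regKernel n ε x ξ) y).le_opNorm ξ).trans
        ((mul_le_mul_of_nonneg_right (hC'1 y) (norm_nonneg _)).trans_eq (by ring))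
    · exact integrable_mul_of_decay_sq hn hE hdm hk.aestronglyMeasurable hDξ hC'0
  · calc _ = |f y| * ‖ξ‖ := by simp [norm_smul]
      _ ≤ C * ‖y‖⁻¹ * ‖ξ‖ := by gcongr; exact hC y hy
      _ = C * ‖ξ‖ * ‖y‖⁻¹ := by ring
      _ ≤ _ := by gcongr; exact le_max_left _ _
  · exact (hDξ y hy).trans (by gcongr; exact le_max_right _ _)

theorem integral_regKernel_mul_hess {ι : Type*} [Fintype ι] (v : OrthonormalBasis ι ℝ E)
    (hn : 2 ≤ n) (hE : Module.finrank ℝ E = n + 1) {f u : E → ℝ} {K : NNReal}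
    (hf : LipschitzOnWith K f (sphere 0 1))
    (hf_hom : ∀ t : ℝ, 0 < t → ∀ y, y ≠ 0 → f (t • y) = t⁻¹ * f y)
    (hu : ContDiffOn ℝ 2 u {0}ᶜ) (hu_hom : ∀ t : ℝ, 0 < t → ∀ y, y ≠ 0 → u (t • y) = t * u y)
    (hfu : ∀ y, y ≠ 0 → ∑ i, hess u y (v i) (v i) = f y) {ε : ℝ} (hε : 0 < ε) (x ξ : E) :
    ∫ y, (n + 1) * ε ^ 2 * (regDist ε x y ^ (n + 3))⁻¹ * hess u y ξ ξ =
      -∫ y, regKernel n ε x ξ y * fderiv ℝ f y ξ := by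
  have : Nontrivial E := Module.nontrivial_of_finrank_pos (R := ℝ) (by omega)
  have hae : ∀ᵐ y : E, y ≠ 0 := by simp [ae_iff]
  have hι : Fintype.card ι = n + 1 := by rw [← Module.finrank_eq_card_basis v.toBasis, hE]
  have hint := integrable_hess_mul hn hE hu hu_hom hε x
  have hswap := integral_hess_mul_swap hn hE hu hu_hom hε x
  rw [← integral_mul_fderiv_regKernel hn hE hf hf_hom hε]
  calc _ = ∫ y, ∑ i, hess u y ξ ξ * fderiv ℝ (regKernel n ε x (v i)) y (v i) := by
        refine integral_congr_ae (Eventually.of_forall fun y => ?_)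
        simp only
        rw [← Finset.mul_sum, sum_fderiv_regKernel v hι hε, mul_comm]
    _ = ∑ i, ∫ y, hess u y ξ ξ * fderiv ℝ (regKernel n ε x (v i)) y (v i) :=
        integral_finsetSum _ fun i _ => hint _ _ _ _
    _ = ∑ i, ∫ y, hess u y (v i) (v i) * fderiv ℝ (regKernel n ε x ξ) y ξ := by
        refine Finset.sum_congr rfl fun i _ => ?_
        rw [hswap ξ (v i) ξ (v i), hswap (v i) ξ (v i) ξ]
        refine integral_congr_ae ?_
        filter_upwards [hae] with y hy
        rw [hess_symm hu hy, fderiv_regKernel_symm n hε]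
    _ = ∫ y, ∑ i, hess u y (v i) (v i) * fderiv ℝ (regKernel n ε x ξ) y ξ :=
        (integral_finsetSum _ fun i _ => hint _ _ _ _).symm
    _ = _ := by
        refine integral_congr_ae ?_
        filter_upwards [hae] with y hy
        rw [← Finset.sum_mul, hfu y hy]

end Regularised

section Limit
variable {E : Type*} [NormedAddCommGroup E] {n : ℕ}

/-- The approximate identity arising from the divergence of the regularised kernels. -/
noncomputable def bump (n : ℕ) (w : E) : ℝ := (n + 1) * (regDist 1 0 w ^ (n + 3))⁻¹

theorem bump_pos (w : E) : 0 < bump n w := by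
  have := regDist_pos one_pos 0 w
  rw [bump]; positivity

theorem bump_le (w : E) : bump n w ≤ (n + 1) * 2 ^ (n + 3) * ((1 + ‖w‖) ^ (n + 3))⁻¹ := by
  have hρ := regDist_pos one_pos 0 w
  have h := pow_le_pow_left₀ (by positivity) (one_add_norm_le_mul_regDist one_pos 0 w) (n + 3)
  rw [norm_zero, add_zero, div_one, one_add_one_eq_two, mul_pow] at h
  rw [bump, mul_assoc]
  gcongr
  rw [← div_eq_mul_inv, le_div_iff₀ (by positivity), inv_mul_le_iff₀ (by positivity)]
  linarith

theorem inv_one_add_pow_le {y : E} (hy : y ≠ 0) :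
    ((1 + ‖y‖) ^ (n + 3))⁻¹ ≤ ‖y‖ * ((‖y‖ ^ 2)⁻¹ * ((1 + ‖y‖) ^ n)⁻¹) := by
  have hy' : 0 < ‖y‖ := norm_pos_iff.2 hy
  have h : (1 + ‖y‖) ^ (n + 3) ≥ ‖y‖ * (1 + ‖y‖) ^ n := by
    rw [pow_add, mul_comm]
    gcongr
    nlinarith [pow_pos hy' 2, pow_pos hy' 3]
  calc _ ≤ (‖y‖ * (1 + ‖y‖) ^ n)⁻¹ := by gcongr
    _ = _ := by field_simp

variable [InnerProductSpace ℝ E]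

theorem continuous_bump : Continuous (bump n : E → ℝ) :=
  continuous_const.mul (((contDiff_regDist one_pos 0 |>.continuous).pow _).inv₀ fun y =>
    (pow_pos (regDist_pos one_pos 0 y) _).ne')

theorem pow_mul_bump_smul {c : ℝ} (hc : 0 < c) (x y : E) :
    c ^ (n + 1) * bump n (c • (x - y)) =
      (n + 1) * c⁻¹ ^ 2 * (regDist c⁻¹ x y ^ (n + 3))⁻¹ := by
  have h : regDist 1 0 (c • (x - y)) = c * regDist c⁻¹ x y := by
    rw [regDist, regDist, sub_zero, norm_smul, ← Real.sqrt_sq hc.le, ← Real.sqrt_mul (sq_nonneg _),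
      Real.sqrt_sq hc.le, norm_sub_rev, Real.norm_of_nonneg hc.le, mul_add, mul_pow, inv_pow,
      mul_inv_cancel₀ (pow_pos hc 2).ne', one_pow]
  have := regDist_pos (inv_pos.2 hc) x y
  rw [bump, h, mul_pow, mul_inv, inv_pow, pow_add c n 3, pow_add c n 1]
  generalize regDist c⁻¹ x y = ρ at *
  field_simp

variable [FiniteDimensional ℝ E] [MeasurableSpace E] [BorelSpace E]

theorem integrable_bump (hn : 2 ≤ n) (hE : Module.finrank ℝ E = n + 1) :
    Integrable (bump n : E → ℝ) := by
  have : Nontrivial E := Module.nontrivial_of_finrank_pos (R := ℝ) (by omega)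
  have hae : ∀ᵐ y : E, y ≠ 0 := by simp [ae_iff]
  refine ((integrable_inv_sq_mul_inv_one_add_pow hn hE).const_mul
    ((n + 1) * 2 ^ (n + 3))).mono' continuous_bump.aestronglyMeasurable ?_
  filter_upwards [hae] with y hy
  have hy' : 0 < ‖y‖ := norm_pos_iff.2 hy
  rw [Real.norm_of_nonneg (bump_pos y).le]
  refine (bump_le y).trans ?_
  gcongr
  rw [← mul_inv]
  gcongr
  rw [pow_add, mul_comm]
  gcongr
  nlinarith [pow_pos hy' 3, sq_nonneg ‖y‖]

theorem integral_bump_pos (hn : 2 ≤ n) (hE : Module.finrank ℝ E = n + 1) :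
    0 < ∫ w : E, bump n w := by
  have : Nontrivial E := Module.nontrivial_of_finrank_pos (R := ℝ) (by omega)
  rw [integral_pos_iff_support_of_nonneg (fun w => (bump_pos w).le) (integrable_bump hn hE)]
  have : Function.support (bump n : E → ℝ) = univ := by
    ext w; simp [(bump_pos (n := n) w).ne']
  rw [this]
  exact isOpen_univ.measure_pos _ univ_nonempty

theorem tendsto_integral_bump_mul_of_integrable (hn : 2 ≤ n) (hE : Module.finrank ℝ E = n + 1)
    {g : E → ℝ} (hg : Integrable g) {x : E} (hgx : ContinuousAt g x) :
    Tendsto (fun c : ℝ => ∫ y, c ^ (n + 1) * bump n (c • (x - y)) * g y) atTop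
      (𝓝 ((∫ w : E, bump n w) * g x)) := by
  obtain ⟨c₀, hc₀⟩ : ∃ c₀, c₀ = ∫ w : E, bump n w := ⟨_, rfl⟩
  have hc₀pos : 0 < c₀ := hc₀ ▸ integral_bump_pos hn hE
  rw [← hc₀]
  have hinv : Tendsto (fun w : E => c₀⁻¹ * ((n + 1) * 2 ^ (n + 3)) * ‖w‖⁻¹)
      (Bornology.cobounded E) (𝓝 0) := by
    simpa using (tendsto_norm_cobounded_atTop (E := E)).inv_tendsto_atTop.const_mul
      (c₀⁻¹ * ((n + 1) * 2 ^ (n + 3)))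
  have hφ : Tendsto (fun w : E => ‖w‖ ^ Module.finrank ℝ E * (c₀⁻¹ * bump n w))
      (Bornology.cobounded E) (𝓝 0) := by
    rw [hE]
    refine squeeze_zero' (Eventually.of_forall fun w => ?_) ?_ hinv
    · have := bump_pos (n := n) w
      positivity
    filter_upwards [(tendsto_norm_cobounded_atTop (E := E)).eventually_gt_atTop 0] with w hw
    have h1 := bump_le (n := n) w
    have h2 : ‖w‖ ^ (n + 1) * ((1 + ‖w‖) ^ (n + 3))⁻¹ ≤ ‖w‖⁻¹ := by
      rw [← div_eq_mul_inv, ← one_div, div_le_div_iff₀ (by positivity) hw, ← pow_succ, one_mul]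
      calc ‖w‖ ^ (n + 1 + 1) ≤ (1 + ‖w‖) ^ (n + 1 + 1) := by gcongr; linarith
        _ ≤ _ := pow_le_pow_right₀ (by linarith) (by omega)
    calc _ ≤ ‖w‖ ^ (n + 1) *
          (c₀⁻¹ * ((n + 1) * 2 ^ (n + 3) * ((1 + ‖w‖) ^ (n + 3))⁻¹)) := by gcongr
      _ = c₀⁻¹ * ((n + 1) * 2 ^ (n + 3)) * (‖w‖ ^ (n + 1) * ((1 + ‖w‖) ^ (n + 3))⁻¹) := by ring
      _ ≤ _ := by gcongr
  have key := tendsto_integral_comp_smul_smul_of_integrable' (μ := (volume : Measure E))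
    (φ := fun w => c₀⁻¹ * bump n w)
    (fun w => mul_nonneg (inv_pos.2 hc₀pos).le (bump_pos w).le)
    (by rw [integral_const_mul, ← hc₀, inv_mul_cancel₀ hc₀pos.ne']) hφ hg hgx
  rw [hE] at key
  refine (key.const_mul c₀).congr fun c => ?_
  rw [← integral_const_mul]
  congr 1 with y
  rw [smul_eq_mul]
  field_simp

theorem tendsto_integral_bump_mul (hn : 2 ≤ n) (hE : Module.finrank ℝ E = n + 1) {g : E → ℝ}
    (hg : AEStronglyMeasurable g) {C : ℝ} (hC : ∀ y, y ≠ 0 → |g y| ≤ C * ‖y‖⁻¹) {x : E}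
    (hx : ‖x‖ = 1) (hgx : ContinuousAt g x) :
    Tendsto (fun c : ℝ => ∫ y, c ^ (n + 1) * bump n (c • (x - y)) * g y) atTop
      (𝓝 ((∫ w : E, bump n w) * g x)) := by
  have : Nontrivial E := Module.nontrivial_of_finrank_pos (R := ℝ) (by omega)
  have hae : ∀ᵐ y : E, y ≠ 0 := by simp [ae_iff]
  have hx0 : x ≠ 0 := norm_pos_iff.1 (by rw [hx]; exact one_pos)
  have hC0 : 0 ≤ C := by simpa [hx] using (abs_nonneg _).trans (hC x hx0)
  set g₁ := (ball x (1 / 2)).indicator g with hg₁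
  set g₂ := (ball x (1 / 2))ᶜ.indicator g with hg₂
  have hsum : ∀ y, g y = g₁ y + g₂ y := fun y =>
    (congrFun (indicator_self_add_compl (ball x (1 / 2)) g) y).symm
  have hg₁i : Integrable g₁ := by
    rw [hg₁, integrable_indicator_iff measurableSet_ball]
    refine Measure.integrableOn_of_bounded (M := C * 2) measure_ball_lt_top.ne hg ?_
    filter_upwards [ae_restrict_mem measurableSet_ball] with y hy
    rw [mem_ball, dist_eq_norm] at hy
    have h1 : 1 / 2 ≤ ‖y‖ := by
      have := norm_sub_norm_le x (x - y)
      rw [sub_sub_cancel, norm_sub_rev, hx] at this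
      linarith
    refine (hC y (norm_pos_iff.1 (by linarith))).trans ?_
    gcongr
    rw [inv_le_comm₀ (by linarith) two_pos]
    linarith
  have hg₁c : ContinuousAt g₁ x := hgx.congr <| by
    filter_upwards [ball_mem_nhds x (by norm_num : (0 : ℝ) < 1 / 2)] with y hy
    rw [hg₁, indicator_of_mem hy]
  have hg₁x : g₁ x = g x := indicator_of_mem (mem_ball_self (by norm_num)) _
  have hlim₁ := tendsto_integral_bump_mul_of_integrable hn hE hg₁i hg₁c
  rw [hg₁x] at hlim₁
  set M : E → ℝ := fun y => (n + 1) * 5 ^ (n + 3) * C * ((‖y‖ ^ 2)⁻¹ * ((1 + ‖y‖) ^ n)⁻¹) with hM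
  have hMi : Integrable M := (integrable_inv_sq_mul_inv_one_add_pow hn hE).const_mul _
  have hfar : ∀ c : ℝ, 0 < c → ∀ᵐ y : E,
      ‖c ^ (n + 1) * bump n (c • (x - y)) * g₂ y‖ ≤ c⁻¹ ^ 2 * M y := fun c hc => by
    filter_upwards [hae] with y hy
    have hy' : 0 < ‖y‖ := norm_pos_iff.2 hy
    by_cases hyb : y ∈ ball x (1 / 2)
    · rw [hg₂, indicator_of_notMem (by simpa using hyb), mul_zero, norm_zero]
      simp only [hM]
      positivity
    have h0 : 1 / 2 ≤ ‖y - x‖ := by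
      rw [mem_ball, dist_eq_norm, not_lt] at hyb; exact hyb
    rw [hg₂, indicator_of_mem (by simpa using hyb), pow_mul_bump_smul hc, norm_mul]
    have hρ := regDist_pos (inv_pos.2 hc) x y
    have h1 : 1 + ‖y‖ ≤ 5 * regDist c⁻¹ x y := by
      have h2 := norm_sub_le_regDist c⁻¹ x y
      have h3 : ‖y‖ ≤ ‖y - x‖ + ‖x‖ := by simpa using norm_add_le (y - x) x
      rw [hx] at h3
      linarith
    have h2 : (regDist c⁻¹ x y ^ (n + 3))⁻¹ ≤ 5 ^ (n + 3) * ((1 + ‖y‖) ^ (n + 3))⁻¹ := by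
      have h := pow_le_pow_left₀ (by positivity) h1 (n + 3)
      rw [mul_pow] at h
      rw [← div_eq_mul_inv, le_div_iff₀ (by positivity), inv_mul_le_iff₀ (by positivity)]
      linarith
    rw [Real.norm_of_nonneg (by positivity), Real.norm_eq_abs]
    calc _ ≤ (n + 1) * c⁻¹ ^ 2 * (5 ^ (n + 3) * (‖y‖ * ((‖y‖ ^ 2)⁻¹ * ((1 + ‖y‖) ^ n)⁻¹))) *
          (C * ‖y‖⁻¹) := by
          gcongr
          · exact h2.trans (by gcongr; exact inv_one_add_pow_le hy)
          · exact hC y hy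
      _ = _ := by simp only [hM]; field_simp
  have hlim₂ : Tendsto (fun c : ℝ => ∫ y, c ^ (n + 1) * bump n (c • (x - y)) * g₂ y) atTop
      (𝓝 0) := by
    have h0 : Tendsto (fun c : ℝ => c⁻¹ ^ 2 * ∫ y, M y) atTop (𝓝 0) := by
      simpa using (tendsto_inv_atTop_zero.pow 2).mul_const (∫ y, M y)
    refine squeeze_zero_norm' ?_ h0
    filter_upwards [eventually_gt_atTop 0] with c hc
    rw [← integral_const_mul]
    exact norm_integral_le_of_norm_le (hMi.const_mul _) (hfar c hc)
  have hlim := hlim₁.add hlim₂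
  rw [add_zero] at hlim
  refine hlim.congr' ?_
  filter_upwards [eventually_gt_atTop 0] with c hc
  have hkc : Continuous fun y : E => c ^ (n + 1) * bump n (c • (x - y)) :=
    continuous_const.mul (continuous_bump.comp (by fun_prop))
  have hi₁ : Integrable fun y => c ^ (n + 1) * bump n (c • (x - y)) * g₁ y := by
    refine hg₁i.bdd_mul (c := c ^ (n + 1) * (n + 1)) hkc.aestronglyMeasurable
      (Eventually.of_forall fun y => ?_)
    have hb := bump_pos (n := n) (c • (x - y))
    rw [Real.norm_of_nonneg (by positivity)]
    gcongr
    rw [bump]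
    exact mul_le_of_le_one_right (by positivity)
      (inv_le_one_of_one_le₀ (one_le_pow₀ (le_regDist 1 0 _)))
  have hi₂ : Integrable fun y => c ^ (n + 1) * bump n (c • (x - y)) * g₂ y :=
    (hMi.const_mul _).mono'
      (hkc.aestronglyMeasurable.mul (hg.indicator measurableSet_ball.compl)) (hfar c hc)
  rw [← integral_add hi₁ hi₂]
  simp only [hsum, mul_add]

theorem tendsto_integral_regKernel_mul (hn : 2 ≤ n) (hE : Module.finrank ℝ E = n + 1) {h : E → ℝ}
    (hh : AEStronglyMeasurable h) {D : ℝ} (hD : ∀ y, y ≠ 0 → |h y| ≤ D * (‖y‖ ^ 2)⁻¹) {x : E}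
    (hx : ‖x‖ = 1) (ξ : E) :
    Integrable (fun y => ⟪y - x, ξ⟫ * (‖y - x‖ ^ (n + 1))⁻¹ * h y) ∧
    Tendsto (fun c : ℝ => ∫ y, regKernel n c⁻¹ x ξ y * h y) atTop
      (𝓝 (∫ y, ⟪y - x, ξ⟫ * (‖y - x‖ ^ (n + 1))⁻¹ * h y)) := by
  have : Nontrivial E := Module.nontrivial_of_finrank_pos (R := ℝ) (by omega)
  have hae : ∀ᵐ y : E, y ≠ 0 := by simp [ae_iff]
  have haex : ∀ᵐ y : E, y ≠ x := by simp [ae_iff]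
  have hMi := (integrable_inv_sq_mul_inv_norm_sub_pow hn hE hx).const_mul (D * ‖ξ‖)
  constructor
  · refine hMi.mono' (AEStronglyMeasurable.mul ?_ hh) ?_
    · exact Measurable.aestronglyMeasurable (by fun_prop)
    filter_upwards [hae, haex] with y hy hyx
    have hyx' : 0 < ‖y - x‖ := norm_pos_iff.2 (sub_ne_zero.2 hyx)
    rw [norm_mul, norm_mul, norm_inv, norm_pow, norm_norm]
    calc _ ≤ ‖y - x‖ * ‖ξ‖ * (‖y - x‖ ^ (n + 1))⁻¹ * (D * (‖y‖ ^ 2)⁻¹) := by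
          gcongr
          · exact norm_inner_le_norm _ _
          · exact hD y hy
      _ = _ := by rw [pow_succ]; field_simp
  · refine tendsto_integral_filter_of_dominated_convergence _ ?_ ?_ hMi ?_
    · filter_upwards [eventually_gt_atTop 0] with c hc
      exact (contDiff_regKernel n (inv_pos.2 hc) x ξ).continuous.aestronglyMeasurable.mul hh
    · filter_upwards [eventually_gt_atTop 0] with c hc
      filter_upwards [hae, haex] with y hy hyx
      have hyx' : 0 < ‖y - x‖ := norm_pos_iff.2 (sub_ne_zero.2 hyx)
      rw [norm_mul, Real.norm_eq_abs, Real.norm_eq_abs]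
      calc _ ≤ (‖ξ‖ * (‖y - x‖ ^ n)⁻¹) * (D * (‖y‖ ^ 2)⁻¹) := by
            gcongr
            · refine (abs_regKernel_le n (inv_pos.2 hc) x ξ y).trans ?_
              gcongr
              exact norm_sub_le_regDist _ _ _
            · exact hD y hy
        _ = _ := by ring
    · filter_upwards [haex] with y hyx
      have hyx' : 0 < ‖y - x‖ := norm_pos_iff.2 (sub_ne_zero.2 hyx)
      refine Tendsto.mul_const _ (Tendsto.const_mul _ (Tendsto.inv₀ (Tendsto.pow ?_ _)
        (pow_pos hyx' _).ne'))
      have : Tendsto (fun c : ℝ => √(‖y - x‖ ^ 2 + c⁻¹ ^ 2)) atTop (𝓝 √(‖y - x‖ ^ 2 + 0 ^ 2)) :=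
        ((tendsto_inv_atTop_zero.pow 2).const_add _).sqrt
      simpa [regDist, Real.sqrt_sq hyx'.le] using this

theorem integral_bump_mul_hess {ι : Type*} [Fintype ι] (v : OrthonormalBasis ι ℝ E)
    (hn : 2 ≤ n) (hE : Module.finrank ℝ E = n + 1) {f u : E → ℝ} {K : NNReal}
    (hf : LipschitzOnWith K f (sphere 0 1))
    (hf_hom : ∀ t : ℝ, 0 < t → ∀ y, y ≠ 0 → f (t • y) = t⁻¹ * f y)
    (hu : ContDiffOn ℝ 2 u {0}ᶜ) (hu_hom : ∀ t : ℝ, 0 < t → ∀ y, y ≠ 0 → u (t • y) = t * u y)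
    (hfu : ∀ y, y ≠ 0 → ∑ i, hess u y (v i) (v i) = f y) {x ξ : E} (hx : ‖x‖ = 1)
    (hxξ : ⟪ξ, x⟫ = 0) :
    Integrable (fun y => ⟪ξ, y⟫ * (‖x - y‖ ^ (n + 1))⁻¹ * fderiv ℝ f y ξ) ∧
    (∫ w : E, bump n w) * hess u x ξ ξ =
      -∫ y, ⟪ξ, y⟫ * (‖x - y‖ ^ (n + 1))⁻¹ * fderiv ℝ f y ξ := by
  obtain ⟨C, hC⟩ := exists_hess_bound hu hu_hom ξ
  obtain ⟨D, hD⟩ := exists_norm_fderiv_le_of_lipschitzOnWith_sphere hf hf_hom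
  have hx0 : x ≠ 0 := norm_pos_iff.1 (by rw [hx]; exact one_pos)
  have h1 := tendsto_integral_bump_mul hn hE (g := fun y => hess u y ξ ξ) (C := C * ‖ξ‖)
    (measurable_fderiv_apply_const ℝ _ _).aestronglyMeasurable (fun y hy =>
      ((fderiv ℝ (fun z => fderiv ℝ u z ξ) y).le_opNorm ξ).trans
        ((mul_le_mul_of_nonneg_right (hC y hy) (norm_nonneg _)).trans_eq (by ring)))
    hx (continuousAt_hess hu hx0 ξ ξ)
  obtain ⟨h2, h3⟩ := tendsto_integral_regKernel_mul hn hE (h := fun y => fderiv ℝ f y ξ)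
    (measurable_fderiv_apply_const ℝ _ _).aestronglyMeasurable (D := D * ‖ξ‖) (fun y hy =>
      ((fderiv ℝ f y).le_opNorm ξ).trans
        ((mul_le_mul_of_nonneg_right (hD y hy) (norm_nonneg _)).trans_eq (by ring))) hx ξ
  have heq : ∀ y, ⟪y - x, ξ⟫ * (‖y - x‖ ^ (n + 1))⁻¹ = ⟪ξ, y⟫ * (‖x - y‖ ^ (n + 1))⁻¹ := fun y => by
    rw [norm_sub_rev, real_inner_comm, inner_sub_right, hxξ, sub_zero]
  simp only [heq] at h2 h3
  refine ⟨h2, tendsto_nhds_unique h1 (h3.neg.congr' ?_)⟩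
  filter_upwards [eventually_gt_atTop 0] with c hc
  rw [← integral_regKernel_mul_hess v hn hE hf hf_hom hu hu_hom hfu (inv_pos.2 hc) x ξ]
  simp only [pow_mul_bump_smul hc]

end Limit

section Polar
variable {E : Type*} [NormedAddCommGroup E] [NormedSpace ℝ E] [FiniteDimensional ℝ E]
  [Nontrivial E] [MeasurableSpace E] [BorelSpace E]

theorem integral_eq_integral_toSphere {μ : Measure E} [μ.IsAddHaarMeasure] {F : E → ℝ}
    (hF : Integrable F μ) :
    Integrable (fun z : sphere (0 : E) 1 =>
      ∫ r in Ioi (0 : ℝ), r ^ (Module.finrank ℝ E - 1) * F (r • (z : E))) μ.toSphere ∧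
    ∫ y, F y ∂μ = ∫ z : sphere (0 : E) 1,
      (∫ r in Ioi (0 : ℝ), r ^ (Module.finrank ℝ E - 1) * F (r • (z : E))) ∂(μ.toSphere) := by
  set m := Module.finrank ℝ E - 1
  set g : sphere (0 : E) 1 × Ioi (0 : ℝ) → ℝ := fun p => F (p.2.1 • p.1.1) with hg
  have hgF : g ∘ homeomorphUnitSphereProd E = fun y => F y.1 := by
    ext y
    exact congrArg (fun y : ({0}ᶜ : Set E) => F y)
      ((homeomorphUnitSphereProd E).symm_apply_apply y)
  have hmp := μ.measurePreserving_homeomorphUnitSphereProd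
  have hgi : Integrable g (μ.toSphere.prod (.volumeIoiPow m)) := by
    rw [← hmp.integrable_comp_emb (Homeomorph.measurableEmbedding _), hgF]
    have := hF.integrableOn (s := {0}ᶜ)
    rwa [integrableOn_iff_comap_subtypeVal (measurableSet_singleton _).compl] at this
  have hinner : ∀ z : sphere (0 : E) 1,
      ∫ r, g (z, r) ∂(.volumeIoiPow m) = ∫ r in Ioi (0 : ℝ), r ^ m * F (r • (z : E)) := fun z => by
    simp only [Measure.volumeIoiPow, ENNReal.ofReal, hg]
    rw [integral_withDensity_eq_integral_smul,
      integral_subtype_comap measurableSet_Ioi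
        fun a : ℝ => Real.toNNReal (a ^ m) • F (a • (z : E)),
      setIntegral_congr_fun measurableSet_Ioi fun x hx => ?_]
    · rw [NNReal.smul_def, Real.coe_toNNReal _ (pow_nonneg hx.out.le _), smul_eq_mul]
    · exact (measurable_subtype_coe.pow_const _).real_toNNReal
  refine ⟨by simpa only [hinner] using hgi.integral_prod_left, ?_⟩
  calc ∫ y, F y ∂μ = ∫ y : ({0}ᶜ : Set E), F y ∂(μ.comap (↑)) := by
        rw [integral_subtype_comap (measurableSet_singleton _).compl F,
          restrict_compl_singleton]
    _ = ∫ p, g p ∂(μ.toSphere.prod (.volumeIoiPow m)) := by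
        rw [← hmp.integral_comp (Homeomorph.measurableEmbedding _)]
        exact congrArg (fun k => ∫ y, k y ∂(μ.comap Subtype.val)) hgF.symm
    _ = _ := by
        rw [integral_prod _ hgi]
        simp only [hinner]

end Polar

section Sphere

theorem integral_omegaKer_eq {n : ℕ} (hn : 2 ≤ n)
    {f u : EuclideanSpace ℝ (Fin (n + 1)) → ℝ} {K : NNReal}
    (hf_lip : LipschitzOnWith K f (sphere (0 : EuclideanSpace ℝ (Fin (n + 1))) 1))
    (hf_hom : ∀ t : ℝ, 0 < t → ∀ y : EuclideanSpace ℝ (Fin (n + 1)), y ≠ 0 →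
      f (t • y) = t⁻¹ * f y)
    (hu_hom : ∀ t : ℝ, 0 < t → ∀ y : EuclideanSpace ℝ (Fin (n + 1)), y ≠ 0 →
      u (t • y) = t * u y)
    (hu_C2 : ContDiffOn ℝ 2 u {(0 : EuclideanSpace ℝ (Fin (n + 1)))}ᶜ)
    (hu_lap : ∀ x : EuclideanSpace ℝ (Fin (n + 1)), x ≠ 0 → laplacian u x = f x)
    {x ξ : EuclideanSpace ℝ (Fin (n + 1))} (hx : ‖x‖ = 1) (hxξ : ⟪ξ, x⟫ = 0) :
    Integrable (fun z : sphere (0 : EuclideanSpace ℝ (Fin (n + 1))) 1 =>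
      omegaKer n x z * ⟪ξ, (z : EuclideanSpace ℝ (Fin (n + 1)))⟫ *
        fderiv ℝ f (z : EuclideanSpace ℝ (Fin (n + 1))) ξ) (sphereMeasure n) ∧
    (∫ w : EuclideanSpace ℝ (Fin (n + 1)), bump n w) * hess u x ξ ξ =
      ∫ z : sphere (0 : EuclideanSpace ℝ (Fin (n + 1))) 1,
        omegaKer n x z * ⟪ξ, (z : EuclideanSpace ℝ (Fin (n + 1)))⟫ *
          fderiv ℝ f (z : EuclideanSpace ℝ (Fin (n + 1))) ξ ∂(sphereMeasure n) := by
  have hE : Module.finrank ℝ (EuclideanSpace ℝ (Fin (n + 1))) = n + 1 := by simp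
  obtain ⟨h1, h2⟩ := integral_bump_mul_hess (EuclideanSpace.basisFun (Fin (n + 1)) ℝ) hn hE
    hf_lip hf_hom hu_C2 hu_hom
    (fun y hy => by simpa [laplacian, hess] using hu_lap y hy) hx hxξ
  have hpt : ∀ z : sphere (0 : EuclideanSpace ℝ (Fin (n + 1))) 1,
      ∫ r in Ioi (0 : ℝ), r ^ n * (⟪ξ, r • (z : EuclideanSpace ℝ (Fin (n + 1)))⟫ *
        (‖x - r • (z : EuclideanSpace ℝ (Fin (n + 1)))‖ ^ (n + 1))⁻¹ *
          fderiv ℝ f (r • (z : EuclideanSpace ℝ (Fin (n + 1)))) ξ) =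
      -(omegaKer n x z * ⟪ξ, (z : EuclideanSpace ℝ (Fin (n + 1)))⟫ *
        fderiv ℝ f (z : EuclideanSpace ℝ (Fin (n + 1))) ξ) := fun z => by
    rw [omegaKer, mul_assoc, neg_mul, neg_neg, ← integral_mul_const]
    refine setIntegral_congr_fun measurableSet_Ioi fun r (hr : 0 < r) => ?_
    rw [fderiv_smul_of_homogeneous hr (hf_hom r hr) (ne_zero_of_mem_unit_sphere z),
      inner_smul_right, smul_apply, smul_eq_mul]
    obtain ⟨m, rfl⟩ : ∃ m, n = m + 1 := ⟨n - 1, by omega⟩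
    rw [Nat.add_sub_cancel, pow_succ r m]
    field_simp
  obtain ⟨h3, h4⟩ := integral_eq_integral_toSphere h1
  simp only [hE, Nat.add_sub_cancel, hpt] at h3 h4
  refine ⟨by simpa [sphereMeasure] using h3.neg, ?_⟩
  rw [h2, h4, integral_neg, neg_neg]
  rfl

end Sphere

section Convexity
variable {E : Type*} [NormedAddCommGroup E]

theorem hasDerivAt_add_smul [NormedSpace ℝ E] (x v : E) (t : ℝ) :
    HasDerivAt (fun t : ℝ => x + t • v) v t := by
  simpa using ((hasDerivAt_id t).smul_const v).const_add x

theorem hasDerivAt_comp_add_smul [NormedSpace ℝ E] {w : E → ℝ} (hw : ContDiffOn ℝ 1 w {0}ᶜ)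
    {x v : E} {t : ℝ} (h : x + t • v ≠ 0) :
    HasDerivAt (fun t : ℝ => w (x + t • v)) (fderiv ℝ w (x + t • v) v) t :=
  ((contDiffAt_of_contDiffOn_compl (m := 1) hw h).differentiableAt
    (by norm_num)).hasFDerivAt.comp_hasDerivAt t (hasDerivAt_add_smul x v t)

variable [InnerProductSpace ℝ E] {u : E → ℝ}

theorem hess_nonneg_of_convexOn (hu : ContDiffOn ℝ 2 u {0}ᶜ) (hconv : ConvexOn ℝ univ u) {x ξ : E}
    (hx : x ≠ 0) (hxξ : ⟪ξ, x⟫ = 0) : 0 ≤ hess u x ξ ξ := by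
  have hne : ∀ t : ℝ, x + t • ξ ≠ 0 := fun t h => hx <| by
    have := congrArg (fun y => ⟪y, x⟫) h
    simpa [inner_add_left, inner_smul_left, hxξ] using this
  have h1 : ∀ t, HasDerivAt (fun t : ℝ => u (x + t • ξ)) (fderiv ℝ u (x + t • ξ) ξ) t := fun t =>
    hasDerivAt_comp_add_smul (hu.of_le (by norm_num)) (hne t)
  have h2 := hasDerivAt_comp_add_smul (contDiffOn_fderiv_apply hu ξ) (hne 0)
  have hφ : ConvexOn ℝ univ fun t : ℝ => u (x + t • ξ) := by
    refine ⟨convex_univ, fun s _ t _ a b ha hb hab => ?_⟩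
    have := hconv.2 (mem_univ (x + s • ξ)) (mem_univ (x + t • ξ)) ha hb hab
    convert this using 2
    rw [smul_add, smul_add, add_add_add_comm, ← add_smul, hab, one_smul, smul_smul, smul_smul,
      ← add_smul, smul_eq_mul, smul_eq_mul]
  have hmono : Monotone fun t : ℝ => fderiv ℝ u (x + t • ξ) ξ := by
    have := hφ.monotoneOn_deriv fun t _ => (h1 t).differentiableAt
    rwa [monotoneOn_univ, funext fun t => (h1 t).deriv] at this
  have := hmono.deriv_nonneg (x := 0)
  rw [h2.deriv] at this
  simpa [hess] using this

theorem hess_self_left (hhom : ∀ t : ℝ, 0 < t → ∀ y, y ≠ 0 → u (t • y) = t * u y)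
    (hu : ContDiffOn ℝ 2 u {0}ᶜ) {y : E} (hy : y ≠ 0) (b : E) : hess u y y b = 0 := by
  have h := hasDerivAt_comp_add_smul (contDiffOn_fderiv_apply hu b) (x := y) (v := y) (t := 0)
    (by simpa using hy)
  have hc : (fun t : ℝ => fderiv ℝ u (y + t • y) b) =ᶠ[𝓝 0] fun _ => fderiv ℝ u y b := by
    filter_upwards [lt_mem_nhds (show (-1 : ℝ) < 0 by norm_num)] with t ht
    have ht' : 0 < 1 + t := by linarith
    rw [show y + t • y = (1 + t) • y by rw [add_smul, one_smul],
      fderiv_smul_of_homogeneous ht' (hhom _ ht') hy, inv_mul_cancel₀ ht'.ne', one_smul]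
  have := h.unique ((hasDerivAt_const (0 : ℝ) (fderiv ℝ u y b)).congr_of_eventuallyEq hc)
  simpa [hess] using this

theorem hess_smul (hhom : ∀ t : ℝ, 0 < t → ∀ y, y ≠ 0 → u (t • y) = t * u y) {t : ℝ} (ht : 0 < t)
    {y : E} (hy : y ≠ 0) (a b : E) : hess u (t • y) a b = t⁻¹ * hess u y a b := by
  rw [hess, fderiv_smul_of_homogeneous (c := 1) ht (fun z hz => ?_) hy, mul_one]
  · rfl
  · rw [fderiv_smul_of_homogeneous ht (hhom t ht) hz, inv_mul_cancel₀ ht.ne', one_smul, one_mul]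

theorem hess_nonneg_of_forall_orthogonal (hu : ContDiffOn ℝ 2 u {0}ᶜ)
    (hhom : ∀ t : ℝ, 0 < t → ∀ y, y ≠ 0 → u (t • y) = t * u y)
    (h : ∀ x ξ : E, ‖x‖ = 1 → ‖ξ‖ = 1 → ⟪ξ, x⟫ = 0 → 0 ≤ hess u x ξ ξ) {y : E} (hy : y ≠ 0)
    (v : E) : 0 ≤ hess u y v v := by
  have hbil : ∀ x ξ : E, ‖x‖ = 1 → ⟪ξ, x⟫ = 0 → 0 ≤ hess u x ξ ξ := fun x ξ hx hxξ => by
    have hx0 : x ≠ 0 := norm_pos_iff.1 (by rw [hx]; exact one_pos)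
    rcases eq_or_ne ξ 0 with rfl | hξ
    · simp [hess]
    have hξ' : 0 < ‖ξ‖ := norm_pos_iff.2 hξ
    have h1 := h x (‖ξ‖⁻¹ • ξ) hx (by rw [norm_smul, norm_inv, norm_norm, inv_mul_cancel₀ hξ'.ne'])
      (by rw [inner_smul_left, hxξ, mul_zero])
    rw [hess_eq_fderiv_fderiv hu hx0] at h1 ⊢
    simp only [map_smul, smul_apply, smul_eq_mul, ← mul_assoc] at h1
    exact nonneg_of_mul_nonneg_right h1 (by positivity)
  have hunit : ∀ x v : E, ‖x‖ = 1 → 0 ≤ hess u x v v := fun x v hx => by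
    have hx0 : x ≠ 0 := norm_pos_iff.1 (by rw [hx]; exact one_pos)
    set w := v - ⟪x, v⟫ • x with hw
    have hwx : ⟪w, x⟫ = 0 := by
      rw [hw, inner_sub_left, inner_smul_left, real_inner_self_eq_norm_sq, hx, real_inner_comm]
      simp
    have h1 := hbil x w hx hwx
    have h2 := fun b => hess_self_left hhom hu hx0 b
    have h3 := fun b => (hess_symm hu hx0 b x).trans (h2 b)
    have hv : v = w + ⟪x, v⟫ • x := by rw [hw]; abel
    simp only [hess_eq_fderiv_fderiv hu hx0] at h1 h2 h3 ⊢
    rw [hv]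
    simpa [h2, h3] using h1
  have hy' : 0 < ‖y‖ := norm_pos_iff.2 hy
  have h1 := hunit (‖y‖⁻¹ • y) v (by rw [norm_smul, norm_inv, norm_norm, inv_mul_cancel₀ hy'.ne'])
  rw [hess_smul hhom (by positivity) hy, inv_inv] at h1
  exact nonneg_of_mul_nonneg_right h1 hy'

theorem le_of_hess_nonneg_of_segment (hu : ContDiffOn ℝ 2 u {0}ᶜ)
    (h : ∀ y, y ≠ 0 → ∀ v, 0 ≤ hess u y v v) {x y : E} (hxy : (0 : E) ∉ segment ℝ x y)
    {a b : ℝ} (ha : 0 ≤ a) (hb : 0 ≤ b) (hab : a + b = 1) :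
    u (a • x + b • y) ≤ a * u x + b * u y := by
  have hne : ∀ t ∈ Icc (0 : ℝ) 1, x + t • (y - x) ≠ 0 := fun t ht h0 => hxy <| by
    rw [segment_eq_image']
    exact ⟨t, ht, h0⟩
  have h1 : ∀ t ∈ Icc (0 : ℝ) 1, HasDerivAt (fun t : ℝ => u (x + t • (y - x)))
      (fderiv ℝ u (x + t • (y - x)) (y - x)) t := fun t ht =>
    hasDerivAt_comp_add_smul (hu.of_le (by norm_num)) (hne t ht)
  have h2 : ∀ t ∈ Icc (0 : ℝ) 1, HasDerivAt (fun t : ℝ => fderiv ℝ u (x + t • (y - x)) (y - x))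
      (hess u (x + t • (y - x)) (y - x) (y - x)) t := fun t ht =>
    hasDerivAt_comp_add_smul (contDiffOn_fderiv_apply hu (y - x)) (hne t ht)
  have hconv := convexOn_of_hasDerivWithinAt2_nonneg (convex_Icc (0 : ℝ) 1)
    (fun t ht => (h1 t ht).continuousAt.continuousWithinAt)
    (fun t ht => (h1 t (interior_subset ht)).hasDerivWithinAt)
    (fun t ht => (h2 t (interior_subset ht)).hasDerivWithinAt)
    fun t ht => h _ (hne t (interior_subset ht)) _
  have := hconv.2 (left_mem_Icc.2 zero_le_one) (right_mem_Icc.2 zero_le_one) ha hb hab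
  simp only [smul_eq_mul, mul_zero, mul_one, zero_add, zero_smul, add_zero, one_smul,
    add_sub_cancel] at this
  rwa [show x + b • (y - x) = a • x + b • y by rw [eq_sub_of_add_eq hab]; module] at this

theorem convexOn_of_hess_nonneg (hE : 2 < Module.finrank ℝ E) (hcont : Continuous u)
    (hu : ContDiffOn ℝ 2 u {0}ᶜ) (h : ∀ y, y ≠ 0 → ∀ v, 0 ≤ hess u y v v) :
    ConvexOn ℝ univ u := by
  refine ⟨convex_univ, fun x _ y _ a b ha hb hab => ?_⟩
  obtain ⟨e, he⟩ : ∃ e, e ∉ Submodule.span ℝ {x, y} := by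
    by_contra! hall
    have htop : Submodule.span ℝ {x, y} = ⊤ := (Submodule.eq_top_iff').2 hall
    classical
    have hle := finrank_span_finset_le_card (R := ℝ) ({x, y} : Finset E)
    rw [Set.finrank, Finset.coe_pair, htop, finrank_top] at hle
    exact absurd (hle.trans Finset.card_le_two) (by omega)
  have hseg : ∀ s : ℝ, 0 < s → (0 : E) ∉ segment ℝ (x + s • e) (y + s • e) := by
    rintro s hs ⟨c, d, -, -, hcd, h0⟩
    refine he ?_
    have h1 : s • e = (-c) • x + (-d) • y := by
      have : (c • x + d • y) + (c + d) • s • e = 0 := by rw [← h0]; module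
      rw [hcd, one_smul] at this
      rw [eq_neg_of_add_eq_zero_right this]
      module
    rw [← Submodule.smul_mem_iff _ hs.ne', h1]
    exact Submodule.mem_span_pair.2 ⟨_, _, rfl⟩
  have hlim : ∀ z : E, Tendsto (fun s : ℝ => u (z + s • e)) (𝓝[>] 0) (𝓝 (u z)) := fun z => by
    have : Continuous fun s : ℝ => u (z + s • e) := by fun_prop
    simpa using (this.tendsto 0).mono_left nhdsWithin_le_nhds
  refine le_of_tendsto_of_tendsto (hlim (a • x + b • y))
    (((hlim x).const_mul a).add ((hlim y).const_mul b)) ?_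
  filter_upwards [self_mem_nhdsWithin] with s hs
  have := le_of_hess_nonneg_of_segment hu h (hseg s hs) ha hb hab
  rwa [smul_add, smul_add, add_add_add_comm, ← add_smul, hab, one_smul] at this

end Convexity

/-- convexity criterion via the spherical kernel `ω`. -/
theorem stmt_7 (n : ℕ) (hn : 2 ≤ n)
    (f u : EuclideanSpace ℝ (Fin (n + 1)) → ℝ) (K : NNReal)
    (hf_pos : ∀ x ∈ sphere (0 : EuclideanSpace ℝ (Fin (n + 1))) 1, 0 < f x)
    (hf_lip : LipschitzOnWith K f (sphere (0 : EuclideanSpace ℝ (Fin (n + 1))) 1))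
    (hf_hom : ∀ t : ℝ, 0 < t → ∀ y : EuclideanSpace ℝ (Fin (n + 1)), y ≠ 0 →
      f (t • y) = t⁻¹ * f y)
    (hu_cont : Continuous u)
    (hu_hom : ∀ t : ℝ, 0 < t → ∀ y : EuclideanSpace ℝ (Fin (n + 1)), y ≠ 0 →
      u (t • y) = t * u y)
    (hu_C2 : ContDiffOn ℝ 2 u {(0 : EuclideanSpace ℝ (Fin (n + 1)))}ᶜ)
    (hu_lap : ∀ x : EuclideanSpace ℝ (Fin (n + 1)), x ≠ 0 → laplacian u x = f x) :
    (∀ x ∈ sphere (0 : EuclideanSpace ℝ (Fin (n + 1))) 1,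
      ∀ ξ ∈ sphere (0 : EuclideanSpace ℝ (Fin (n + 1))) 1, ⟪ξ, x⟫ = 0 →
        Integrable (fun z : sphere (0 : EuclideanSpace ℝ (Fin (n + 1))) 1 =>
          omegaKer n x z * ⟪ξ, (z : EuclideanSpace ℝ (Fin (n + 1)))⟫ *
            fderiv ℝ f (z : EuclideanSpace ℝ (Fin (n + 1))) ξ) (sphereMeasure n))
    ∧ (ConvexOn ℝ Set.univ u ↔
        ∀ x ∈ sphere (0 : EuclideanSpace ℝ (Fin (n + 1))) 1,
          ∀ ξ ∈ sphere (0 : EuclideanSpace ℝ (Fin (n + 1))) 1, ⟪ξ, x⟫ = 0 →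
            0 ≤ ∫ z : sphere (0 : EuclideanSpace ℝ (Fin (n + 1))) 1,
              omegaKer n x z * ⟪ξ, (z : EuclideanSpace ℝ (Fin (n + 1)))⟫ *
                fderiv ℝ f (z : EuclideanSpace ℝ (Fin (n + 1))) ξ ∂(sphereMeasure n)) := by
  have key : ∀ x ξ : EuclideanSpace ℝ (Fin (n + 1)), ‖x‖ = 1 → ⟪ξ, x⟫ = 0 → _ := fun x ξ hx hxξ =>
    integral_omegaKer_eq hn hf_lip hf_hom hu_hom hu_C2 hu_lap hx hxξ
  have hpos : 0 < ∫ w : EuclideanSpace ℝ (Fin (n + 1)), bump n w := integral_bump_pos hn (by simp)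
  refine ⟨fun x hx ξ _ hxξ => (key x ξ (by simpa using hx) hxξ).1,
    fun h x hx ξ _ hxξ => ?_, fun h => ?_⟩
  · rw [← (key x ξ (by simpa using hx) hxξ).2]
    exact mul_nonneg hpos.le
      (hess_nonneg_of_convexOn hu_C2 h (ne_zero_of_mem_unit_sphere ⟨x, hx⟩) hxξ)
  · refine convexOn_of_hess_nonneg (by simp; omega) hu_cont hu_C2 fun y hy v =>
      hess_nonneg_of_forall_orthogonal hu_C2 hu_hom (fun x ξ hx hξ hxξ => ?_) hy v
    have := h x (by simpa using hx) ξ (by simpa using hξ) hxξ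
    rw [← (key x ξ hx hxξ).2] at this
    exact nonneg_of_mul_nonneg_right this hpos
end

section
/- Let n ≥ 2 and let f : S^n → (0,∞) be a positive Lipschitz function, extended to ℝ^{n+1}\{0} as a function homogeneous of degree −1. Assume that for every unit vector ξ ∈ S^n and every x ∈ ℝ^{n+1} with ⟨ξ, x⟩ = 0, the function t ↦ f(x + tξ) + f(x − tξ) is non-increasing on (0, ∞) (equivalently, ∂_ξ f(x+tξ) − ∂_ξ f(x−tξ) ≤ 0 for all t > 0 wherever these directional derivatives exist). Let u : ℝ^{n+1} → ℝ be continuous, homogeneous of degree 1, of class C² on ℝ^{n+1}\{0}, and satisfy Δu = f on ℝ^{n+1}\{0}. Then u is convex on ℝ^{n+1}. -/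
open MeasureTheory Metric Set
open scoped RealInnerProductSpace

open Filter Topology

section SecondDifference

variable {φ φ' φ'' : ℝ → ℝ} {h c : ℝ}

/-- A bound from above on the second derivative bounds the symmetric second difference. -/
lemma second_diff_le_of_deriv2_le (hh : 0 ≤ h)
    (h1 : ∀ s ∈ Icc (-h) h, HasDerivAt φ (φ' s) s)
    (h2 : ∀ s ∈ Icc (-h) h, HasDerivAt φ' (φ'' s) s)
    (h3 : ∀ s ∈ Icc (-h) h, φ'' s ≤ c) :
    φ h + φ (-h) - 2 * φ 0 ≤ c * h ^ 2 := by
  have d2 : ∀ s ∈ Icc (-h) h, HasDerivAt (fun s => φ' s - c * s) (φ'' s - c * 1) s := fun s hs =>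
    (h2 s hs).sub ((hasDerivAt_id s).const_mul c)
  have m2 : AntitoneOn (fun s => φ' s - c * s) (Icc (-h) h) := by
    refine antitoneOn_of_hasDerivWithinAt_nonpos (f' := fun s => φ'' s - c * 1) (convex_Icc _ _)
      (fun s hs => (d2 s hs).continuousAt.continuousWithinAt)
      (fun s hs => (d2 s (interior_subset hs)).hasDerivWithinAt) (fun s hs => ?_)
    linarith [h3 s (interior_subset hs)]
  have neg_mem : ∀ s ∈ Icc 0 h, -s ∈ Icc (-h) h := fun s hs => ⟨by linarith [hs.2], by
    linarith [hs.1]⟩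
  have pos_mem : ∀ s ∈ Icc 0 h, s ∈ Icc (-h) h := fun s hs => ⟨by linarith [hs.1], hs.2⟩
  have d1 : ∀ s ∈ Icc 0 h, HasDerivAt (fun s => φ s + φ (-s) - c * s ^ 2)
      (φ' s + φ' (-s) * (-1) - c * (2 * s)) s := fun s hs => by
    have := (((h1 s (pos_mem s hs)).add
      ((h1 (-s) (neg_mem s hs)).comp s (hasDerivAt_neg s))).sub ((hasDerivAt_pow 2 s).const_mul c))
    exact this.congr_deriv (by simp)
  have m1 : AntitoneOn (fun s => φ s + φ (-s) - c * s ^ 2) (Icc 0 h) := by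
    refine antitoneOn_of_hasDerivWithinAt_nonpos (convex_Icc _ _)
      (fun s hs => (d1 s hs).continuousAt.continuousWithinAt)
      (fun s hs => (d1 s (interior_subset hs)).hasDerivWithinAt) (fun s hs => ?_)
    have hs' := interior_subset hs
    have : φ' s - c * s ≤ φ' (-s) - c * (-s) :=
      m2 (neg_mem s hs') (pos_mem s hs') (by linarith [hs'.1])
    linarith
  have := m1 ⟨le_rfl, hh⟩ ⟨hh, le_rfl⟩ hh
  simp only [neg_zero] at this
  linarith

lemma le_second_diff_of_le_deriv2 (hh : 0 ≤ h)
    (h1 : ∀ s ∈ Icc (-h) h, HasDerivAt φ (φ' s) s)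
    (h2 : ∀ s ∈ Icc (-h) h, HasDerivAt φ' (φ'' s) s)
    (h3 : ∀ s ∈ Icc (-h) h, c ≤ φ'' s) :
    c * h ^ 2 ≤ φ h + φ (-h) - 2 * φ 0 := by
  have := second_diff_le_of_deriv2_le (φ := -φ) (φ' := -φ') (φ'' := -φ'') (c := -c) hh
    (fun s hs => (h1 s hs).neg) (fun s hs => (h2 s hs).neg) (fun s hs => neg_le_neg (h3 s hs))
  simp only [Pi.neg_apply] at this
  linarith

end SecondDifference

section DirectionalDerivatives

variable {V : Type*} [NormedAddCommGroup V] [NormedSpace ℝ V] {u : V → ℝ} {U : Set V}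

lemma hasDerivAt_add_smul_s11 (x ξ : V) (s : ℝ) : HasDerivAt (fun s : ℝ => x + s • ξ) ξ s := by
  simpa using ((hasDerivAt_id s).smul_const ξ).const_add x

lemma hasDerivAt_comp_line (hU : IsOpen U) (hu : ContDiffOn ℝ 2 u U) {x ξ : V} {s : ℝ}
    (hx : x + s • ξ ∈ U) :
    HasDerivAt (fun s : ℝ => u (x + s • ξ)) (fderiv ℝ u (x + s • ξ) ξ) s := by
  have := (hu.contDiffAt (hU.mem_nhds hx)).differentiableAt (by norm_num)
  exact this.hasFDerivAt.comp_hasDerivAt s (hasDerivAt_add_smul_s11 x ξ s)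

lemma contDiffOn_fderiv (hU : IsOpen U) (hu : ContDiffOn ℝ 2 u U) :
    ContDiffOn ℝ 1 (fderiv ℝ u) U :=
  hu.fderiv_of_isOpen hU (by norm_num)

lemma hasDerivAt_fderiv_comp_line (hU : IsOpen U) (hu : ContDiffOn ℝ 2 u U) {x ξ η : V} {s : ℝ}
    (hx : x + s • ξ ∈ U) :
    HasDerivAt (fun s : ℝ => fderiv ℝ u (x + s • ξ) η)
      (fderiv ℝ (fderiv ℝ u) (x + s • ξ) ξ η) s := by
  have := ((contDiffOn_fderiv hU hu).contDiffAt (hU.mem_nhds hx)).differentiableAt (by norm_num)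
  have h := this.hasFDerivAt.comp_hasDerivAt s (hasDerivAt_add_smul_s11 x ξ s)
  exact ((ContinuousLinearMap.apply ℝ ℝ η).hasFDerivAt.comp_hasDerivAt s h)

lemma continuousOn_fderiv_fderiv (hU : IsOpen U) (hu : ContDiffOn ℝ 2 u U) :
    ContinuousOn (fderiv ℝ (fderiv ℝ u)) U :=
  (contDiffOn_fderiv hU hu).continuousOn_fderiv_of_isOpen hU (by norm_num)

end DirectionalDerivatives

section Cap

variable {V : Type*} [NormedAddCommGroup V]

/-- The radial weight `(1 - ‖z‖²)₊`. -/
noncomputable def cap (z : V) : ℝ := max 0 (1 - ‖z‖ ^ 2)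

lemma cap_nonneg (z : V) : 0 ≤ cap z := le_max_left _ _

lemma cap_anti {z w : V} (h : ‖z‖ ≤ ‖w‖) : cap w ≤ cap z := by
  unfold cap
  gcongr

lemma cap_eq_zero {z : V} (h : 1 ≤ ‖z‖) : cap z = 0 := by
  unfold cap
  exact max_eq_left (by nlinarith)

lemma continuous_cap : Continuous (cap : V → ℝ) := by
  unfold cap
  fun_prop

lemma hasCompactSupport_cap [ProperSpace V] : HasCompactSupport (cap : V → ℝ) :=
  HasCompactSupport.intro (isCompact_closedBall (0 : V) 1) fun z hz =>
    cap_eq_zero (by simpa using (not_le.1 (by simpa using hz)).le)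

lemma hasDerivAt_max_zero_sq (s : ℝ) :
    HasDerivAt (fun s : ℝ => (max 0 s) ^ 2) (2 * max 0 s) s := by
  rcases lt_trichotomy s 0 with hs | rfl | hs
  · rw [max_eq_left hs.le, mul_zero]
    refine (hasDerivAt_const s (0 : ℝ)).congr_of_eventuallyEq ?_
    filter_upwards [Iio_mem_nhds hs] with t ht
    simp [max_eq_left (mem_Iio.1 ht).le]
  · rw [hasDerivAt_iff_isLittleO]
    simp only [max_self, mul_zero, sub_zero, ne_eq, OfNat.ofNat_ne_zero, not_false_eq_true,
      zero_pow, smul_eq_mul]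
    refine Asymptotics.IsBigO.trans_isLittleO (g := fun x : ℝ => x ^ 2) ?_ ?_
    · refine Asymptotics.IsBigO.of_bound 1 (Eventually.of_forall fun x => ?_)
      rw [one_mul, norm_pow, norm_pow]
      gcongr
      rw [Real.norm_eq_abs, Real.norm_eq_abs, abs_of_nonneg (le_max_left _ _)]
      exact max_le (abs_nonneg x) (le_abs_self x)
    · simpa using Asymptotics.isLittleO_pow_id (𝕜 := ℝ) (n := 2) (by norm_num)
  · rw [max_eq_right hs.le]
    have := hasDerivAt_pow 2 s
    simp only [Nat.cast_ofNat, Nat.add_one_sub_one, pow_one] at this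
    refine this.congr_of_eventuallyEq ?_
    filter_upwards [Ioi_mem_nhds hs] with t ht
    simp [max_eq_right (mem_Ioi.1 ht).le]

lemma hasFDerivAt_cap_sq [InnerProductSpace ℝ V] (z : V) :
    HasFDerivAt (fun z : V => cap z ^ 2) ((-4 * cap z) • innerSL ℝ z) z := by
  have h1 : HasFDerivAt (fun z : V => 1 - ‖z‖ ^ 2) (-(2 • innerSL ℝ z)) z :=
    (hasStrictFDerivAt_norm_sq z).hasFDerivAt.const_sub 1
  refine ((hasDerivAt_max_zero_sq (1 - ‖z‖ ^ 2)).comp_hasFDerivAt z h1).congr_fderiv ?_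
  ext w
  simp [cap]
  ring

end Cap

section RadialMeans

variable {m : ℕ}

local notation "𝔼" => EuclideanSpace ℝ (Fin m)

lemma integrable_cap_mul {g : 𝔼 → ℝ} (hg : Continuous g) :
    Integrable (fun z : 𝔼 => cap z * g z) :=
  (continuous_cap.mul hg).integrable_of_hasCompactSupport hasCompactSupport_cap.mul_right

lemma integrable_cap_sq_mul {g : 𝔼 → ℝ} (hg : Continuous g) :
    Integrable (fun z : 𝔼 => cap z ^ 2 * g z) := by
  simpa only [pow_two, mul_assoc] using
    integrable_cap_mul (g := fun z => cap z * g z) (continuous_cap.mul hg)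

lemma integral_cap_pos [NeZero m] : 0 < ∫ z : 𝔼, cap z := by
  refine continuous_cap.integral_pos_of_hasCompactSupport_nonneg_nonzero hasCompactSupport_cap
    cap_nonneg (x := 0) ?_
  simp [cap]

lemma integral_cap_sq_pos [NeZero m] : 0 < ∫ z : 𝔼, cap z ^ 2 := by
  refine (continuous_cap.pow 2).integral_pos_of_hasCompactSupport_nonneg_nonzero ?_
    (fun z => sq_nonneg _) (x := 0) ?_
  · exact hasCompactSupport_cap.comp_left (g := fun s : ℝ => s ^ 2) (by simp)
  · simp [cap]

/-- Integration by parts against the weight `cap`. -/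
lemma integral_cap_mul_coord_mul {F : 𝔼 → ℝ} (hF : ContDiff ℝ 1 F) (i : Fin m) :
    ∫ z : 𝔼, cap z * (z i * F z) =
      1 / 4 * ∫ z : 𝔼, cap z ^ 2 * fderiv ℝ F z (EuclideanSpace.single i 1) := by
  have hd : ∀ z : 𝔼, fderiv ℝ (fun z : 𝔼 => cap z ^ 2) z (EuclideanSpace.single i 1) =
      -4 * (cap z * z i) := fun z => by
    rw [(hasFDerivAt_cap_sq z).fderiv]
    simp [EuclideanSpace.inner_single_right]
    ring
  have hcF : Continuous fun z => fderiv ℝ F z (EuclideanSpace.single i 1) :=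
    (hF.continuous_fderiv (by norm_num)).clm_apply continuous_const
  have h := integral_mul_fderiv_eq_neg_fderiv_mul_of_integrable (μ := volume)
    (f := fun z : 𝔼 => cap z ^ 2) (g := F) (v := EuclideanSpace.single i 1)
    (by
      simp only [hd]
      have : Continuous fun z : 𝔼 => -4 * z i * F z := by
        have := hF.continuous
        fun_prop
      refine (integrable_cap_mul this).congr (ae_of_all _ fun z => ?_)
      simp only
      ring)
    (integrable_cap_sq_mul hcF) (integrable_cap_sq_mul hF.continuous)
    (fun z _ => (hasFDerivAt_cap_sq z).differentiableAt)
    (fun z _ => hF.differentiable (by norm_num) z)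
  rw [h]
  simp only [hd]
  rw [← integral_neg, ← integral_const_mul]
  congr 1 with z
  ring

/-- The weighted radial means `r ↦ ∫ cap z * g (x + r z)` grow at a rate given by the weighted
means of the Laplacian. -/
lemma hasDerivAt_integral_cap {g : 𝔼 → ℝ} (hg : ContDiff ℝ 2 g) (x : 𝔼) (r : ℝ) :
    HasDerivAt (fun r : ℝ => ∫ z : 𝔼, cap z * g (x + r • z))
      (r / 4 * ∫ z : 𝔼, cap z ^ 2 * laplacian g (x + r • z)) r := by
  have hg1 : ContDiff ℝ 1 (fderiv ℝ g) := hg.fderiv_right (by norm_num)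
  have hD : Continuous fun p : ℝ × 𝔼 => fderiv ℝ g (x + p.1 • p.2) p.2 :=
    (hg1.continuous.comp (by fun_prop)).clm_apply continuous_snd
  obtain ⟨C, hC⟩ := ((isCompact_closedBall r 1).prod
    (isCompact_closedBall (0 : 𝔼) 1)).exists_bound_of_continuousOn hD.continuousOn
  have key := (hasDerivAt_integral_of_dominated_loc_of_deriv_le (μ := (volume : Measure 𝔼))
    (F := fun (r : ℝ) z => cap z * g (x + r • z))
    (F' := fun (r : ℝ) z => cap z * fderiv ℝ g (x + r • z) z) (x₀ := r)
    (bound := fun z => cap z * C) (closedBall_mem_nhds r one_pos)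
    (Eventually.of_forall fun r => (integrable_cap_mul
      (hg.continuous.comp (by fun_prop))).aestronglyMeasurable)
    (integrable_cap_mul (hg.continuous.comp (by fun_prop)))
    (integrable_cap_mul (hD.comp (by fun_prop : Continuous fun z : 𝔼 => (r, z)))).aestronglyMeasurable
    (ae_of_all _ fun z t ht => by
      rw [norm_mul, Real.norm_of_nonneg (cap_nonneg z)]
      by_cases hz : ‖z‖ ≤ 1
      · exact mul_le_mul_of_nonneg_left (hC (t, z) ⟨ht, by simpa using hz⟩) (cap_nonneg z)
      · simp [cap_eq_zero (not_le.1 hz).le])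
    (integrable_cap_mul continuous_const)
    (ae_of_all _ fun z t _ =>
      (hasDerivAt_comp_line isOpen_univ hg.contDiffOn (mem_univ (x + t • z))).const_mul _)).2
  refine key.congr_deriv ?_
  let e : Fin m → 𝔼 := fun i => EuclideanSpace.single i 1
  have hF : ∀ i, ContDiff ℝ 1 fun z : 𝔼 => fderiv ℝ g (x + r • z) (e i) := fun i =>
    (hg1.comp (by fun_prop : ContDiff ℝ 1 fun z : 𝔼 => x + r • z)).clm_apply contDiff_const
  have hFd : ∀ i (z : 𝔼), fderiv ℝ (fun z : 𝔼 => fderiv ℝ g (x + r • z) (e i)) z (e i) =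
      r * fderiv ℝ (fun y => fderiv ℝ g y (e i)) (x + r • z) (e i) := fun i z => by
    have h1 : HasFDerivAt (fun z : 𝔼 => x + r • z) (r • ContinuousLinearMap.id ℝ 𝔼) z :=
      ((hasFDerivAt_id z).const_smul r).const_add x
    have h2 : DifferentiableAt ℝ (fun y => fderiv ℝ g y (e i)) (x + r • z) :=
      (hg1.clm_apply contDiff_const).differentiable (by norm_num) _
    have h3 := (h2.hasFDerivAt.comp z h1).fderiv
    change fderiv ℝ ((fun y => fderiv ℝ g y (e i)) ∘ fun z : 𝔼 => x + r • z) z (e i) = _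
    rw [h3]
    simp
  have hsum : ∀ z : 𝔼, fderiv ℝ g (x + r • z) z = ∑ i, z i * fderiv ℝ g (x + r • z) (e i) :=
    fun z => by
      have hz : z = ∑ i, z i • e i := by
        ext j
        simp [e, Pi.single_apply]
      conv_lhs => rw [hz, map_sum]
      rw [← hz]
      simp
  simp only [hsum, Finset.mul_sum, laplacian]
  rw [integral_finsetSum _ fun i _ => integrable_cap_mul
    (g := fun z => z i * fderiv ℝ g (x + r • z) (e i)) (Continuous.mul (by fun_prop)
    (hF i).continuous), integral_finsetSum, Finset.mul_sum]
  · refine Finset.sum_congr rfl fun i _ => ?_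
    rw [integral_cap_mul_coord_mul (hF i) i]
    simp only [show EuclideanSpace.single i (1 : ℝ) = e i from rfl, hFd]
    rw [← integral_const_mul, ← integral_const_mul]
    congr 1 with z
    ring
  · intro i _
    refine integrable_cap_sq_mul ?_
    have : Continuous fun y : 𝔼 => fderiv ℝ (fun y => fderiv ℝ g y (e i)) y (e i) :=
      ((hg1.clm_apply contDiff_const).continuous_fderiv (by norm_num)).clm_apply continuous_const
    exact this.comp (by fun_prop)

end RadialMeans

section Symmetrization

variable {m : ℕ}

local notation "𝔼" => EuclideanSpace ℝ (Fin m)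

/-- Discrete integration by parts for symmetric second differences. -/
lemma integral_cap_sq_mul_second_diff {F : 𝔼 → ℝ} (hF : Continuous F) (η : 𝔼) :
    ∫ z : 𝔼, cap z ^ 2 * (F (z + η) + F (z - η) - 2 * F z) =
      ∫ z : 𝔼, (cap (z - η) ^ 2 - cap z ^ 2) * (F z - F (z - η)) := by
  have i1 : Integrable fun z : 𝔼 => cap z ^ 2 * (F (z + η) - F z) :=
    integrable_cap_sq_mul (by fun_prop)
  have i2 : Integrable fun z : 𝔼 => cap z ^ 2 * (F z - F (z - η)) :=
    integrable_cap_sq_mul (by fun_prop)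
  have e1 : ∫ z : 𝔼, cap z ^ 2 * (F (z + η) - F z) =
      ∫ z : 𝔼, cap (z - η) ^ 2 * (F z - F (z - η)) := by
    rw [← integral_sub_right_eq_self _ η]
    simp
  have i3 : Integrable fun z : 𝔼 => cap (z - η) ^ 2 * (F z - F (z - η)) := by
    simpa using i1.comp_sub_right η
  calc ∫ z : 𝔼, cap z ^ 2 * (F (z + η) + F (z - η) - 2 * F z)
      = ∫ z : 𝔼, (cap z ^ 2 * (F (z + η) - F z) - cap z ^ 2 * (F z - F (z - η))) := by
        congr 1 with z
        ring
    _ = _ := by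
        rw [integral_sub i1 i2, e1, ← integral_sub i3 i2]
        congr 1 with z
        ring

lemma integral_cap_sq_second_diff_nonpos {F : 𝔼 → ℝ} (hF : Continuous F) {ξ : 𝔼} (hξ : ‖ξ‖ = 1)
    (t : ℝ)
    (hmono : ∀ y : 𝔼, ⟪ξ, y⟫ = 0 → ∀ a b : ℝ, |a| ≤ |b| → |b| ≤ |a| + |t| → ‖y + a • ξ‖ < 1 →
      F (y + b • ξ) + F (y - b • ξ) ≤ F (y + a • ξ) + F (y - a • ξ)) :
    ∫ z : 𝔼, cap z ^ 2 * (F (z + t • ξ) + F (z - t • ξ) - 2 * F z) ≤ 0 := by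
  have hξξ : ⟪ξ, ξ⟫ = 1 := by rw [real_inner_self_eq_norm_sq, hξ, one_pow]
  let σ : 𝔼 ≃ₗᵢ[ℝ] 𝔼 := (ℝ ∙ ξ)ᗮ.reflection
  have hσ : ∀ y : 𝔼, ⟪ξ, y⟫ = 0 → ∀ a : ℝ, σ (y + a • ξ) = y - a • ξ := fun y hy a => by
    have h1 : σ y = y := Submodule.reflection_mem_subspace_eq_self
      (Submodule.mem_orthogonal_singleton_iff_inner_right.2 hy)
    have h2 : σ ξ = -ξ := Submodule.reflection_orthogonalComplement_singleton_eq_neg ξ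
    rw [map_add, map_smul, h1, h2, smul_neg, sub_eq_add_neg]
  have hσξ : σ (t • ξ) = - (t • ξ) := by simpa using hσ 0 (by simp) t
  have hcapσ : ∀ z, cap (σ z) = cap z := fun z => by simp [cap]
  have hdecomp : ∀ z : 𝔼, ∃ y : 𝔼, ∃ a : ℝ, ⟪ξ, y⟫ = 0 ∧ z = y + a • ξ := fun z =>
    ⟨z - ⟪ξ, z⟫ • ξ, ⟪ξ, z⟫, by rw [inner_sub_right, inner_smul_right, hξξ]; ring, by simp⟩
  have hnorm : ∀ y : 𝔼, ⟪ξ, y⟫ = 0 → ∀ a : ℝ, ‖y + a • ξ‖ ^ 2 = ‖y‖ ^ 2 + a ^ 2 := fun y hy a => by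
    rw [norm_add_sq_real, inner_smul_right, real_inner_comm, hy, norm_smul, hξ]
    simp
  have hsF : Continuous fun z => F z + F (σ z) := hF.add (hF.comp σ.continuous)
  have key : ∫ z : 𝔼, cap z ^ 2 * ((F (z + t • ξ) + F (σ (z + t • ξ))) +
      (F (z - t • ξ) + F (σ (z - t • ξ))) - 2 * (F z + F (σ z))) ≤ 0 := by
    rw [integral_cap_sq_mul_second_diff hsF (t • ξ)]
    refine integral_nonpos fun z => ?_
    obtain ⟨y, a, hy, rfl⟩ := hdecomp z
    have e : y + a • ξ - t • ξ = y + (a - t) • ξ := by module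
    simp only [Pi.zero_apply, e, hσ y hy]
    have aux : ∀ a b : ℝ, |a| ≤ |b| → |b| ≤ |a| + |t| →
        (cap (y + a • ξ) = cap (y + b • ξ)) ∨
        (cap (y + b • ξ) ≤ cap (y + a • ξ) ∧
          F (y + b • ξ) + F (y - b • ξ) ≤ F (y + a • ξ) + F (y - a • ξ)) := fun a b hab hb => by
      have hn : ‖y + a • ξ‖ ≤ ‖y + b • ξ‖ := by
        rw [← sq_le_sq₀ (norm_nonneg _) (norm_nonneg _), hnorm y hy, hnorm y hy]
        gcongr 1
        exact sq_le_sq.2 hab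
      by_cases h1 : ‖y + a • ξ‖ < 1
      · exact Or.inr ⟨cap_anti hn, hmono y hy a b hab hb h1⟩
      · left
        rw [cap_eq_zero (not_lt.1 h1), cap_eq_zero ((not_lt.1 h1).trans hn)]
    rcases le_total |a - t| |a| with h | h
    · rcases aux (a - t) a h (by simpa using abs_add_le (a - t) t) with h | ⟨h1, h2⟩
      · simp [h]
      · exact mul_nonpos_of_nonneg_of_nonpos
          (sub_nonneg.2 (pow_le_pow_left₀ (cap_nonneg _) h1 2)) (sub_nonpos.2 h2)
    · rcases aux a (a - t) h (abs_sub a t) with h | ⟨h1, h2⟩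
      · simp [h]
      · exact mul_nonpos_of_nonpos_of_nonneg
          (sub_nonpos.2 (pow_le_pow_left₀ (cap_nonneg _) h1 2)) (sub_nonneg.2 h2)
  have i1 : Integrable fun z : 𝔼 => cap z ^ 2 * (F (z + t • ξ) + F (z - t • ξ) - 2 * F z) :=
    integrable_cap_sq_mul (by fun_prop)
  have i2 : Integrable fun z : 𝔼 => cap (σ z) ^ 2 *
      (F (σ z + t • ξ) + F (σ z - t • ξ) - 2 * F (σ z)) := by
    simp only [hcapσ]
    exact integrable_cap_sq_mul (by fun_prop)
  have hsplit := integral_add i1 i2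
  have hinv : ∫ z : 𝔼, cap (σ z) ^ 2 * (F (σ z + t • ξ) + F (σ z - t • ξ) - 2 * F (σ z)) =
      ∫ z : 𝔼, cap z ^ 2 * (F (z + t • ξ) + F (z - t • ξ) - 2 * F z) :=
    σ.measurePreserving.integral_comp σ.toHomeomorph.measurableEmbedding
      fun z => cap z ^ 2 * (F (z + t • ξ) + F (z - t • ξ) - 2 * F z)
  rw [hinv] at hsplit
  have heq : ∫ z : 𝔼, cap z ^ 2 * ((F (z + t • ξ) + F (σ (z + t • ξ))) +
      (F (z - t • ξ) + F (σ (z - t • ξ))) - 2 * (F z + F (σ z))) =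
      ∫ z : 𝔼, (cap z ^ 2 * (F (z + t • ξ) + F (z - t • ξ) - 2 * F z) + cap (σ z) ^ 2 *
      (F (σ z + t • ξ) + F (σ z - t • ξ) - 2 * F (σ z))) := by
    congr 1 with z
    rw [hcapσ, map_add, map_sub, hσξ, sub_neg_eq_add, ← sub_eq_add_neg]
    ring
  linarith

end Symmetrization

section NormAlongLines

variable {V : Type*} [NormedAddCommGroup V] [InnerProductSpace ℝ V]

lemma hasDerivAt_norm_line {x ξ : V} {s : ℝ} (h : x + s • ξ ≠ 0) :
    HasDerivAt (fun s : ℝ => ‖x + s • ξ‖) (⟪x + s • ξ, ξ⟫ / ‖x + s • ξ‖) s := by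
  have h1 := ((hasStrictFDerivAt_norm_sq (x + s • ξ)).hasFDerivAt.comp_hasDerivAt s
    (hasDerivAt_add_smul_s11 x ξ s)).sqrt (by simpa using h)
  simp only [Function.comp_def, Real.sqrt_sq (norm_nonneg _)] at h1
  refine h1.congr_deriv ?_
  have := norm_ne_zero_iff.2 h
  simp only [smul_apply, innerSL_apply_apply, nsmul_eq_mul]
  push_cast
  field_simp

lemma hasDerivAt_inner_line (x ξ : V) (s : ℝ) :
    HasDerivAt (fun s : ℝ => ⟪x + s • ξ, ξ⟫) (‖ξ‖ ^ 2) s := by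
  have := (hasDerivAt_add_smul_s11 x ξ s).inner ℝ (hasDerivAt_const s ξ)
  simpa [real_inner_self_eq_norm_sq] using this

lemma hasDerivAt_inner_div_norm_line {x ξ : V} {s : ℝ} (h : x + s • ξ ≠ 0) :
    HasDerivAt (fun s : ℝ => ⟪x + s • ξ, ξ⟫ / ‖x + s • ξ‖)
      ((‖ξ‖ ^ 2 * ‖x + s • ξ‖ ^ 2 - ⟪x + s • ξ, ξ⟫ ^ 2) / ‖x + s • ξ‖ ^ 3) s := by
  have h0 := norm_ne_zero_iff.2 h
  refine ((hasDerivAt_inner_line x ξ s).div (hasDerivAt_norm_line h) h0).congr_deriv ?_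
  field_simp

lemma hasDerivAt_norm_inv_line {x ξ : V} {s : ℝ} (h : x + s • ξ ≠ 0) :
    HasDerivAt (fun s : ℝ => ‖x + s • ξ‖⁻¹) (-⟪x + s • ξ, ξ⟫ / ‖x + s • ξ‖ ^ 3) s := by
  have h0 := norm_ne_zero_iff.2 h
  refine ((hasDerivAt_norm_line h).inv h0).congr_deriv ?_
  field_simp

lemma hasDerivAt_neg_inner_div_norm_cube_line {x ξ : V} {s : ℝ} (hξ : ‖ξ‖ = 1)
    (h : x + s • ξ ≠ 0) :
    HasDerivAt (fun s : ℝ => -⟪x + s • ξ, ξ⟫ / ‖x + s • ξ‖ ^ 3)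
      ((3 * ⟪x + s • ξ, ξ⟫ ^ 2 - ‖x + s • ξ‖ ^ 2) / ‖x + s • ξ‖ ^ 5) s := by
  have h0 := norm_ne_zero_iff.2 h
  refine ((hasDerivAt_inner_line x ξ s).neg.div ((hasDerivAt_norm_line h).pow 3)
    (pow_ne_zero 3 h0)).congr_deriv ?_
  rw [hξ]
  field_simp
  simp
  ring

lemma contDiffOn_norm_compl_zero : ContDiffOn ℝ 2 (fun x : V => ‖x‖) {0}ᶜ := fun _ hx =>
  (contDiffAt_norm ℝ hx).contDiffWithinAt

lemma fderiv_fderiv_norm_apply {x : V} (hx : x ≠ 0) (ξ : V) :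
    fderiv ℝ (fderiv ℝ fun x : V => ‖x‖) x ξ ξ =
      (‖ξ‖ ^ 2 * ‖x‖ ^ 2 - ⟪x, ξ⟫ ^ 2) / ‖x‖ ^ 3 := by
  have hU : IsOpen ({0}ᶜ : Set V) := isOpen_compl_singleton
  have hx0 : x + (0 : ℝ) • ξ ≠ 0 := by simpa
  have h1 := hasDerivAt_fderiv_comp_line (η := ξ) hU contDiffOn_norm_compl_zero hx0
  have h2 := hasDerivAt_inner_div_norm_line hx0
  have hne : ∀ᶠ s : ℝ in 𝓝 0, x + s • ξ ≠ 0 :=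
    (hasDerivAt_add_smul_s11 x ξ 0).continuousAt.eventually_ne hx0
  have h3 : (fun s : ℝ => fderiv ℝ (fun x : V => ‖x‖) (x + s • ξ) ξ) =ᶠ[𝓝 0]
      fun s : ℝ => ⟪x + s • ξ, ξ⟫ / ‖x + s • ξ‖ := by
    filter_upwards [hne] with s hs
    exact (hasDerivAt_comp_line hU contDiffOn_norm_compl_zero hs).unique (hasDerivAt_norm_line hs)
  simpa using h1.unique (h2.congr_of_eventuallyEq h3)

/-- Uniform concavity of `1 / ‖x‖` in directions orthogonal to a nearby unit vector. -/
lemma norm_inv_second_diff_le {x₀ x ξ : V} (hx₀ : ‖x₀‖ = 1) (hξ : ‖ξ‖ = 1) (horth : ⟪ξ, x₀⟫ = 0)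
    {h : ℝ} (hh : 0 ≤ h) (hh' : h ≤ 1 / 8) (hx : ‖x - x₀‖ ≤ 1 / 8) :
    ‖x + h • ξ‖⁻¹ + ‖x - h • ξ‖⁻¹ - 2 * ‖x‖⁻¹ ≤ -(1 / 10) * h ^ 2 := by
  have hd : ∀ s ∈ Icc (-h) h, ‖x + s • ξ - x₀‖ ≤ 1 / 4 := fun s hs => by
    have e : x + s • ξ - x₀ = (x - x₀) + s • ξ := by abel
    rw [e]
    refine (norm_add_le _ _).trans ?_
    rw [norm_smul, hξ, mul_one, Real.norm_eq_abs]
    linarith [abs_le.2 hs]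
  have hlow : ∀ s ∈ Icc (-h) h, 3 / 4 ≤ ‖x + s • ξ‖ := fun s hs => by
    have := norm_sub_norm_le x₀ (x + s • ξ)
    rw [norm_sub_rev, hx₀] at this
    linarith [hd s hs]
  have hup : ∀ s ∈ Icc (-h) h, ‖x + s • ξ‖ ≤ 5 / 4 := fun s hs => by
    have := norm_sub_norm_le (x + s • ξ) x₀
    rw [hx₀] at this
    linarith [hd s hs]
  have hne : ∀ s ∈ Icc (-h) h, x + s • ξ ≠ 0 := fun s hs => by
    rw [← norm_pos_iff]
    linarith [hlow s hs]
  have hin : ∀ s ∈ Icc (-h) h, ⟪x + s • ξ, ξ⟫ ^ 2 ≤ (1 / 4) ^ 2 := fun s hs => by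
    have e : ⟪x + s • ξ, ξ⟫ = ⟪x + s • ξ - x₀, ξ⟫ := by
      rw [inner_sub_left, real_inner_comm ξ x₀, horth, sub_zero]
    rw [e, sq_le_sq, abs_of_pos (by norm_num : (0 : ℝ) < 1 / 4)]
    refine (abs_real_inner_le_norm _ _).trans ?_
    rw [hξ, mul_one]
    exact hd s hs
  have := second_diff_le_of_deriv2_le (c := -(1 / 10)) hh
    (fun s hs => hasDerivAt_norm_inv_line (hne s hs))
    (fun s hs => hasDerivAt_neg_inner_div_norm_cube_line hξ (hne s hs)) (fun s hs => by
      have h1 := hlow s hs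
      have h2 := hup s hs
      have h3 := hin s hs
      have h5 : ‖x + s • ξ‖ ^ 5 ≤ (5 / 4) ^ 5 := by gcongr
      rw [div_le_iff₀ (by positivity)]
      nlinarith)
  simpa [← sub_eq_add_neg] using this

end NormAlongLines

section Laplacian

variable {m : ℕ}

local notation "𝔼" => EuclideanSpace ℝ (Fin m)

lemma laplacian_eq_sum_fderiv_fderiv {u : 𝔼 → ℝ} {x : 𝔼} (hu : ContDiffAt ℝ 2 u x) :
    laplacian u x =
      ∑ i, fderiv ℝ (fderiv ℝ u) x (EuclideanSpace.single i 1) (EuclideanSpace.single i 1) := by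
  refine Finset.sum_congr rfl fun i _ => ?_
  have h : HasFDerivAt (fderiv ℝ u) (fderiv ℝ (fderiv ℝ u) x) x :=
    ((hu.fderiv_right (m := 1) (by norm_num)).differentiableAt (by norm_num)).hasFDerivAt
  have := ((ContinuousLinearMap.apply ℝ ℝ
    (EuclideanSpace.single i (1 : ℝ))).hasFDerivAt.comp x h).fderiv
  simp only [Function.comp_def, ContinuousLinearMap.apply_apply] at this
  rw [this]
  simp

lemma laplacian_congr {u v : 𝔼 → ℝ} {x : 𝔼} (h : u =ᶠ[𝓝 x] v) :
    laplacian u x = laplacian v x := by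
  refine Finset.sum_congr rfl fun i _ => ?_
  have : (fun y => fderiv ℝ u y (EuclideanSpace.single i 1)) =ᶠ[𝓝 x]
      fun y => fderiv ℝ v y (EuclideanSpace.single i 1) := by
    filter_upwards [h.eventuallyEq_nhds] with y hy
    rw [hy.fderiv_eq]
  rw [this.fderiv_eq]

lemma continuous_laplacian {u : 𝔼 → ℝ} (hu : ContDiff ℝ 2 u) : Continuous (laplacian u) := by
  refine continuous_finsetSum _ fun i _ => ?_
  exact (((hu.fderiv_right (m := 1) (by norm_num)).clm_apply contDiff_const).continuous_fderiv
    (by norm_num)).clm_apply continuous_const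

lemma laplacian_norm {x : 𝔼} (hx : x ≠ 0) :
    laplacian (fun x : 𝔼 => ‖x‖) x = (m - 1) * ‖x‖⁻¹ := by
  rw [laplacian_eq_sum_fderiv_fderiv (contDiffAt_norm ℝ hx)]
  have h0 := norm_ne_zero_iff.2 hx
  simp only [fderiv_fderiv_norm_apply hx, ← Finset.sum_div, Finset.sum_sub_distrib]
  have : ∑ i, ⟪x, EuclideanSpace.single i (1 : ℝ)⟫ ^ 2 = ‖x‖ ^ 2 := by
    simp [EuclideanSpace.inner_single_right, EuclideanSpace.norm_sq_eq]
  rw [this]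
  simp
  field_simp

/-- A function of class `C²` away from the origin agrees near a unit vector with a global `C²`
function. -/
lemma exists_contDiff_eventuallyEq {u : 𝔼 → ℝ} (hu : ContDiffOn ℝ 2 u {0}ᶜ) {x₀ : 𝔼}
    (hx₀ : ‖x₀‖ = 1) :
    ∃ g : 𝔼 → ℝ, ContDiff ℝ 2 g ∧ ∀ x, ‖x - x₀‖ < 3 / 4 → g =ᶠ[𝓝 x] u := by
  let χ : ContDiffBump x₀ := ⟨3 / 4, 7 / 8, by norm_num, by norm_num⟩
  refine ⟨fun x => χ x * u x, ?_, fun x hx => ?_⟩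
  · rw [contDiff_iff_contDiffAt]
    intro x
    by_cases hx : x = 0
    · subst hx
      refine (contDiffAt_const (c := (0 : ℝ))).congr_of_eventuallyEq ?_
      have : {x : 𝔼 | 7 / 8 < dist x x₀} ∈ 𝓝 0 :=
        (isOpen_lt continuous_const (by fun_prop)).mem_nhds (by simp [hx₀]; norm_num)
      filter_upwards [this] with y hy
      rw [χ.zero_of_le_dist (le_of_lt hy), zero_mul]
    · exact χ.contDiff.contDiffAt.mul (hu.contDiffAt (isOpen_compl_singleton.mem_nhds hx))
  · filter_upwards [χ.eventuallyEq_one_of_mem_ball (x := x) (by simpa [dist_eq_norm] using hx)]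
      with y hy
    simp [hy]

lemma integral_mul_second_diff {w a b c : 𝔼 → ℝ} (ha : Integrable fun z => w z * a z)
    (hb : Integrable fun z => w z * b z) (hc : Integrable fun z => w z * c z) :
    ∫ z, w z * (a z + b z - 2 * c z) =
      (∫ z, w z * a z) + (∫ z, w z * b z) - 2 * ∫ z, w z * c z := by
  have hab : Integrable fun z => w z * a z + w z * b z := ha.add hb
  rw [← integral_const_mul, ← integral_add ha hb, ← integral_sub hab (hc.const_mul 2)]
  congr 1 with z
  ring

/-- The weighted mean of a second difference decreases with the radius when the weighted means of
the second difference of the Laplacian are negative. -/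
lemma integral_cap_second_diff_le {g : 𝔼 → ℝ} (hg : ContDiff ℝ 2 g) (x v : 𝔼) {R k : ℝ}
    (hR : 0 ≤ R)
    (hk : ∀ r ∈ Ioo 0 R, ∫ z : 𝔼, cap z ^ 2 * (laplacian g (x + r • z + v) +
      laplacian g (x + r • z - v) - 2 * laplacian g (x + r • z)) ≤ -k) :
    ∫ z : 𝔼, cap z * (g (x + R • z + v) + g (x + R • z - v) - 2 * g (x + R • z)) ≤
      (∫ z : 𝔼, cap z) * (g (x + v) + g (x - v) - 2 * g x) - k * R ^ 2 / 8 := by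
  have hgc := hg.continuous
  have hlc := continuous_laplacian hg
  have split1 : ∀ r : ℝ,
      ∫ z : 𝔼, cap z * (g (x + r • z + v) + g (x + r • z - v) - 2 * g (x + r • z)) =
      (∫ z : 𝔼, cap z * g (x + v + r • z)) + (∫ z : 𝔼, cap z * g (x - v + r • z)) -
        2 * ∫ z : 𝔼, cap z * g (x + r • z) := fun r => by
    simp only [add_right_comm x v, ← add_sub_right_comm x]
    exact integral_mul_second_diff (integrable_cap_mul (by fun_prop))
      (integrable_cap_mul (by fun_prop)) (integrable_cap_mul (by fun_prop))
  have split2 : ∀ r : ℝ,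
      ∫ z : 𝔼, cap z ^ 2 * (laplacian g (x + r • z + v) + laplacian g (x + r • z - v) -
        2 * laplacian g (x + r • z)) =
      (∫ z : 𝔼, cap z ^ 2 * laplacian g (x + v + r • z)) +
        (∫ z : 𝔼, cap z ^ 2 * laplacian g (x - v + r • z)) -
        2 * ∫ z : 𝔼, cap z ^ 2 * laplacian g (x + r • z) := fun r => by
    simp only [add_right_comm x v, ← add_sub_right_comm x]
    exact integral_mul_second_diff (integrable_cap_sq_mul (by fun_prop))
      (integrable_cap_sq_mul (by fun_prop)) (integrable_cap_sq_mul (by fun_prop))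
  have hd : ∀ r : ℝ, HasDerivAt (fun r : ℝ =>
      (∫ z : 𝔼, cap z * (g (x + r • z + v) + g (x + r • z - v) - 2 * g (x + r • z))) +
        k * r ^ 2 / 8)
      (r / 4 * (∫ z : 𝔼, cap z ^ 2 * (laplacian g (x + r • z + v) +
        laplacian g (x + r • z - v) - 2 * laplacian g (x + r • z))) + k * (2 * r) / 8) r :=
    fun r => by
      simp only [split1, split2]
      have h := (((hasDerivAt_integral_cap hg (x + v) r).add
        (hasDerivAt_integral_cap hg (x - v) r)).sub
        ((hasDerivAt_integral_cap hg x r).const_mul 2)).add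
        (((hasDerivAt_pow 2 r).const_mul k).div_const 8)
      refine h.congr_deriv ?_
      push_cast
      ring
  have hanti := antitoneOn_of_hasDerivWithinAt_nonpos (convex_Icc 0 R)
    (fun r _ => (hd r).continuousAt.continuousWithinAt)
    (fun r _ => (hd r).hasDerivWithinAt) (fun r hr => by
      rw [interior_Icc] at hr
      nlinarith [hk r hr, hr.1])
  have := hanti ⟨le_rfl, hR⟩ ⟨hR, le_rfl⟩ hR
  simp only [zero_smul, add_zero, integral_mul_const] at this
  linarith

end Laplacian

section Homogeneous

variable {V : Type*} [NormedAddCommGroup V] [NormedSpace ℝ V] {u : V → ℝ}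

lemma fderiv_smul_of_homogeneous_s11 (hom : ∀ t : ℝ, 0 < t → ∀ y : V, y ≠ 0 → u (t • y) = t * u y)
    (hu : ContDiffOn ℝ 2 u {0}ᶜ) {t : ℝ} (ht : 0 < t) {x : V} (hx : x ≠ 0) :
    fderiv ℝ u (t • x) = fderiv ℝ u x := by
  have h1 : (fun y => u (t • y)) =ᶠ[𝓝 x] fun y => t * u y := by
    filter_upwards [eventually_ne_nhds hx] with y hy using hom t ht y hy
  have hd : DifferentiableAt ℝ u x :=
    (hu.contDiffAt (isOpen_compl_singleton.mem_nhds hx)).differentiableAt (by norm_num)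
  have h2 := h1.fderiv_eq (𝕜 := ℝ)
  rw [fderiv_comp_smul, fderiv_const_mul hd] at h2
  exact smul_right_injective (V →L[ℝ] ℝ) ht.ne' h2

lemma fderiv_fderiv_smul_of_homogeneous
    (hom : ∀ t : ℝ, 0 < t → ∀ y : V, y ≠ 0 → u (t • y) = t * u y)
    (hu : ContDiffOn ℝ 2 u {0}ᶜ) {t : ℝ} (ht : 0 < t) {x : V} (hx : x ≠ 0) :
    t • fderiv ℝ (fderiv ℝ u) (t • x) = fderiv ℝ (fderiv ℝ u) x := by
  have h1 : (fun y => fderiv ℝ u (t • y)) =ᶠ[𝓝 x] fderiv ℝ u := by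
    filter_upwards [eventually_ne_nhds hx] with y hy using fderiv_smul_of_homogeneous_s11 hom hu ht hy
  rw [← h1.fderiv_eq, fderiv_comp_smul]

lemma fderiv_fderiv_self_of_homogeneous
    (hom : ∀ t : ℝ, 0 < t → ∀ y : V, y ≠ 0 → u (t • y) = t * u y)
    (hu : ContDiffOn ℝ 2 u {0}ᶜ) {x : V} (hx : x ≠ 0) (η : V) :
    fderiv ℝ (fderiv ℝ u) x x η = 0 := by
  have h1 := hasDerivAt_fderiv_comp_line (η := η) (ξ := x) (s := 0) isOpen_compl_singleton hu
    (x := x) (by simpa using hx)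
  have h2 : (fun s : ℝ => fderiv ℝ u (x + s • x) η) =ᶠ[𝓝 0] fun _ => fderiv ℝ u x η := by
    filter_upwards [Ioi_mem_nhds (show (-1 : ℝ) < 0 by norm_num)] with s hs
    have : x + s • x = (1 + s) • x := by module
    rw [this, fderiv_smul_of_homogeneous_s11 hom hu (by linarith [mem_Ioi.1 hs]) hx]
  simpa using h1.unique ((hasDerivAt_const (0 : ℝ) (fderiv ℝ u x η)).congr_of_eventuallyEq h2)

lemma fderiv_fderiv_comm (hu : ContDiffOn ℝ 2 u {0}ᶜ) {x : V} (hx : x ≠ 0) (ξ η : V) :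
    fderiv ℝ (fderiv ℝ u) x ξ η = fderiv ℝ (fderiv ℝ u) x η ξ :=
  ((hu.contDiffAt (isOpen_compl_singleton.mem_nhds hx)).isSymmSndFDerivAt (by simp)) ξ η

end Homogeneous

section HessianBound

variable {V : Type*} [NormedAddCommGroup V] [InnerProductSpace ℝ V] {u : V → ℝ}

/-- A lower bound for the Hessian of a 1-homogeneous function on unit tangent vectors of the sphere
propagates to all points and directions. -/
lemma le_fderiv_fderiv_of_homogeneous
    (hom : ∀ t : ℝ, 0 < t → ∀ y : V, y ≠ 0 → u (t • y) = t * u y)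
    (hu : ContDiffOn ℝ 2 u {0}ᶜ) {c : ℝ}
    (hc : ∀ x ξ : V, ‖x‖ = 1 → ‖ξ‖ = 1 → ⟪ξ, x⟫ = 0 → c ≤ fderiv ℝ (fderiv ℝ u) x ξ ξ)
    {x : V} (hx : x ≠ 0) (ξ : V) :
    c * ((‖ξ‖ ^ 2 * ‖x‖ ^ 2 - ⟪x, ξ⟫ ^ 2) / ‖x‖ ^ 3) ≤ fderiv ℝ (fderiv ℝ u) x ξ ξ := by
  have hx0 : 0 < ‖x‖ := norm_pos_iff.2 hx
  set a := ⟪x, ξ⟫ / ‖x‖ ^ 2 with ha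
  set η := ξ - a • x with hη
  have hHη : fderiv ℝ (fderiv ℝ u) x ξ ξ = fderiv ℝ (fderiv ℝ u) x η η := by
    have h0 := fderiv_fderiv_self_of_homogeneous hom hu hx
    simp [hη, h0, fderiv_fderiv_comm hu hx ξ x]
  have horth : ⟪η, x⟫ = 0 := by
    rw [hη, inner_sub_left, real_inner_smul_left, real_inner_self_eq_norm_sq, ha,
      real_inner_comm]
    field_simp
    ring
  have hnorm : ‖η‖ ^ 2 * ‖x‖ ^ 2 = ‖ξ‖ ^ 2 * ‖x‖ ^ 2 - ⟪x, ξ⟫ ^ 2 := by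
    rw [hη, norm_sub_sq_real, real_inner_smul_right, norm_smul, mul_pow, Real.norm_eq_abs, sq_abs,
      ha, real_inner_comm]
    field_simp
    ring
  rw [← hnorm, hHη]
  by_cases hη0 : η = 0
  · simp [hη0]
  have hη1 : 0 < ‖η‖ := norm_pos_iff.2 hη0
  have h1 := hc (‖x‖⁻¹ • x) (‖η‖⁻¹ • η) (norm_smul_inv_norm hx) (norm_smul_inv_norm hη0)
    (by rw [real_inner_smul_left, real_inner_smul_right, horth]; simp)
  have h2 := fderiv_fderiv_smul_of_homogeneous hom hu (inv_pos.2 hx0) hx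
  rw [← h2]
  simp only [map_smul, smul_apply, smul_eq_mul] at h1 ⊢
  calc c * (‖η‖ ^ 2 * ‖x‖ ^ 2 / ‖x‖ ^ 3) = c * (‖η‖ ^ 2 * ‖x‖⁻¹) := by field_simp
    _ ≤ _ * (‖η‖ ^ 2 * ‖x‖⁻¹) := mul_le_mul_of_nonneg_right h1 (by positivity)
    _ = _ := by field_simp

lemma convexOn_of_fderiv_fderiv_nonneg (hcont : Continuous u) (hu : ContDiffOn ℝ 2 u {0}ᶜ)
    (hdim : 2 < Module.finrank ℝ V)
    (hH : ∀ x ξ : V, x ≠ 0 → 0 ≤ fderiv ℝ (fderiv ℝ u) x ξ ξ) : ConvexOn ℝ univ u := by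
  refine ⟨convex_univ, fun a _ b _ s t hs ht hst => ?_⟩
  have : FiniteDimensional ℝ V := FiniteDimensional.of_finrank_pos (by omega)
  obtain ⟨v, hv, hv0⟩ : ∃ v ∈ (Submodule.span ℝ {a, b})ᗮ, v ≠ 0 := by
    apply Submodule.exists_mem_ne_zero_of_ne_bot
    intro h
    have h1 := Submodule.finrank_add_finrank_orthogonal (Submodule.span ℝ {a, b})
    have h2 : Module.finrank ℝ (Submodule.span ℝ {a, b}) ≤ 2 := by
      classical
      have := finrank_span_finset_le_card (R := ℝ) ({a, b} : Finset V)
      simp only [Finset.coe_insert, Finset.coe_singleton] at this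
      exact this.trans Finset.card_le_two
    rw [h, finrank_bot] at h1
    omega
  have ha : ⟪v, a⟫ = 0 := by
    rw [real_inner_comm]
    exact hv a (Submodule.subset_span (by simp))
  have hb : ⟪v, b⟫ = 0 := by
    rw [real_inner_comm]
    exact hv b (Submodule.subset_span (by simp))
  have key : ∀ ε : ℝ, ε ≠ 0 →
      u (s • (a + ε • v) + t • (b + ε • v)) ≤ s • u (a + ε • v) + t • u (b + ε • v) := by
    intro ε hε
    have hne : ∀ r : ℝ, (a + ε • v) + r • (b - a) ≠ 0 := fun r h0 => by
      have := congrArg (fun w => ⟪v, w⟫) h0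
      simp [inner_add_right, inner_sub_right, real_inner_smul_right, ha, hb, hε, hv0] at this
    have hconv : ConvexOn ℝ univ fun r : ℝ => u ((a + ε • v) + r • (b - a)) :=
      convexOn_of_hasDerivWithinAt2_nonneg convex_univ
        (hcont.comp (by fun_prop)).continuousOn
        (fun r _ => (hasDerivAt_comp_line isOpen_compl_singleton hu (hne r)).hasDerivWithinAt)
        (fun r _ =>
          (hasDerivAt_fderiv_comp_line isOpen_compl_singleton hu (hne r)).hasDerivWithinAt)
        (fun r _ => hH _ _ (hne r))
    have := hconv.2 (mem_univ 0) (mem_univ 1) hs ht hst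
    have hs1 : s = 1 - t := by linarith
    have e1 : s • (a + ε • v) + t • (b + ε • v) =
        a + ε • v + (s • (0 : ℝ) + t • (1 : ℝ)) • (b - a) := by
      rw [hs1]
      simp only [smul_eq_mul]
      module
    have e2 : a + ε • v + (1 : ℝ) • (b - a) = b + ε • v := by module
    rw [e1]
    simpa only [e2, zero_smul, add_zero] using this
  have hlim : ∀ {φ : ℝ → ℝ}, Continuous φ → Tendsto φ (𝓝[≠] 0) (𝓝 (φ 0)) := fun hφ =>
    hφ.continuousAt.tendsto.mono_left nhdsWithin_le_nhds
  have := le_of_tendsto_of_tendsto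
    (hlim (φ := fun ε => u (s • (a + ε • v) + t • (b + ε • v))) (hcont.comp (by fun_prop)))
    (hlim (φ := fun ε => s • u (a + ε • v) + t • u (b + ε • v))
      (((hcont.comp (by fun_prop)).const_smul s).add ((hcont.comp (by fun_prop)).const_smul t)))
    (eventually_mem_nhdsWithin.mono key)
  simpa using this

end HessianBound

section Monotonicity

variable {m : ℕ}

local notation "𝔼" => EuclideanSpace ℝ (Fin m)

lemma integral_cap_sq_second_diff_nonpos_of_antitoneOn {f F : 𝔼 → ℝ} (hF : Continuous F)
    {x₀ ξ : 𝔼} (hξ : ‖ξ‖ = 1) (horth : ⟪ξ, x₀⟫ = 0)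
    (hFf : ∀ x, ‖x - x₀‖ < 3 / 4 → F x = f x)
    (hmono : ∀ x : 𝔼, ⟪ξ, x⟫ = 0 →
      AntitoneOn (fun t : ℝ => f (x + t • ξ) + f (x - t • ξ)) (Ioi 0))
    {h r : ℝ} (hh : 0 ≤ h) (hh' : h ≤ 1 / 8) (hr : 0 < r) (hr' : r ≤ 1 / 8) :
    ∫ z : 𝔼, cap z ^ 2 * (F (x₀ + r • z + h • ξ) + F (x₀ + r • z - h • ξ) -
      2 * F (x₀ + r • z)) ≤ 0 := by
  have hrh : r * |h / r| = h := by
    rw [abs_of_nonneg (by positivity)]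
    field_simp
  have key := integral_cap_sq_second_diff_nonpos (F := fun z => F (x₀ + r • z))
    (by fun_prop) hξ (h / r) ?_
  · refine le_of_eq_of_le ?_ key
    congr 1 with z
    have e : r • (h / r) • ξ = h • ξ := by
      rw [smul_smul]
      congr 1
      field_simp
    simp only [smul_add, smul_sub, e, add_assoc, add_sub_assoc]
  intro y hy a b hab hb hya
  have ha1 : |a| < 1 := by
    have h1 := abs_real_inner_le_norm ξ (y + a • ξ)
    rw [inner_add_right, hy, real_inner_smul_right, real_inner_self_eq_norm_sq, hξ] at h1
    simp only [zero_add, one_pow, mul_one, one_mul] at h1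
    exact h1.trans_lt hya
  have hy2 : ‖y‖ < 2 := by
    have h1 := norm_sub_le (y + a • ξ) (a • ξ)
    rw [add_sub_cancel_right, norm_smul, hξ, mul_one, Real.norm_eq_abs] at h1
    linarith
  have hyr : ‖r • y‖ ≤ r * 2 := by
    rw [norm_smul, Real.norm_of_nonneg hr.le]
    gcongr
  have hrb : r * |b| ≤ r + h := by nlinarith
  have hx : ⟪ξ, x₀ + r • y⟫ = 0 := by
    rw [inner_add_right, real_inner_smul_right, horth, hy]
    simp
  have hball : ∀ s : ℝ, |s| ≤ r + h → F (x₀ + r • y + s • ξ) = f (x₀ + r • y + s • ξ) :=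
    fun s hs => by
      refine hFf _ ?_
      have e : x₀ + r • y + s • ξ - x₀ = r • y + s • ξ := by abel
      rw [e]
      refine (norm_add_le _ _).trans_lt ?_
      rw [norm_smul s, hξ, mul_one, Real.norm_eq_abs]
      linarith
  have hsym : ∀ s : ℝ, |s| ≤ r + h →
      F (x₀ + r • y + |s| • ξ) + F (x₀ + r • y - |s| • ξ) =
        f (x₀ + r • y + |s| • ξ) + f (x₀ + r • y - |s| • ξ) := fun s hs => by
    have h2 := hball (-|s|) (by simpa using hs)
    rw [neg_smul, ← sub_eq_add_neg] at h2
    rw [hball |s| (by simpa using hs), h2]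
  have habs : ∀ s : ℝ, F (x₀ + r • (y + s • ξ)) + F (x₀ + r • (y - s • ξ)) =
      F (x₀ + r • y + |r * s| • ξ) + F (x₀ + r • y - |r * s| • ξ) := fun s => by
    rw [smul_add, smul_sub, smul_smul, ← add_assoc, ← add_sub_assoc]
    rcases abs_choice (r * s) with h | h <;> rw [h]
    rw [neg_smul, sub_neg_eq_add, ← sub_eq_add_neg, add_comm]
  simp only [habs]
  have hb' : |r * b| ≤ r + h := by rwa [abs_mul, abs_of_pos hr]
  have hab' : |r * a| ≤ |r * b| := by
    rw [abs_mul, abs_mul]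
    gcongr
  have hpos : ∀ s : ℝ, 0 < |s| → |s| ≤ |r * b| →
      F (x₀ + r • y + |r * b| • ξ) + F (x₀ + r • y - |r * b| • ξ) ≤
      F (x₀ + r • y + |s| • ξ) + F (x₀ + r • y - |s| • ξ) := fun s hs hsb => by
    rw [hsym _ hb', hsym s (hsb.trans hb')]
    exact hmono _ hx (mem_Ioi.2 hs) (mem_Ioi.2 (hs.trans_le hsb)) hsb
  rcases eq_or_lt_of_le (abs_nonneg (r * a)) with h0 | h0
  · rcases eq_or_lt_of_le (abs_nonneg (r * b)) with h0b | h0b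
    · rw [← h0, ← h0b]
    · rw [← h0]
      have hc : Continuous fun s : ℝ => F (x₀ + r • y + s • ξ) + F (x₀ + r • y - s • ξ) := by
        fun_prop
      refine ge_of_tendsto (hc.continuousAt.tendsto.mono_left
        (nhdsWithin_le_nhds (s := Ioi 0))) ?_
      filter_upwards [Ioo_mem_nhdsGT h0b] with s hs
      have := hpos s (by simpa using hs.1.ne') (by rw [abs_of_pos hs.1]; exact hs.2.le)
      rwa [abs_of_pos hs.1] at this
  · exact hpos (r * a) h0 hab'

end Monotonicity

section StrongMinimum

variable {n : ℕ}

local notation "𝔼" => EuclideanSpace ℝ (Fin (n + 1))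

/-- The Hessian of a solution cannot attain a negative minimum over unit tangent vectors of the
sphere. -/
lemma nonneg_of_isMin_hessian (hn : 0 < n) {f u : 𝔼 → ℝ}
    (hu_hom : ∀ t : ℝ, 0 < t → ∀ y : 𝔼, y ≠ 0 → u (t • y) = t * u y)
    (hu : ContDiffOn ℝ 2 u {0}ᶜ) (hu_lap : ∀ x : 𝔼, x ≠ 0 → laplacian u x = f x)
    {x₀ ξ : 𝔼} (hx₀ : ‖x₀‖ = 1) (hξ : ‖ξ‖ = 1) (horth : ⟪ξ, x₀⟫ = 0)
    (hmono : ∀ x : 𝔼, ⟪ξ, x⟫ = 0 →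
      AntitoneOn (fun t : ℝ => f (x + t • ξ) + f (x - t • ξ)) (Ioi 0))
    (hmin : ∀ x η : 𝔼, ‖x‖ = 1 → ‖η‖ = 1 → ⟪η, x⟫ = 0 →
      fderiv ℝ (fderiv ℝ u) x₀ ξ ξ ≤ fderiv ℝ (fderiv ℝ u) x η η) :
    0 ≤ fderiv ℝ (fderiv ℝ u) x₀ ξ ξ := by
  by_contra! hneg
  set A : ℝ := -fderiv ℝ (fderiv ℝ u) x₀ ξ ξ with hA
  have hA0 : 0 < A := by linarith
  have hU : IsOpen ({0}ᶜ : Set 𝔼) := isOpen_compl_singleton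
  have hx₀0 : x₀ ≠ 0 := by
    rw [← norm_pos_iff, hx₀]
    exact one_pos
  have hne : ∀ x : 𝔼, ‖x - x₀‖ < 3 / 4 → x ≠ 0 := by
    rintro x hx rfl
    rw [zero_sub, norm_neg, hx₀] at hx
    norm_num at hx
  obtain ⟨g, hg, hgu⟩ := exists_contDiff_eventuallyEq hu hx₀
  obtain ⟨p, hp, hpn⟩ := exists_contDiff_eventuallyEq (contDiffOn_norm_compl_zero (V := 𝔼)) hx₀
  have hgl : ∀ x, ‖x - x₀‖ < 3 / 4 → laplacian g x = f x := fun x hx => by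
    rw [laplacian_congr (hgu x hx), hu_lap x (hne x hx)]
  have hpl : ∀ x, ‖x - x₀‖ < 3 / 4 → laplacian p x = n * ‖x‖⁻¹ := fun x hx => by
    rw [laplacian_congr (hpn x hx), laplacian_norm (hne x hx)]
    push_cast
    ring
  let H : 𝔼 → ℝ := fun x =>
    fderiv ℝ (fderiv ℝ u) x ξ ξ + A * ((‖ξ‖ ^ 2 * ‖x‖ ^ 2 - ⟪x, ξ⟫ ^ 2) / ‖x‖ ^ 3)
  have hH0 : ∀ x : 𝔼, x ≠ 0 → 0 ≤ H x := fun x hx => by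
    have := le_fderiv_fderiv_of_homogeneous hu_hom hu hmin hx ξ
    simp only [H, hA]
    linarith
  have hHx₀ : H x₀ = 0 := by
    simp only [H, hA, hx₀, hξ, real_inner_comm ξ x₀, horth]
    ring
  have hHc : ContinuousAt H x₀ := by
    have h1 : ContinuousAt (fderiv ℝ (fderiv ℝ u)) x₀ :=
      (continuousOn_fderiv_fderiv hU hu).continuousAt (hU.mem_nhds hx₀0)
    refine ((h1.clm_apply continuousAt_const).clm_apply continuousAt_const).add
      (continuousAt_const.mul (ContinuousAt.div (by fun_prop) (by fun_prop) ?_))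
    simp [hx₀]
  have hline1 : ∀ x : 𝔼, ∀ s : ℝ, x + s • ξ ≠ 0 →
      HasDerivAt (fun s : ℝ => u (x + s • ξ) + A * ‖x + s • ξ‖)
        (fderiv ℝ u (x + s • ξ) ξ + A * (⟪x + s • ξ, ξ⟫ / ‖x + s • ξ‖)) s := fun x s hs =>
    (hasDerivAt_comp_line hU hu hs).add ((hasDerivAt_norm_line hs).const_mul A)
  have hline2 : ∀ x : 𝔼, ∀ s : ℝ, x + s • ξ ≠ 0 →
      HasDerivAt (fun s : ℝ => fderiv ℝ u (x + s • ξ) ξ +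
        A * (⟪x + s • ξ, ξ⟫ / ‖x + s • ξ‖)) (H (x + s • ξ)) s := fun x s hs =>
    (hasDerivAt_fderiv_comp_line hU hu hs).add ((hasDerivAt_inner_div_norm_line hs).const_mul A)
  have hdist : ∀ (x : 𝔼) (s t : ℝ), ‖x - x₀‖ ≤ t → |s| ≤ 1 / 8 → ‖x + s • ξ - x₀‖ ≤ t + 1 / 8 :=
    fun x s t hx hs => by
      have e : x + s • ξ - x₀ = (x - x₀) + s • ξ := by abel
      rw [e]
      refine (norm_add_le _ _).trans ?_
      rw [norm_smul, hξ, mul_one, Real.norm_eq_abs]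
      linarith
  let C₁ : ℝ := ∫ z : 𝔼, cap z
  let C₂ : ℝ := ∫ z : 𝔼, cap z ^ 2
  have hC₁ : 0 < C₁ := integral_cap_pos
  have hC₂ : 0 < C₂ := integral_cap_sq_pos
  have hn' : (0 : ℝ) < n := Nat.cast_pos.2 hn
  let c : ℝ := A * (n * C₂ * (1 / 10) * (1 / 8) ^ 2 / 8)
  have hc : 0 < c := by positivity
  have hε : 0 < c / (2 * C₁) := by positivity
  obtain ⟨δ, hδ, hδH⟩ := Metric.eventually_nhds_iff.1 (hHc.eventually_lt_const (hHx₀.trans_lt hε))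
  obtain ⟨h, hh0, hh⟩ : ∃ h : ℝ, 0 < h ∧ h < min (1 / 8) δ :=
    exists_between (lt_min (by norm_num) hδ)
  have hh8 : h ≤ 1 / 8 := (hh.trans_le (min_le_left _ _)).le
  have hhδ : h < δ := hh.trans_le (min_le_right _ _)
  have habs : ∀ s ∈ Icc (-h) h, |s| ≤ h := fun s hs => abs_le.2 hs
  have hwx₀ : (u (x₀ + h • ξ) + A * ‖x₀ + h • ξ‖) + (u (x₀ - h • ξ) + A * ‖x₀ - h • ξ‖) -
      2 * (u x₀ + A * ‖x₀‖) ≤ c / (2 * C₁) * h ^ 2 := by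
    have hne' : ∀ s ∈ Icc (-h) h, x₀ + s • ξ ≠ 0 := fun s hs => by
      refine hne _ ((hdist x₀ s 0 (by simp) ((habs s hs).trans hh8)).trans_lt (by norm_num))
    have := second_diff_le_of_deriv2_le hh0.le (fun s hs => hline1 x₀ s (hne' s hs))
      (fun s hs => hline2 x₀ s (hne' s hs)) (c := c / (2 * C₁)) (fun s hs => by
        refine (hδH ?_).le
        rw [dist_eq_norm, add_sub_cancel_left, norm_smul, hξ, mul_one]
        exact (habs s hs).trans_lt hhδ)
    simpa [← sub_eq_add_neg] using this
  have hwx : ∀ x : 𝔼, ‖x - x₀‖ ≤ 1 / 8 →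
      0 ≤ (u (x + h • ξ) + A * ‖x + h • ξ‖) + (u (x - h • ξ) + A * ‖x - h • ξ‖) -
        2 * (u x + A * ‖x‖) := fun x hx => by
    have hne' : ∀ s ∈ Icc (-h) h, x + s • ξ ≠ 0 := fun s hs => by
      refine hne _ ((hdist x s _ hx ((habs s hs).trans hh8)).trans_lt (by norm_num))
    have := le_second_diff_of_le_deriv2 hh0.le (fun s hs => hline1 x s (hne' s hs))
      (fun s hs => hline2 x s (hne' s hs)) (c := 0) (fun s hs => hH0 _ (hne' s hs))
    simpa [← sub_eq_add_neg] using this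
  have hval : ∀ x, ‖x - x₀‖ ≤ 1 / 8 →
      (g (x + h • ξ) + g (x - h • ξ) - 2 * g x) + A * (p (x + h • ξ) + p (x - h • ξ) - 2 * p x) =
      (u (x + h • ξ) + A * ‖x + h • ξ‖) + (u (x - h • ξ) + A * ‖x - h • ξ‖) -
        2 * (u x + A * ‖x‖) := fun x hx => by
    have h1 : ‖x + h • ξ - x₀‖ < 3 / 4 :=
      (hdist x h _ hx (by rwa [abs_of_pos hh0])).trans_lt (by norm_num)
    have h2 : ‖x - h • ξ - x₀‖ < 3 / 4 := by
      have := hdist x (-h) _ hx (by rwa [abs_neg, abs_of_pos hh0])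
      rw [neg_smul, ← sub_eq_add_neg] at this
      exact this.trans_lt (by norm_num)
    have h3 : ‖x - x₀‖ < 3 / 4 := hx.trans_lt (by norm_num)
    rw [(hgu _ h1).eq_of_nhds, (hgu _ h2).eq_of_nhds, (hgu _ h3).eq_of_nhds,
      (hpn _ h1).eq_of_nhds, (hpn _ h2).eq_of_nhds, (hpn _ h3).eq_of_nhds]
    ring
  have hball : ∀ r : ℝ, 0 ≤ r → r ≤ 1 / 8 → ∀ z : 𝔼, ‖z‖ < 1 → ‖x₀ + r • z - x₀‖ ≤ 1 / 8 :=
    fun r hr hr' z hz => by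
      rw [add_sub_cancel_left, norm_smul, Real.norm_of_nonneg hr]
      nlinarith [norm_nonneg z]
  have hmean_g := integral_cap_second_diff_le hg x₀ (h • ξ) (R := 1 / 8) (k := 0) (by norm_num)
    (fun r hr => by
      rw [neg_zero]
      exact integral_cap_sq_second_diff_nonpos_of_antitoneOn (continuous_laplacian hg) hξ horth
        hgl hmono hh0.le hh8 hr.1 hr.2.le)
  have hlp := continuous_laplacian hp
  have hmean_p := integral_cap_second_diff_le hp x₀ (h • ξ) (R := 1 / 8)
    (k := n * C₂ * (1 / 10) * h ^ 2) (by norm_num) (fun r hr => by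
      have e : -(n * C₂ * (1 / 10) * h ^ 2) =
          ∫ z : 𝔼, cap z ^ 2 * (-(n * (1 / 10) * h ^ 2)) := by
        rw [integral_mul_const]
        ring
      rw [e]
      refine integral_mono (integrable_cap_sq_mul (by fun_prop))
        (integrable_cap_sq_mul continuous_const) fun z => ?_
      rcases lt_or_ge ‖z‖ 1 with hz | hz
      · have hx := hball r hr.1.le hr.2.le z hz
        have h1 := (hdist _ h _ hx (by rwa [abs_of_pos hh0])).trans_lt
          (by norm_num : (1 / 8 + 1 / 8 : ℝ) < 3 / 4)
        have h2 := (hdist _ (-h) _ hx (by rwa [abs_neg, abs_of_pos hh0])).trans_lt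
          (by norm_num : (1 / 8 + 1 / 8 : ℝ) < 3 / 4)
        rw [neg_smul, ← sub_eq_add_neg] at h2
        refine mul_le_mul_of_nonneg_left ?_ (sq_nonneg _)
        rw [hpl _ h1, hpl _ h2, hpl _ (hx.trans_lt (by norm_num))]
        have := mul_le_mul_of_nonneg_left
          (norm_inv_second_diff_le hx₀ hξ horth hh0.le hh8 hx) hn'.le
        linarith
      · simp [cap_eq_zero hz])
  have hgc := hg.continuous
  have hpc := hp.continuous
  have hsum : 0 ≤ (∫ z : 𝔼, cap z * (g (x₀ + (1 / 8 : ℝ) • z + h • ξ) +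
        g (x₀ + (1 / 8 : ℝ) • z - h • ξ) - 2 * g (x₀ + (1 / 8 : ℝ) • z))) +
      A * ∫ z : 𝔼, cap z * (p (x₀ + (1 / 8 : ℝ) • z + h • ξ) +
        p (x₀ + (1 / 8 : ℝ) • z - h • ξ) - 2 * p (x₀ + (1 / 8 : ℝ) • z)) := by
    rw [← integral_const_mul, ← integral_add (integrable_cap_mul (by fun_prop))
      ((integrable_cap_mul (by fun_prop)).const_mul A)]
    refine integral_nonneg fun z => ?_
    simp only [Pi.zero_apply]
    rw [mul_left_comm, ← mul_add]
    rcases lt_or_ge ‖z‖ 1 with hz | hz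
    · have hx := hball (1 / 8) (by norm_num) le_rfl z hz
      rw [hval _ hx]
      exact mul_nonneg (cap_nonneg z) (hwx _ hx)
    · simp [cap_eq_zero hz]
  have hx₀val := hval x₀ (by simp)
  have hup : C₁ * ((g (x₀ + h • ξ) + g (x₀ - h • ξ) - 2 * g x₀) +
      A * (p (x₀ + h • ξ) + p (x₀ - h • ξ) - 2 * p x₀)) ≤ C₁ * (c / (2 * C₁) * h ^ 2) := by
    rw [hx₀val]
    exact mul_le_mul_of_nonneg_left hwx₀ hC₁.le
  have e1 : C₁ * (c / (2 * C₁) * h ^ 2) = c * h ^ 2 / 2 := by field_simp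
  have hAp := mul_le_mul_of_nonneg_left hmean_p hA0.le
  have hfin : c * h ^ 2 ≤ c * h ^ 2 / 2 := by
    have : c * h ^ 2 = A * (n * C₂ * (1 / 10) * h ^ 2 * (1 / 8) ^ 2 / 8) := by
      simp only [c]
      ring
    rw [mul_sub, ← this] at hAp
    rw [e1] at hup
    linarith
  have : 0 < c * h ^ 2 := by positivity
  linarith

end StrongMinimum

/-- a monotonicity condition on `f` ensuring convexity of the solution. -/
theorem stmt_11 (n : ℕ) (hn : 2 ≤ n)
    (f u : EuclideanSpace ℝ (Fin (n + 1)) → ℝ) (K : NNReal)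
    (hf_pos : ∀ x ∈ sphere (0 : EuclideanSpace ℝ (Fin (n + 1))) 1, 0 < f x)
    (hf_lip : LipschitzOnWith K f (sphere (0 : EuclideanSpace ℝ (Fin (n + 1))) 1))
    (hf_hom : ∀ t : ℝ, 0 < t → ∀ y : EuclideanSpace ℝ (Fin (n + 1)), y ≠ 0 →
      f (t • y) = t⁻¹ * f y)
    (hf_mono : ∀ ξ ∈ sphere (0 : EuclideanSpace ℝ (Fin (n + 1))) 1,
      ∀ x : EuclideanSpace ℝ (Fin (n + 1)), ⟪ξ, x⟫ = 0 →
        AntitoneOn (fun t : ℝ => f (x + t • ξ) + f (x - t • ξ)) (Set.Ioi 0))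
    (hu_cont : Continuous u)
    (hu_hom : ∀ t : ℝ, 0 < t → ∀ y : EuclideanSpace ℝ (Fin (n + 1)), y ≠ 0 →
      u (t • y) = t * u y)
    (hu_C2 : ContDiffOn ℝ 2 u {(0 : EuclideanSpace ℝ (Fin (n + 1)))}ᶜ)
    (hu_lap : ∀ x : EuclideanSpace ℝ (Fin (n + 1)), x ≠ 0 → laplacian u x = f x) :
    ConvexOn ℝ Set.univ u := by
  have hH_cont := continuousOn_fderiv_fderiv isOpen_compl_singleton hu_C2
  let T : Set (EuclideanSpace ℝ (Fin (n + 1)) × EuclideanSpace ℝ (Fin (n + 1))) :=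
    (sphere 0 1 ×ˢ sphere 0 1) ∩ {q | ⟪q.2, q.1⟫ = 0}
  have hT : IsCompact T := ((isCompact_sphere _ _).prod (isCompact_sphere _ _)).inter_right
    (isClosed_eq (by fun_prop) continuous_const)
  have hT0 : ∀ q ∈ T, q.1 ∈ ({0}ᶜ : Set (EuclideanSpace ℝ (Fin (n + 1)))) := fun q hq =>
    ne_zero_of_mem_unit_sphere ⟨q.1, hq.1.1⟩
  have hTc : ContinuousOn (fun q : EuclideanSpace ℝ (Fin (n + 1)) × EuclideanSpace ℝ (Fin (n + 1))
      => fderiv ℝ (fderiv ℝ u) q.1 q.2 q.2) T :=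
    ((hH_cont.comp continuousOn_fst hT0).clm_apply continuousOn_snd).clm_apply continuousOn_snd
  have hnonneg : ∀ x ξ : EuclideanSpace ℝ (Fin (n + 1)), ‖x‖ = 1 → ‖ξ‖ = 1 → ⟪ξ, x⟫ = 0 →
      0 ≤ fderiv ℝ (fderiv ℝ u) x ξ ξ := by
    intro x ξ hx hξ horth
    have hmem : ∀ y η : EuclideanSpace ℝ (Fin (n + 1)), ‖y‖ = 1 → ‖η‖ = 1 → ⟪η, y⟫ = 0 →
        (y, η) ∈ T := fun y η hy hη h => ⟨⟨by simpa using hy, by simpa using hη⟩, h⟩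
    obtain ⟨⟨x₀, ξ₀⟩, hq, hmin⟩ := hT.exists_isMinOn ⟨_, hmem x ξ hx hξ horth⟩ hTc
    refine le_trans ?_ (hmin (hmem x ξ hx hξ horth))
    exact nonneg_of_isMin_hessian (by omega) hu_hom hu_C2 hu_lap (by simpa using hq.1.1)
      (by simpa using hq.1.2) hq.2 (hf_mono ξ₀ hq.1.2)
      fun y η hy hη h => hmin (hmem y η hy hη h)
  refine convexOn_of_fderiv_fderiv_nonneg hu_cont hu_C2 (by simp; omega) fun x ξ hx => ?_
  simpa using le_fderiv_fderiv_of_homogeneous hu_hom hu_C2 hnonneg hx ξ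
end

section
/- Let n ≥ 2 and let f : S^n → (0,∞) be a positive Lipschitz function, extended to ℝ^{n+1}\{0} as a function homogeneous of degree −1. Assume that for every unit vector ξ ∈ S^n and every x ∈ ℝ^{n+1} with ⟨ξ, x⟩ = 0, the function t ↦ f(x + tξ) + f(x − tξ) is non-increasing on (0, ∞). Then for every z, ξ ∈ S^n with ⟨ξ, z⟩ = 0, the strict inequality ∫_{ℝ^{n+1}} ⟨ξ, y⟩ ⟨∇f(y), ξ⟩ / |z − y|^{n+1} dy < 0 holds, where ∇f is the (almost everywhere defined) gradient of the extension and the integral is a Lebesgue integral. -/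
open MeasureTheory Metric Set
open scoped RealInnerProductSpace

theorem lipschitzOnWith_compl_closedBall {E : Type*} [NormedAddCommGroup E] {f : E → ℝ}
    {C : NNReal}
    (hf : ∀ x y : E, x ≠ 0 → y ≠ 0 → |f x - f y| ≤ C * ‖x - y‖ / (‖x‖ * ‖y‖))
    {r : NNReal} (hr : 0 < r) :
    LipschitzOnWith (C / r ^ 2) f (closedBall (0 : E) r)ᶜ := by
  refine LipschitzOnWith.of_dist_le_mul fun x hx y hy => ?_
  rw [mem_compl_iff, mem_closedBall_zero_iff, not_le] at hx hy
  have hr' : (0 : ℝ) < r := hr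
  have hx0 : x ≠ 0 := norm_pos_iff.1 (hr'.trans hx)
  have hy0 : y ≠ 0 := norm_pos_iff.1 (hr'.trans hy)
  rw [Real.dist_eq, dist_eq_norm]
  calc |f x - f y| ≤ C * ‖x - y‖ / (‖x‖ * ‖y‖) := hf x y hx0 hy0
    _ ≤ C * ‖x - y‖ / (r * r) := by gcongr
    _ = _ := by push_cast; ring

section HomogeneousFunctions

variable {E : Type*} [NormedAddCommGroup E] [InnerProductSpace ℝ E]

/-- A function homogeneous of degree `-1` that is bounded and Lipschitz on the unit sphere. -/
theorem abs_sub_le_of_homogeneous {f : E → ℝ} {K : NNReal} {M : ℝ}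
    (hM : ∀ x ∈ sphere (0 : E) 1, ‖f x‖ ≤ M) (hf_lip : LipschitzOnWith K f (sphere (0 : E) 1))
    (hf_hom : ∀ t : ℝ, 0 < t → ∀ y : E, y ≠ 0 → f (t • y) = t⁻¹ * f y)
    {x y : E} (hx : x ≠ 0) (hy : y ≠ 0) :
    |f x - f y| ≤ (M + 2 * K) * ‖x - y‖ / (‖x‖ * ‖y‖) := by
  have ha : 0 < ‖x‖ := norm_pos_iff.2 hx
  have hb : 0 < ‖y‖ := norm_pos_iff.2 hy
  have hu : ‖x‖⁻¹ • x ∈ sphere (0 : E) 1 := by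
    simp [norm_smul, ha.ne']
  have hv : ‖y‖⁻¹ • y ∈ sphere (0 : E) 1 := by
    simp [norm_smul, hb.ne']
  have hfu : f (‖x‖⁻¹ • x) = ‖x‖ * f x := by
    rw [hf_hom _ (inv_pos.2 ha) x hx, inv_inv]
  have hfv : f (‖y‖⁻¹ • y) = ‖y‖ * f y := by
    rw [hf_hom _ (inv_pos.2 hb) y hy, inv_inv]
  have hMu := hM _ hu
  have hlip := hf_lip.dist_le_mul _ hu _ hv
  rw [Real.dist_eq, dist_eq_norm, hfu, hfv] at hlip
  rw [hfu, Real.norm_eq_abs] at hMu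
  have hba : |‖y‖ - ‖x‖| ≤ ‖x - y‖ := by
    rw [norm_sub_rev]; exact abs_norm_sub_norm_le y x
  have hscaled : ‖x‖ * ‖‖x‖⁻¹ • x - ‖y‖⁻¹ • y‖ ≤ 2 * ‖x - y‖ := by
    have hdec : ‖x‖ • (‖x‖⁻¹ • x - ‖y‖⁻¹ • y) = (x - y) + ((‖y‖ - ‖x‖) * ‖y‖⁻¹) • y := by
      rw [smul_sub, smul_smul, smul_smul, mul_inv_cancel₀ ha.ne', sub_mul,
        mul_inv_cancel₀ hb.ne', sub_smul, one_smul, one_smul]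
      abel
    calc ‖x‖ * ‖‖x‖⁻¹ • x - ‖y‖⁻¹ • y‖ = ‖‖x‖ • (‖x‖⁻¹ • x - ‖y‖⁻¹ • y)‖ := by
          rw [norm_smul, norm_norm]
      _ ≤ ‖x - y‖ + ‖((‖y‖ - ‖x‖) * ‖y‖⁻¹) • y‖ := by rw [hdec]; exact norm_add_le _ _
      _ = ‖x - y‖ + |‖y‖ - ‖x‖| := by
          rw [norm_smul, norm_mul, norm_inv, norm_norm, mul_assoc, inv_mul_cancel₀ hb.ne',
            mul_one, Real.norm_eq_abs]
      _ ≤ 2 * ‖x - y‖ := by linarith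
  rw [le_div_iff₀ (mul_pos ha hb)]
  calc |f x - f y| * (‖x‖ * ‖y‖) = |(‖x‖ * ‖y‖) * (f x - f y)| := by
        rw [abs_mul, abs_of_pos (mul_pos ha hb), mul_comm]
    _ = |(‖y‖ - ‖x‖) * (‖x‖ * f x) + ‖x‖ * (‖x‖ * f x - ‖y‖ * f y)| := by ring_nf
    _ ≤ |(‖y‖ - ‖x‖) * (‖x‖ * f x)| + |‖x‖ * (‖x‖ * f x - ‖y‖ * f y)| := abs_add_le _ _
    _ = |‖y‖ - ‖x‖| * |‖x‖ * f x| + ‖x‖ * |‖x‖ * f x - ‖y‖ * f y| := by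
        rw [abs_mul, abs_mul ‖x‖ (_ - _), abs_of_pos ha]
    _ ≤ ‖x - y‖ * M + ‖x‖ * (K * ‖‖x‖⁻¹ • x - ‖y‖⁻¹ • y‖) := by gcongr
    _ ≤ (M + 2 * K) * ‖x - y‖ := by
        nlinarith [mul_le_mul_of_nonneg_left hscaled K.coe_nonneg]

theorem norm_fderiv_le_div_norm_sq {f : E → ℝ} {C : NNReal}
    (hf : ∀ x y : E, x ≠ 0 → y ≠ 0 → |f x - f y| ≤ C * ‖x - y‖ / (‖x‖ * ‖y‖))
    {y : E} (hy : y ≠ 0) : ‖fderiv ℝ f y‖ ≤ 4 * C / ‖y‖ ^ 2 := by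
  have hb : 0 < ‖y‖ := norm_pos_iff.2 hy
  have hr : 0 < ‖y‖₊ / 2 := half_pos (nnnorm_pos.2 hy)
  have hmem : (closedBall (0 : E) (‖y‖₊ / 2 : NNReal))ᶜ ∈ nhds y := by
    refine isClosed_closedBall.isOpen_compl.mem_nhds ?_
    rw [mem_compl_iff, mem_closedBall_zero_iff, not_le]
    push_cast
    linarith [hb, coe_nnnorm y]
  refine (norm_fderiv_le_of_lipschitzOn ℝ hmem (lipschitzOnWith_compl_closedBall hf hr)).trans
    (le_of_eq ?_)
  push_cast
  field_simp
  norm_num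

theorem ae_differentiableAt_of_homogeneous [FiniteDimensional ℝ E] [Nontrivial E]
    [MeasurableSpace E] [BorelSpace E] {f : E → ℝ} {C : NNReal}
    (hf : ∀ x y : E, x ≠ 0 → y ≠ 0 → |f x - f y| ≤ C * ‖x - y‖ / (‖x‖ * ‖y‖)) :
    ∀ᵐ y : E, DifferentiableAt ℝ f y := by
  have hk : ∀ k : ℕ, ∀ᵐ y : E, y ∈ (closedBall (0 : E) (1 / ((k : NNReal) + 1) : NNReal))ᶜ →
      DifferentiableWithinAt ℝ f (closedBall (0 : E) (1 / ((k : NNReal) + 1) : NNReal))ᶜ y :=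
    fun k => (lipschitzOnWith_compl_closedBall hf (by positivity)).ae_differentiableWithinAt_of_mem
  have h0 : ∀ᵐ y : E, y ≠ 0 := by simp [ae_iff]
  filter_upwards [ae_all_iff.2 hk, h0] with y hy hy0
  obtain ⟨k, hk⟩ := exists_nat_one_div_lt (norm_pos_iff.2 hy0)
  have hmem : y ∈ (closedBall (0 : E) (1 / ((k : NNReal) + 1) : NNReal))ᶜ := by
    rw [mem_compl_iff, mem_closedBall_zero_iff, not_le]
    push_cast
    exact hk
  exact (hy k hmem).differentiableAt (isClosed_closedBall.isOpen_compl.mem_nhds hmem)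

/-- Euler's identity in degree `-1`. -/
theorem fderiv_apply_self_of_homogeneous {f : E → ℝ}
    (hf_hom : ∀ t : ℝ, 0 < t → ∀ y : E, y ≠ 0 → f (t • y) = t⁻¹ * f y)
    {y : E} (hy : y ≠ 0) (hd : DifferentiableAt ℝ f y) : fderiv ℝ f y y = -f y := by
  have h1 : HasDerivAt (fun t : ℝ => f (t • y)) (fderiv ℝ f y y) 1 := by
    have hl : HasDerivAt (fun t : ℝ => t • y) y 1 := by
      simpa using (hasDerivAt_id (1 : ℝ)).smul_const y
    exact HasFDerivAt.comp_hasDerivAt (l := f) (l' := fderiv ℝ f y) (1 : ℝ)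
      (by simpa using hd.hasFDerivAt) hl
  have h2 : HasDerivAt (fun t : ℝ => t⁻¹ * f y) (-f y) 1 := by
    simpa using (hasDerivAt_inv (one_ne_zero (α := ℝ))).mul_const (f y)
  refine h1.unique (h2.congr_of_eventuallyEq ?_)
  filter_upwards [lt_mem_nhds (zero_lt_one (α := ℝ))] with t ht using hf_hom t ht y hy

theorem fderiv_apply_neg_of_near [FiniteDimensional ℝ E] {f : E → ℝ} {C : NNReal} {m : ℝ}
    (hm : ∀ x ∈ sphere (0 : E) 1, m ≤ f x)
    (hf_hom : ∀ t : ℝ, 0 < t → ∀ y : E, y ≠ 0 → f (t • y) = t⁻¹ * f y)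
    (hf : ∀ x y : E, x ≠ 0 → y ≠ 0 → |f x - f y| ≤ C * ‖x - y‖ / (‖x‖ * ‖y‖))
    {y ξ : E} (hξ : ‖ξ‖ = 1) (h1 : ‖y - ξ‖ < 1 / 2) (h2 : (8 * C + 1) * ‖y - ξ‖ < m)
    (hd : DifferentiableAt ℝ f y) : fderiv ℝ f y ξ < 0 := by
  have hy : 1 / 2 < ‖y‖ := by
    have := norm_sub_norm_le ξ y
    rw [norm_sub_rev] at this
    linarith
  have hb : 0 < ‖y‖ := by linarith
  have hy0 : y ≠ 0 := norm_pos_iff.1 hb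
  have hfy : m ≤ ‖y‖ * f y := by
    have := hm (‖y‖⁻¹ • y) (by simp [norm_smul, hb.ne'])
    rwa [hf_hom _ (inv_pos.2 hb) y hy0, inv_inv] at this
  have hsplit : fderiv ℝ f y ξ = -f y - fderiv ℝ f y (y - ξ) := by
    rw [map_sub, fderiv_apply_self_of_homogeneous hf_hom hy0 hd]
    ring
  have hbound : -fderiv ℝ f y (y - ξ) ≤ 4 * C / ‖y‖ ^ 2 * ‖y - ξ‖ := by
    refine (neg_le_abs _).trans (((fderiv ℝ f y).le_opNorm _).trans ?_)
    gcongr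
    exact norm_fderiv_le_div_norm_sq hf hy0
  have hlt : 4 * C / ‖y‖ ^ 2 * ‖y - ξ‖ < f y := by
    rw [div_mul_eq_mul_div, div_lt_iff₀ (by positivity)]
    have hCy : 0 ≤ C * ‖y - ξ‖ := by positivity
    have hm0 : 0 < m := by nlinarith [norm_nonneg (y - ξ)]
    calc 4 * C * ‖y - ξ‖ ≤ 1 / 2 * m := by nlinarith [norm_nonneg (y - ξ)]
      _ < ‖y‖ * m := by gcongr
      _ ≤ ‖y‖ * (‖y‖ * f y) := by gcongr
      _ = f y * ‖y‖ ^ 2 := by ring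
  linarith

theorem fderiv_sub_fderiv_nonpos_of_antitoneOn {f : E → ℝ} {x ξ : E} {t : ℝ} (ht : 0 < t)
    (hmono : AntitoneOn (fun s : ℝ => f (x + s • ξ) + f (x - s • ξ)) (Ioi 0))
    (h1 : DifferentiableAt ℝ f (x + t • ξ)) (h2 : DifferentiableAt ℝ f (x - t • ξ)) :
    fderiv ℝ f (x + t • ξ) ξ - fderiv ℝ f (x - t • ξ) ξ ≤ 0 := by
  have hl : HasDerivAt (fun s : ℝ => s • ξ) ξ t := by
    simpa using (hasDerivAt_id t).smul_const ξ
  have d1 : HasDerivAt (fun s : ℝ => f (x + s • ξ)) (fderiv ℝ f (x + t • ξ) ξ) t :=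
    HasFDerivAt.comp_hasDerivAt (l := f) t h1.hasFDerivAt (hl.const_add x)
  have d2 : HasDerivAt (fun s : ℝ => f (x - s • ξ)) (fderiv ℝ f (x - t • ξ) (-ξ)) t :=
    HasFDerivAt.comp_hasDerivAt (l := f) t h2.hasFDerivAt (hl.const_sub x)
  have hacc : AccPt t (Filter.principal (Ioi (0 : ℝ))) := by
    simpa using (PerfectSpace.univ_preperfect (α := ℝ)).open_inter isOpen_Ioi t
      ⟨mem_Ioi.2 ht, mem_univ t⟩
  have := (d1.add d2).hasDerivWithinAt.nonpos_of_antitoneOn hacc hmono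
  rwa [map_neg, ← sub_eq_add_neg] at this

theorem integrable_indicator_norm_inv_pow [FiniteDimensional ℝ E] [MeasurableSpace E]
    [BorelSpace E] {n : ℕ} (hE : Module.finrank ℝ E = n + 1) (r : ℝ) :
    Integrable ((ball (0 : E) r).indicator fun y => (‖y‖ ^ n)⁻¹) := by
  have : Nontrivial E := Module.nontrivial_of_finrank_pos (R := ℝ) (by omega)
  rw [integrable_indicator_iff measurableSet_ball,
    integrableOn_fun_norm_addHaar volume (f := fun s : ℝ => (s ^ n)⁻¹), hE]
  refine (integrableOn_const (C := (1 : ℝ)) (by simp)).congr_fun (fun s hs => ?_)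
    measurableSet_Ioo
  simp [(pow_pos hs.1 n).ne']

theorem integrable_criterion [FiniteDimensional ℝ E] [MeasurableSpace E] [BorelSpace E]
    {n : ℕ} (hn : 1 ≤ n) (hE : Module.finrank ℝ E = n + 1) {f : E → ℝ} {L : ℝ} (hL : 0 ≤ L)
    (hf : ∀ y : E, y ≠ 0 → ‖fderiv ℝ f y‖ ≤ L / ‖y‖ ^ 2)
    {z ξ : E} (hz : ‖z‖ = 1) (hξ : ‖ξ‖ = 1) (hzξ : ⟪ξ, z⟫ = 0) :
    Integrable fun y : E => ⟪ξ, y⟫ * fderiv ℝ f y ξ / ‖z - y‖ ^ (n + 1) := by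
  have hG := integrable_indicator_norm_inv_pow hE (1 / 2)
  have hJ : Integrable fun y : E => (1 + ‖y‖) ^ (-((n : ℝ) + 2)) :=
    integrable_one_add_norm (by rw [hE]; push_cast; linarith)
  set G : E → ℝ := (ball (0 : E) (1 / 2)).indicator fun y => (‖y‖ ^ n)⁻¹ with hGdef
  have hG0 : ∀ y, 0 ≤ G y := fun y => indicator_nonneg (fun _ _ => by positivity) y
  refine Integrable.mono' (((hG.const_mul (L * 2 ^ (n + 1))).add
    ((hG.comp_sub_right z).const_mul (4 * L))).add (hJ.const_mul (L * 3 * 5 ^ (n + 1)))) ?_ ?_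
  · have := measurable_fderiv_apply_const ℝ f ξ
    exact Measurable.aestronglyMeasurable (by fun_prop)
  · refine Filter.Eventually.of_forall fun y => ?_
    have hJy : (1 + ‖y‖) ^ (-((n : ℝ) + 2)) = ((1 + ‖y‖) ^ (n + 2))⁻¹ := by
      rw [Real.rpow_neg (by positivity)]
      norm_cast
    simp only [Pi.add_apply, hJy]
    have hpA : 0 ≤ L * 2 ^ (n + 1) * G y := mul_nonneg (by positivity) (hG0 _)
    have hpB : 0 ≤ 4 * L * G (y - z) := mul_nonneg (by positivity) (hG0 _)
    have hpC : 0 ≤ L * 3 * 5 ^ (n + 1) * ((1 + ‖y‖) ^ (n + 2))⁻¹ := by positivity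
    rcases eq_or_ne y 0 with rfl | hy0
    · rw [inner_zero_right, zero_mul, zero_div, norm_zero]
      linarith
    have hb : 0 < ‖y‖ := norm_pos_iff.2 hy0
    have hder : |fderiv ℝ f y ξ| ≤ L / ‖y‖ ^ 2 := by
      simpa [hξ] using (fderiv ℝ f y).le_of_opNorm_le (hf y hy0) ξ
    have hin1 : |⟪ξ, y⟫| ≤ ‖y‖ := by simpa [hξ] using abs_real_inner_le_norm ξ y
    have hin2 : |⟪ξ, y⟫| ≤ ‖y - z‖ := by
      simpa [hξ, inner_sub_right, hzξ] using abs_real_inner_le_norm ξ (y - z)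
    have htri : ‖z‖ ≤ ‖y‖ + ‖y - z‖ := by
      simpa using norm_sub_le y (y - z)
    have htri2 : ‖y‖ ≤ ‖y - z‖ + ‖z‖ := by
      simpa using norm_add_le (y - z) z
    rw [hz] at htri htri2
    rw [norm_div, norm_mul, norm_pow, norm_norm, Real.norm_eq_abs, Real.norm_eq_abs, norm_sub_rev z]
    by_cases hA : ‖y‖ < 1 / 2
    · have hGy : G y = (‖y‖ ^ n)⁻¹ := indicator_of_mem (by simpa using hA) _
      have hd : 1 / 2 ≤ ‖y - z‖ := by linarith
      have hpow : ‖y‖ ^ n ≤ ‖y‖ := pow_le_of_le_one hb.le (by linarith) (by omega)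
      have : |⟪ξ, y⟫| * |fderiv ℝ f y ξ| / ‖y - z‖ ^ (n + 1) ≤ L * 2 ^ (n + 1) * G y := by
        calc _ ≤ ‖y‖ * (L / ‖y‖ ^ 2) / (1 / 2) ^ (n + 1) := by gcongr
          _ = L * 2 ^ (n + 1) * ‖y‖⁻¹ := by field_simp; simp
          _ ≤ L * 2 ^ (n + 1) * G y := by rw [hGy]; gcongr
      linarith
    · push Not at hA
      by_cases hB : ‖y - z‖ < 1 / 2
      · have hGy : G (y - z) = (‖y - z‖ ^ n)⁻¹ := indicator_of_mem (by simpa using hB) _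
        have : |⟪ξ, y⟫| * |fderiv ℝ f y ξ| / ‖y - z‖ ^ (n + 1) ≤ 4 * L * G (y - z) := by
          calc _ ≤ ‖y - z‖ * (L / (1 / 2) ^ 2) / ‖y - z‖ ^ (n + 1) := by
                gcongr
                exact hder.trans (by gcongr)
            _ = 4 * L * (‖y - z‖ / ‖y - z‖ ^ (n + 1)) := by ring
            _ ≤ 4 * L * G (y - z) := by
                rw [hGy]
                gcongr
                rcases (norm_nonneg (y - z)).eq_or_lt with h | h
                · rw [← h]; simp
                · rw [pow_succ]; field_simp; rfl
        linarith
      · push Not at hB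
        have hd : 0 < ‖y - z‖ := by linarith
        have : |⟪ξ, y⟫| * |fderiv ℝ f y ξ| / ‖y - z‖ ^ (n + 1) ≤
            L * 3 * 5 ^ (n + 1) * ((1 + ‖y‖) ^ (n + 2))⁻¹ := by
          calc _ ≤ ‖y‖ * (L / ‖y‖ ^ 2) / ((1 + ‖y‖) / 5) ^ (n + 1) := by
                gcongr
                linarith
            _ = L * 5 ^ (n + 1) * ‖y‖⁻¹ * ((1 + ‖y‖) ^ (n + 1))⁻¹ := by
                rw [div_pow]
                field_simp
            _ ≤ L * 5 ^ (n + 1) * ((1 + ‖y‖) / 3)⁻¹ * ((1 + ‖y‖) ^ (n + 1))⁻¹ := by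
                gcongr
                linarith
            _ = _ := by
                rw [pow_succ (1 + ‖y‖) (n + 1)]
                field_simp
        linarith

/-- Invariance of the domain of integration under an isometry `R` reduces the sign of an integral to
that of the `R`-symmetrized integrand. -/
theorem integral_neg_of_add_comp_isometry [FiniteDimensional ℝ E] [MeasurableSpace E]
    [BorelSpace E] (R : E ≃ₗᵢ[ℝ] E) {F : E → ℝ} (hF : Integrable F)
    (hle : ∀ᵐ y, F y + F (R y) ≤ 0) {U : Set E} (hU : IsOpen U) (hU' : U.Nonempty)
    (hlt : ∀ᵐ y, y ∈ U → F y + F (R y) < 0) : ∫ y, F y < 0 := by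
  have hFR : Integrable fun y => F (R y) := (integrable_comp R F).2 hF
  have hpos : 0 < ∫ y, -(F y + F (R y)) := by
    have hnonneg : 0 ≤ᵐ[volume] fun y => -(F y + F (R y)) := by
      filter_upwards [hle] with y hy using neg_nonneg.2 hy
    rw [integral_pos_iff_support_of_nonneg_ae hnonneg (hF.add hFR).neg]
    refine (hU.measure_pos volume hU').trans_le (measure_mono_ae ?_)
    filter_upwards [hlt] with y hy hyU
    exact neg_ne_zero.2 (hy hyU).ne
  rw [integral_neg, integral_add hF hFR, integral_comp R F] at hpos
  linarith

theorem integral_criterion_neg [FiniteDimensional ℝ E] [MeasurableSpace E] [BorelSpace E]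
    {n : ℕ} (hn : 1 ≤ n) (hE : Module.finrank ℝ E = n + 1) {f : E → ℝ} {K : NNReal}
    (hf_pos : ∀ x ∈ sphere (0 : E) 1, 0 < f x)
    (hf_lip : LipschitzOnWith K f (sphere (0 : E) 1))
    (hf_hom : ∀ t : ℝ, 0 < t → ∀ y : E, y ≠ 0 → f (t • y) = t⁻¹ * f y)
    {z ξ : E} (hz : ‖z‖ = 1) (hξ : ‖ξ‖ = 1) (hzξ : ⟪ξ, z⟫ = 0)
    (hf_mono : ∀ x : E, ⟪ξ, x⟫ = 0 →
      AntitoneOn (fun t : ℝ => f (x + t • ξ) + f (x - t • ξ)) (Ioi 0)) :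
    ∫ y : E, ⟪ξ, y⟫ * fderiv ℝ f y ξ / ‖z - y‖ ^ (n + 1) < 0 := by
  have : Nontrivial E := Module.nontrivial_of_finrank_pos (R := ℝ) (by omega)
  have hξS : ξ ∈ sphere (0 : E) 1 := by simpa using hξ
  have hcomp : IsCompact (sphere (0 : E) 1) := isCompact_sphere 0 1
  obtain ⟨M, hM⟩ := hcomp.exists_bound_of_continuousOn hf_lip.continuousOn
  obtain ⟨w, hw, hmin⟩ := hcomp.exists_isMinOn ⟨ξ, hξS⟩ hf_lip.continuousOn
  have hM0 : 0 ≤ M := (norm_nonneg _).trans (hM ξ hξS)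
  lift M to NNReal using hM0
  obtain ⟨C, hC⟩ : ∃ C : NNReal,
      ∀ x y : E, x ≠ 0 → y ≠ 0 → |f x - f y| ≤ C * ‖x - y‖ / (‖x‖ * ‖y‖) :=
    ⟨M + 2 * K, fun x y hx hy => by
      simpa using abs_sub_le_of_homogeneous hM hf_lip hf_hom hx hy⟩
  set R : E ≃ₗᵢ[ℝ] E := Submodule.reflection (ℝ ∙ ξ)ᗮ with hR
  have hRξ : R ξ = -ξ := Submodule.reflection_orthogonalComplement_singleton_eq_neg ξ
  have hRR : ∀ y, R (R y) = y := Submodule.reflection_reflection _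
  have hRz : R z = z := Submodule.reflection_mem_subspace_eq_self
    (Submodule.mem_orthogonal_singleton_iff_inner_right.2 hzξ)
  have hRinner : ∀ y, ⟪ξ, R y⟫ = -⟪ξ, y⟫ := fun y => by
    rw [← R.inner_map_map, hRR, hRξ, inner_neg_left]
  have hRnorm : ∀ y, ‖z - R y‖ = ‖z - y‖ := fun y => by
    rw [← R.norm_map (z - y), map_sub, hRz]
  have hRsub : ∀ y, ‖R y - -ξ‖ = ‖y - ξ‖ := fun y => by
    rw [← hRξ, ← map_sub, R.norm_map]
  have hsum : ∀ y, ⟪ξ, y⟫ * fderiv ℝ f y ξ / ‖z - y‖ ^ (n + 1) +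
      ⟪ξ, R y⟫ * fderiv ℝ f (R y) ξ / ‖z - R y‖ ^ (n + 1) =
      ⟪ξ, y⟫ * (fderiv ℝ f y ξ - fderiv ℝ f (R y) ξ) / ‖z - y‖ ^ (n + 1) := fun y => by
    rw [hRinner, hRnorm]; ring
  have hdiff : ∀ᵐ y : E, DifferentiableAt ℝ f y := ae_differentiableAt_of_homogeneous hC
  have hdiffR : ∀ᵐ y : E, DifferentiableAt ℝ f (R y) :=
    R.measurePreserving.quasiMeasurePreserving.ae hdiff
  have hkey : ∀ y, DifferentiableAt ℝ f y → DifferentiableAt ℝ f (R y) → 0 < ⟪ξ, y⟫ →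
      fderiv ℝ f y ξ - fderiv ℝ f (R y) ξ ≤ 0 := fun y h1 h2 ht => by
    set x : E := y - ⟪ξ, y⟫ • ξ with hx
    have hxξ : ⟪ξ, x⟫ = 0 := by
      rw [hx, inner_sub_right, inner_smul_right, real_inner_self_eq_norm_sq, hξ]; ring
    have hRx : R x = x := Submodule.reflection_mem_subspace_eq_self
      (Submodule.mem_orthogonal_singleton_iff_inner_right.2 hxξ)
    have hy : y = x + ⟪ξ, y⟫ • ξ := by rw [hx]; abel
    have hRy : R y = x - ⟪ξ, y⟫ • ξ := by
      conv_lhs => rw [hy]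
      rw [map_add, map_smul, hRx, hRξ, smul_neg, sub_eq_add_neg]
    rw [hRy] at h2 ⊢
    have := fderiv_sub_fderiv_nonpos_of_antitoneOn ht (hf_mono x hxξ) (by rwa [← hy]) h2
    rwa [← hy] at this
  have hm : 0 < f w := hf_pos w hw
  have hmin' : ∀ x ∈ sphere (0 : E) 1, f w ≤ f x := fun x hx => hmin hx
  set δ : ℝ := min (1 / 2) (f w / (8 * C + 1)) with hδ
  have hδ0 : 0 < δ := by positivity
  refine integral_neg_of_add_comp_isometry R
    (integrable_criterion hn hE (by positivity) (fun y hy => norm_fderiv_le_div_norm_sq hC hy)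
      hz hξ hzξ) ?_ (U := ball ξ δ) isOpen_ball ⟨ξ, mem_ball_self hδ0⟩ ?_
  · filter_upwards [hdiff, hdiffR] with y h1 h2
    rw [hsum]
    refine div_nonpos_of_nonpos_of_nonneg ?_ (by positivity)
    rcases lt_trichotomy ⟪ξ, y⟫ 0 with h | h | h
    · have := hkey (R y) h2 (by rwa [hRR]) (by rw [hRinner]; linarith)
      rw [hRR] at this
      exact mul_nonpos_of_nonpos_of_nonneg h.le (by linarith)
    · simp [h]
    · exact mul_nonpos_of_nonneg_of_nonpos h.le (hkey y h1 h2 h)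
  · filter_upwards [hdiff, hdiffR] with y h1 h2 hyU
    rw [hsum]
    rw [mem_ball, dist_eq_norm] at hyU
    have hd1 : ‖y - ξ‖ < 1 / 2 := hyU.trans_le (min_le_left _ _)
    have hd2 : (8 * C + 1) * ‖y - ξ‖ < f w := by
      have := hyU.trans_le (min_le_right _ _)
      rwa [lt_div_iff₀ (by positivity), mul_comm] at this
    have hinner : 0 < ⟪ξ, y⟫ := by
      have h := (abs_le.1 (abs_real_inner_le_norm ξ (y - ξ))).1
      rw [inner_sub_right, real_inner_self_eq_norm_sq, hξ] at h
      linarith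
    have hneg := fderiv_apply_neg_of_near hmin' hf_hom hC hξ hd1 hd2 h1
    have hposR := fderiv_apply_neg_of_near hmin' hf_hom hC (ξ := -ξ) (by simpa using hξ)
      (by rwa [hRsub]) (by rwa [hRsub]) h2
    rw [map_neg] at hposR
    have hzy : z - y ≠ 0 := fun h => by
      rw [← sub_eq_zero.1 h, hzξ] at hinner
      exact lt_irrefl _ hinner
    exact div_neg_of_neg_of_pos (mul_neg_of_pos_of_neg hinner (by linarith))
      (pow_pos (norm_pos_iff.2 hzy) _)

end HomogeneousFunctions

/-- under the monotonicity condition, the criterion integral is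
strictly negative. -/
theorem stmt_12 (n : ℕ) (hn : 2 ≤ n)
    (f : EuclideanSpace ℝ (Fin (n + 1)) → ℝ) (K : NNReal)
    (hf_pos : ∀ x ∈ sphere (0 : EuclideanSpace ℝ (Fin (n + 1))) 1, 0 < f x)
    (hf_lip : LipschitzOnWith K f (sphere (0 : EuclideanSpace ℝ (Fin (n + 1))) 1))
    (hf_hom : ∀ t : ℝ, 0 < t → ∀ y : EuclideanSpace ℝ (Fin (n + 1)), y ≠ 0 →
      f (t • y) = t⁻¹ * f y)
    (hf_mono : ∀ ξ ∈ sphere (0 : EuclideanSpace ℝ (Fin (n + 1))) 1,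
      ∀ x : EuclideanSpace ℝ (Fin (n + 1)), ⟪ξ, x⟫ = 0 →
        AntitoneOn (fun t : ℝ => f (x + t • ξ) + f (x - t • ξ)) (Set.Ioi 0)) :
    ∀ z ∈ sphere (0 : EuclideanSpace ℝ (Fin (n + 1))) 1,
      ∀ ξ ∈ sphere (0 : EuclideanSpace ℝ (Fin (n + 1))) 1, ⟪ξ, z⟫ = 0 →
        (∫ y : EuclideanSpace ℝ (Fin (n + 1)),
          ⟪ξ, y⟫ * fderiv ℝ f y ξ / ‖z - y‖ ^ (n + 1)) < 0 := by
  intro z hz ξ hξ hzξ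
  exact integral_criterion_neg (by omega) (by simp) hf_pos hf_lip hf_hom
    (by simpa using hz) (by simpa using hξ) hzξ (hf_mono ξ hξ)
end
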